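/- arXiv:2005.11370 — 6 statements merged into one kernel-verified Lean document; each statement's English description precedes it below -/
import Mathlib

section
/- If in the dynamic extension the dithers v_j^μ(t) are replaced by ṽ_j^μ(t) = (1/η)v_j^μ(t/η) with an additional time-scale parameter η > 0, then for every δ ∈ (0, √(σ₁₁/σ₁₂)·dist(x*, ∂D)) and every ρ > 0 there exist μ̄ > 0, a threshold ε̄(μ) > 0, and a threshold η̄(ε, μ) > 0, such that for all μ ∈ (0, μ̄], all ε ∈ (0, ε̄(μ)], and all η ≥ η̄(ε, μ), there exist β, λ > 0 such that every π_ε-solution (x(t), ξ(t)) of the closed-loop system with x(0) = ξ(0) = x⁰ ∈ B̄_δ(x*) satisfies ‖x(t) − x*‖ ≤ β‖x⁰ − x*‖e^{−λt/η} + ρ for all t ∈ [0, ∞). -/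
open Real Set Metric Matrix

noncomputable section

/-- The Lie bracket `[f,g](x) = Dg(x)·f(x) − Df(x)·g(x)` of vector fields on ℝⁿ. -/
def lieBracket {n : ℕ} (f g : EuclideanSpace ℝ (Fin n) → EuclideanSpace ℝ (Fin n))
    (x : EuclideanSpace ℝ (Fin n)) : EuclideanSpace ℝ (Fin n) :=
  fderiv ℝ g x (f x) - fderiv ℝ f x (g x)

/-- The `j`-th column of the matrix `F(x)`: the field `f_{i₁}(x)` for indices coming from
`S₁` and the bracket `[f_{j₁},f_{j₂}](x)` for indices coming from `S₂`, according to the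
enumeration `idx` of `S₁ ⊕ S₂` by `Fin n`. -/
def col {n m : ℕ} (f : Fin m → EuclideanSpace ℝ (Fin n) → EuclideanSpace ℝ (Fin n))
    (S₁ : Finset (Fin m)) (S₂ : Finset (Fin m × Fin m))
    (idx : (↥S₁ ⊕ ↥S₂) ≃ Fin n) (x : EuclideanSpace ℝ (Fin n)) (j : Fin n) :
    EuclideanSpace ℝ (Fin n) :=
  match idx.symm j with
  | Sum.inl i₁ => f i₁ x
  | Sum.inr p => lieBracket (f p.1.1) (f p.1.2) x

/-- The matrix `F(x)` whose columns are `f_{j₁}(x)` (`j₁ ∈ S₁`) and `[f_{j₁},f_{j₂}](x)`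
(`(j₁,j₂) ∈ S₂`). -/
def Fmat {n m : ℕ} (f : Fin m → EuclideanSpace ℝ (Fin n) → EuclideanSpace ℝ (Fin n))
    (S₁ : Finset (Fin m)) (S₂ : Finset (Fin m × Fin m))
    (idx : (↥S₁ ⊕ ↥S₂) ≃ Fin n) (x : EuclideanSpace ℝ (Fin n)) :
    Matrix (Fin n) (Fin n) ℝ :=
  Matrix.of fun i j => col f S₁ S₂ idx x j i

/-- The state-dependent coefficient vector `a(x,ξ) = −γ₁F(x)⁻¹(x − ξ)`. -/
def avec {n m : ℕ} (f : Fin m → EuclideanSpace ℝ (Fin n) → EuclideanSpace ℝ (Fin n))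
    (S₁ : Finset (Fin m)) (S₂ : Finset (Fin m × Fin m))
    (idx : (↥S₁ ⊕ ↥S₂) ≃ Fin n) (γ₁ : ℝ) (x ξ : EuclideanSpace ℝ (Fin n)) :
    Fin n → ℝ :=
  (-γ₁) • ((Fmat f S₁ S₂ idx x)⁻¹ *ᵥ (fun i => x i - ξ i))

/-- The sampled fast-oscillating stabilizing control
`φᵢ^ε(x,ξ,t) = Σ_{i₁∈S₁}a_{i₁}(x,ξ)δ_{ii₁} + √(4π/ε)Σ_{(i₁,i₂)∈S₂}√(κ_{i₁i₂}|a_{i₁i₂}(x,ξ)|)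
(δ_{ii₁}sign(a_{i₁i₂}(x,ξ))cos(2πκ_{i₁i₂}t/ε) + δ_{ii₂}sin(2πκ_{i₁i₂}t/ε))`. -/
def ctrl {n m : ℕ} (f : Fin m → EuclideanSpace ℝ (Fin n) → EuclideanSpace ℝ (Fin n))
    (S₁ : Finset (Fin m)) (S₂ : Finset (Fin m × Fin m))
    (idx : (↥S₁ ⊕ ↥S₂) ≃ Fin n) (κ : Fin m × Fin m → ℕ) (γ₁ ε : ℝ)
    (x ξ : EuclideanSpace ℝ (Fin n)) (i : Fin m) (t : ℝ) : ℝ :=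
  (∑ i₁ ∈ S₁.attach, avec f S₁ S₂ idx γ₁ x ξ (idx (Sum.inl i₁)) * (if i = ↑i₁ then 1 else 0))
  + Real.sqrt (4 * π / ε) * ∑ p ∈ S₂.attach,
      Real.sqrt (κ p.1 * |avec f S₁ S₂ idx γ₁ x ξ (idx (Sum.inr p))|) *
        ((if i = p.1.1 then (1:ℝ) else 0) * Real.sign (avec f S₁ S₂ idx γ₁ x ξ (idx (Sum.inr p))) *
            Real.cos (2 * π * κ p.1 * t / ε) +
          (if i = p.1.2 then (1:ℝ) else 0) * Real.sin (2 * π * κ p.1 * t / ε))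

/-- The dithers `v_j^μ` of the extremum-seeking dynamic extension: `√(4πk_j/μ)cos(2πk_jt/μ)`
for the first `n` indices and `√(4πk_j/μ)sin(2πk_jt/μ)` for the last `n` indices. -/
def dither {n : ℕ} (k : Fin n → ℕ) (μ : ℝ) : (Fin n ⊕ Fin n) → ℝ → ℝ
  | Sum.inl j, t => Real.sqrt (4 * π * k j / μ) * Real.cos (2 * π * k j * t / μ)
  | Sum.inr j, t => Real.sqrt (4 * π * k j / μ) * Real.sin (2 * π * k j * t / μ)

/-- The vector field `g_j(J(x))e_j` of the dynamic extension (`e_j` is the `j`-th standard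
basis vector for `j ≤ n` and the `(j−n)`-th one for `n+1 ≤ j ≤ 2n`). -/
def Gfield {n : ℕ} (g : Fin n ⊕ Fin n → ℝ → ℝ) (J : EuclideanSpace ℝ (Fin n) → ℝ)
    (j : Fin n ⊕ Fin n) (x : EuclideanSpace ℝ (Fin n)) : EuclideanSpace ℝ (Fin n) :=
  g j (J x) • EuclideanSpace.single (Sum.elim id id j) (1 : ℝ)

lemma es_avg_abstract {E : Type*} [NormedAddCommGroup E] [NormedSpace ℝ E]
    {I : Type*} [Fintype I] (u U : I → ℝ → ℝ) (W : I → I → ℝ → ℝ)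
    (t0 t1 : ℝ) (h01 : t0 ≤ t1)
    (hU : ∀ i t, HasDerivAt (U i) (u i t) t)
    (hW : ∀ i j t, HasDerivAt (W i j) (u i t * U j t) t)
    (hU0 : ∀ i, U i t0 = 0) (hW0 : ∀ i j, W i j t0 = 0)
    (c : ℝ) (hc : 0 ≤ c) (huc : ∀ i t, |u i t| ≤ c)
    (y : ℝ → E) (hy : ContinuousOn y (Icc t0 t1)) (b : E) (w : ℝ → E)
    (Z : I → E → E) (A : I → E →L[ℝ] E)
    (hyd : ∀ t ∈ Ico t0 t1, HasDerivWithinAt y (b + w t + ∑ i, u i t • Z i (y t)) (Ici t) t)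
    (B w0 w1 M L ν d : ℝ) (hB0 : 0 ≤ B) (hM : 0 ≤ M) (hL : 0 ≤ L) (hν : 0 ≤ ν)
    (hw10 : 0 ≤ w1)
    (hB : ∀ t ∈ Ico t0 t1, ‖b + w t‖ ≤ B)
    (hw : ∀ t ∈ Ico t0 t1, ‖w t‖ ≤ w0 + w1 * ‖y t - y t0‖)
    (hZ : ∀ i, ∀ t ∈ Ico t0 t1, ‖Z i (y t)‖ ≤ M)
    (hA : ∀ i, ‖A i‖ ≤ L)
    (hd : d = (t1 - t0) * (B + Fintype.card I * c * M))
    (hν' : (∀ t ∈ Icc t0 t1, ‖y t - y t0‖ ≤ d) → ∀ i, ∀ t ∈ Ico t0 t1,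
      ‖Z i (y t) - Z i (y t0) - A i (y t - y t0)‖ ≤ ν * ‖y t - y t0‖) :
    (∀ t ∈ Icc t0 t1, ‖y t - y t0‖ ≤ d) ∧
    ‖y t1 - y t0 - (t1 - t0) • b - ∑ j, U j t1 • Z j (y t0)
        - ∑ i, ∑ j, W i j t1 • A i (Z j (y t0))‖ ≤
      (t1 - t0) * (w0 + w1 * d + Fintype.card I * c * (ν * d + L * ((t1 - t0) *
        (B + Fintype.card I * c * ((L + ν) * d))))) := by
  set N : ℝ := (Fintype.card I : ℝ) with hN
  have hN0 : 0 ≤ N := by positivity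
  have hh : 0 ≤ t1 - t0 := by linarith
  have hsum : ∀ (t : ℝ) (v : I → E) (m : ℝ), (∀ i, ‖v i‖ ≤ m) →
      ‖∑ i, u i t • v i‖ ≤ N * c * m := by
    intro t v m hv
    calc ‖∑ i, u i t • v i‖ ≤ ∑ i : I, c * m := by
          refine norm_sum_le_of_le _ fun i _ => ?_
          rw [norm_smul, Real.norm_eq_abs]
          exact mul_le_mul (huc i t) (hv i) (norm_nonneg _) hc
      _ = N * c * m := by simp [hN, Finset.card_univ]; ring
  have hd0 : 0 ≤ d := by rw [hd]; positivity
  have hdb : ∀ t ∈ Icc t0 t1, ‖y t - y t0‖ ≤ d := by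
    intro t ht
    have := norm_image_sub_le_of_norm_deriv_right_le_segment hy hyd (C := B + N * c * M)
      (fun s hs => (norm_add_le _ _).trans
        (add_le_add (hB s hs) (hsum s _ M (fun i => hZ i s hs)))) t ht
    refine this.trans ?_
    rw [hd, mul_comm]
    exact mul_le_mul_of_nonneg_right (by linarith [ht.2]) (by positivity)
  refine ⟨hdb, ?_⟩
  have hν2 := hν' hdb
  have hIcc : ∀ t ∈ Ico t0 t1, t ∈ Icc t0 t1 := fun t ht => ⟨ht.1, ht.2.le⟩
  have hUc : ∀ i, Continuous (U i) := fun i =>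
    continuous_iff_continuousAt.2 fun t => (hU i t).continuousAt
  have hWc : ∀ i j, Continuous (W i j) := fun i j =>
    continuous_iff_continuousAt.2 fun t => (hW i j t).continuousAt
  -- first-order remainder
  have hlip : ∀ i, ∀ t ∈ Ico t0 t1, ‖Z i (y t) - Z i (y t0)‖ ≤ (L + ν) * d := by
    intro i t ht
    have h1 := hν2 i t ht
    have h2 : ‖A i (y t - y t0)‖ ≤ L * ‖y t - y t0‖ := (A i).le_of_opNorm_le (hA i) _
    have h3 : Z i (y t) - Z i (y t0) =
      (Z i (y t) - Z i (y t0) - A i (y t - y t0)) + A i (y t - y t0) := by abel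
    rw [h3]
    have h4 := hdb t (hIcc t ht)
    calc _ ≤ ν * ‖y t - y t0‖ + L * ‖y t - y t0‖ := norm_add_le_of_le h1 h2
      _ = (L + ν) * ‖y t - y t0‖ := by ring
      _ ≤ _ := by gcongr
  have hr1 : ∀ t ∈ Icc t0 t1, ‖y t - y t0 - ∑ j, U j t • Z j (y t0)‖ ≤
      (t1 - t0) * (B + N * c * ((L + ν) * d)) := by
    intro t ht
    have hder : ∀ s ∈ Ico t0 t1, HasDerivWithinAt (fun s => y s - ∑ j, U j s • Z j (y t0))
        (b + w s + ∑ i, u i s • (Z i (y s) - Z i (y t0))) (Ici s) s := by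
      intro s hs
      have := (hyd s hs).sub (HasDerivWithinAt.fun_sum (u := Finset.univ)
        (fun i _ => ((hU i s).hasDerivWithinAt (s := Ici s)).smul_const (Z i (y t0))))
      refine HasDerivWithinAt.congr_deriv (f := fun s => y s - ∑ j, U j s • Z j (y t0)) this ?_
      simp only [smul_sub, Finset.sum_sub_distrib]; abel
    have := norm_image_sub_le_of_norm_deriv_right_le_segment
      (f := fun s => y s - ∑ j, U j s • Z j (y t0)) (C := B + N * c * ((L + ν) * d))
      (hy.sub (Continuous.continuousOn (by fun_prop))) hder
      (fun s hs => (norm_add_le _ _).trans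
        (add_le_add (hB s hs) (hsum s _ _ (fun i => hlip i s hs)))) t ht
    simp only [hU0, zero_smul, Finset.sum_const_zero, sub_zero] at this
    rw [sub_right_comm] at this
    refine this.trans ?_
    rw [mul_comm]
    exact mul_le_mul_of_nonneg_right (by linarith [ht.2]) (by positivity)
  have hder : ∀ s ∈ Ico t0 t1, HasDerivWithinAt (fun s => y s - s • b - ∑ j, U j s • Z j (y t0)
        - ∑ i, ∑ j, W i j s • A i (Z j (y t0)))
        (w s + ∑ i, u i s • ((Z i (y s) - Z i (y t0) - A i (y s - y t0)) +
          A i (y s - y t0 - ∑ j, U j s • Z j (y t0)))) (Ici s) s := by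
    intro s hs
    have := (((hyd s hs).sub ((hasDerivWithinAt_id s (Ici s)).smul_const b)).sub
      (HasDerivWithinAt.fun_sum (u := Finset.univ)
        (fun i _ => ((hU i s).hasDerivWithinAt (s := Ici s)).smul_const (Z i (y t0))))).sub
      (HasDerivWithinAt.fun_sum (u := Finset.univ) (fun i _ =>
        (HasDerivWithinAt.fun_sum (u := Finset.univ) (fun j _ =>
          ((hW i j s).hasDerivWithinAt (s := Ici s)).smul_const (A i (Z j (y t0)))))))
    refine HasDerivWithinAt.congr_deriv (f := fun s => y s - s • b - ∑ j, U j s • Z j (y t0)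
        - ∑ i, ∑ j, W i j s • A i (Z j (y t0))) this ?_
    have e : ∀ i, u i s • ((Z i (y s) - Z i (y t0) - A i (y s - y t0)) +
          A i (y s - y t0 - ∑ j, U j s • Z j (y t0))) =
        u i s • Z i (y s) - u i s • Z i (y t0) - ∑ j, (u i s * U j s) • A i (Z j (y t0)) := by
      intro i
      rw [map_sub (A i) (y s - y t0), map_sum]
      simp only [map_smul, mul_smul, ← Finset.smul_sum]
      module
    simp only [e, Finset.sum_sub_distrib, one_smul]
    abel
  have := norm_image_sub_le_of_norm_deriv_right_le_segment
      (f := fun s => y s - s • b - ∑ j, U j s • Z j (y t0)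
        - ∑ i, ∑ j, W i j s • A i (Z j (y t0)))
      (C := w0 + w1 * d + N * c * (ν * d + L * ((t1 - t0) *
        (B + N * c * ((L + ν) * d)))))
      (((hy.sub (Continuous.continuousOn (by fun_prop))).sub
        (Continuous.continuousOn (by fun_prop))).sub
        (Continuous.continuousOn (by fun_prop))) hder
      (fun s hs => by
        have h4 := hdb s (hIcc s hs)
        refine (norm_add_le _ _).trans (add_le_add ((hw s hs).trans ?_) (hsum s _ _ (fun i => ?_)))
        · gcongr
        · refine norm_add_le_of_le ((hν2 i s hs).trans (by gcongr)) ?_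
          refine ((A i).le_of_opNorm_le (hA i) _).trans ?_
          exact mul_le_mul_of_nonneg_left (hr1 s (hIcc s hs)) hL) t1 ⟨h01, le_rfl⟩
  simp only [hU0, hW0, zero_smul, Finset.sum_const_zero, sub_zero] at this
  rw [mul_comm (t1 - t0)]
  refine le_trans (le_of_eq ?_) this
  congr 1
  rw [sub_smul]; abel

/-- Uniform first-order expansion on a convex compact set. -/
lemma es_unifC1 {E F : Type*} [NormedAddCommGroup E] [NormedSpace ℝ E]
    [NormedAddCommGroup F] [NormedSpace ℝ F]
    (f : E → F) (D K : Set E) (hKD : K ⊆ D) (hK : IsCompact K)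
    (hKc : Convex ℝ K) (hf : ∀ x ∈ D, DifferentiableAt ℝ f x)
    (hf' : ContinuousOn (fderiv ℝ f) D) (ν : ℝ) (hν : 0 < ν) :
    ∃ r > 0, ∀ y ∈ K, ∀ x ∈ K, ‖x - y‖ ≤ r →
      ‖f x - f y - fderiv ℝ f y (x - y)‖ ≤ ν * ‖x - y‖ := by
  have huc := hK.uniformContinuousOn_of_continuous (hf'.mono hKD)
  rw [Metric.uniformContinuousOn_iff] at huc
  obtain ⟨r, hr, h⟩ := huc ν hν
  refine ⟨r / 2, by positivity, fun y hy x hx hxy => ?_⟩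
  have hseg : segment ℝ y x ⊆ K := hKc.segment_subset hy hx
  refine (convex_segment y x).norm_image_sub_le_of_norm_hasFDerivWithin_le'
    (f' := fderiv ℝ f) (fun z hz => (hf z (hKD (hseg hz))).hasFDerivAt.hasFDerivWithinAt)
    (fun z hz => ?_) (left_mem_segment ℝ y x) (right_mem_segment ℝ y x)
  have hd : dist z y < r := by
    have : ‖z - y‖ ≤ ‖x - y‖ := by
      obtain ⟨s, hs, rfl⟩ := (segment_eq_image' ℝ y x) ▸ hz
      rw [add_sub_cancel_left, norm_smul, Real.norm_eq_abs, abs_of_nonneg hs.1]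
      exact mul_le_of_le_one_left (norm_nonneg _) hs.2
    rw [dist_eq_norm]; linarith
  have := h z (hseg hz) y hy hd
  rw [dist_eq_norm] at this
  exact this.le

lemma es_cos_end (z : ℤ) (h : ℝ) (hh : 0 < h) (j : ℕ) : Real.cos (2 * π * z * (h * j) / h) = 1 := by
  have : 2 * π * z * (h * j) / h = ((z * j : ℤ) : ℝ) * (2 * π) := by
    push_cast; field_simp
  rw [this, Real.cos_int_mul_two_pi]

lemma es_sin_end (z : ℤ) (h : ℝ) (hh : 0 < h) (j : ℕ) : Real.sin (2 * π * z * (h * j) / h) = 0 := by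
  have : 2 * π * z * (h * j) / h = ((2 * z * j : ℤ) : ℝ) * π := by
    push_cast; field_simp
  rw [this, Real.sin_int_mul_pi]

lemma es_int_cos (z : ℤ) (hz : z ≠ 0) (h : ℝ) (hh : 0 < h) (j : ℕ) :
    ∫ t in (h * j)..(h * (j + 1)), Real.cos (2 * π * z * t / h) = 0 := by
  have hz' : (z : ℝ) ≠ 0 := by exact_mod_cast hz
  have := intervalIntegral.integral_eq_sub_of_hasDerivAt
    (f := fun t => h / (2 * π * z) * Real.sin (2 * π * z * t / h))
    (f' := fun t => Real.cos (2 * π * z * t / h)) (a := h * j) (b := h * (j + 1))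
    (fun t _ => by
      have h1 : HasDerivAt (fun t : ℝ => 2 * π * z * t / h) (2 * π * z * 1 / h) t :=
        ((hasDerivAt_id t).const_mul _).div_const h
      have h2 := (h1.sin).const_mul (h / (2 * π * z))
      refine h2.congr_deriv ?_
      field_simp)
    (Continuous.intervalIntegrable (by fun_prop) _ _)
  rw [this]
  have e1 := es_sin_end z h hh j
  have e2 := es_sin_end z h hh (j + 1)
  push_cast at e2
  simp [e1, e2]

lemma es_int_sin (z : ℤ) (h : ℝ) (hh : 0 < h) (j : ℕ) :
    ∫ t in (h * j)..(h * (j + 1)), Real.sin (2 * π * z * t / h) = 0 := by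
  rcases eq_or_ne z 0 with rfl | hz
  · simp
  have hz' : (z : ℝ) ≠ 0 := by exact_mod_cast hz
  have := intervalIntegral.integral_eq_sub_of_hasDerivAt
    (f := fun t => -(h / (2 * π * z)) * Real.cos (2 * π * z * t / h))
    (f' := fun t => Real.sin (2 * π * z * t / h)) (a := h * j) (b := h * (j + 1))
    (fun t _ => by
      have h1 : HasDerivAt (fun t : ℝ => 2 * π * z * t / h) (2 * π * z * 1 / h) t :=
        ((hasDerivAt_id t).const_mul _).div_const h
      have h2 := (h1.cos).const_mul (-(h / (2 * π * z)))
      refine h2.congr_deriv ?_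
      field_simp)
    (Continuous.intervalIntegrable (by fun_prop) _ _)
  rw [this]
  have e1 := es_cos_end z h hh j
  have e2 := es_cos_end z h hh (j + 1)
  push_cast at e2
  simp [e1, e2]

lemma es_int_sin_cos (p q : ℕ) (h : ℝ) (hh : 0 < h) (j : ℕ) :
    ∫ t in (h * j)..(h * (j + 1)), Real.sin (2 * π * p * t / h) * Real.cos (2 * π * q * t / h) = 0 := by
  have e : ∀ t : ℝ, Real.sin (2 * π * p * t / h) * Real.cos (2 * π * q * t / h) =
      (1/2) * Real.sin (2 * π * ((p + q : ℤ) : ℝ) * t / h) +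
      (1/2) * Real.sin (2 * π * ((p - q : ℤ) : ℝ) * t / h) := by
    intro t
    have h1 : 2 * π * ((p + q : ℤ) : ℝ) * t / h = 2 * π * p * t / h + 2 * π * q * t / h := by
      push_cast; ring
    have h2 : 2 * π * ((p - q : ℤ) : ℝ) * t / h = 2 * π * p * t / h - 2 * π * q * t / h := by
      push_cast; ring
    rw [h1, h2, Real.sin_add, Real.sin_sub]; ring
  simp_rw [e]
  rw [intervalIntegral.integral_add (Continuous.intervalIntegrable (by fun_prop) _ _)
    (Continuous.intervalIntegrable (by fun_prop) _ _)]
  simp only [intervalIntegral.integral_const_mul]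
  rw [es_int_sin _ h hh, es_int_sin _ h hh]; simp

lemma es_int_cos_cos (p q : ℕ) (hp : 0 < p) (h : ℝ) (hh : 0 < h) (j : ℕ) :
    ∫ t in (h * j)..(h * (j + 1)), Real.cos (2 * π * p * t / h) * Real.cos (2 * π * q * t / h) =
      if p = q then h / 2 else 0 := by
  have e : ∀ t : ℝ, Real.cos (2 * π * p * t / h) * Real.cos (2 * π * q * t / h) =
      (1/2) * Real.cos (2 * π * ((p + q : ℤ) : ℝ) * t / h) +
      (1/2) * Real.cos (2 * π * ((p - q : ℤ) : ℝ) * t / h) := by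
    intro t
    have h1 : 2 * π * ((p + q : ℤ) : ℝ) * t / h = 2 * π * p * t / h + 2 * π * q * t / h := by
      push_cast; ring
    have h2 : 2 * π * ((p - q : ℤ) : ℝ) * t / h = 2 * π * p * t / h - 2 * π * q * t / h := by
      push_cast; ring
    rw [h1, h2, Real.cos_add, Real.cos_sub]; ring
  simp_rw [e]
  rw [intervalIntegral.integral_add (Continuous.intervalIntegrable (by fun_prop) _ _)
    (Continuous.intervalIntegrable (by fun_prop) _ _)]
  simp only [intervalIntegral.integral_const_mul]
  rw [es_int_cos (p + q) (by omega) h hh]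
  split_ifs with hpq
  · subst hpq; simp; ring
  · rw [es_int_cos (p - q) (by omega) h hh]; simp

lemma es_int_sin_sin (p q : ℕ) (hp : 0 < p) (h : ℝ) (hh : 0 < h) (j : ℕ) :
    ∫ t in (h * j)..(h * (j + 1)), Real.sin (2 * π * p * t / h) * Real.sin (2 * π * q * t / h) =
      if p = q then h / 2 else 0 := by
  have e : ∀ t : ℝ, Real.sin (2 * π * p * t / h) * Real.sin (2 * π * q * t / h) =
      (-1/2) * Real.cos (2 * π * ((p + q : ℤ) : ℝ) * t / h) +
      (1/2) * Real.cos (2 * π * ((p - q : ℤ) : ℝ) * t / h) := by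
    intro t
    have h1 : 2 * π * ((p + q : ℤ) : ℝ) * t / h = 2 * π * p * t / h + 2 * π * q * t / h := by
      push_cast; ring
    have h2 : 2 * π * ((p - q : ℤ) : ℝ) * t / h = 2 * π * p * t / h - 2 * π * q * t / h := by
      push_cast; ring
    rw [h1, h2, Real.cos_add, Real.cos_sub]; ring
  simp_rw [e]
  rw [intervalIntegral.integral_add (Continuous.intervalIntegrable (by fun_prop) _ _)
    (Continuous.intervalIntegrable (by fun_prop) _ _)]
  simp only [intervalIntegral.integral_const_mul]
  rw [es_int_cos (p + q) (by omega) h hh]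
  split_ifs with hpq
  · subst hpq; simp; ring
  · rw [es_int_cos (p - q) (by omega) h hh]; simp

/-- The trigonometric controls. -/
def esU {P : Type*} (κ : P → ℕ) (a b : P → ℝ) (h : ℝ) : P ⊕ P → ℝ → ℝ
  | Sum.inl p, t => a p * Real.cos (2 * π * κ p * t / h)
  | Sum.inr p, t => b p * Real.sin (2 * π * κ p * t / h)

/-- Primitives of the trigonometric controls. -/
def esV {P : Type*} (κ : P → ℕ) (a b : P → ℝ) (h : ℝ) : P ⊕ P → ℝ → ℝ
  | Sum.inl p, t => a p * (h / (2 * π * κ p)) * Real.sin (2 * π * κ p * t / h)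
  | Sum.inr p, t => b p * (h / (2 * π * κ p)) * (1 - Real.cos (2 * π * κ p * t / h))

lemma esU_cont {P : Type*} (κ : P → ℕ) (a b : P → ℝ) (h : ℝ) (i : P ⊕ P) :
    Continuous (esU κ a b h i) := by
  rcases i with p | p
  · show Continuous (fun t => a p * Real.cos (2 * π * κ p * t / h)); fun_prop
  · show Continuous (fun t => b p * Real.sin (2 * π * κ p * t / h)); fun_prop

lemma esV_deriv {P : Type*} (κ : P → ℕ) (hκ : ∀ p, 0 < κ p) (a b : P → ℝ) (h : ℝ) (hh : 0 < h)
    (i : P ⊕ P) (t : ℝ) : HasDerivAt (esV κ a b h i) (esU κ a b h i t) t := by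
  rcases i with p | p
  all_goals
    have hp : (κ p : ℝ) ≠ 0 := by exact_mod_cast (hκ p).ne'
    have h1 : HasDerivAt (fun t : ℝ => 2 * π * κ p * t / h) (2 * π * κ p * 1 / h) t :=
      ((hasDerivAt_id t).const_mul _).div_const h
  · have h2 := (h1.sin).const_mul (a p * (h / (2 * π * κ p)))
    refine HasDerivAt.congr_deriv (f := fun t => a p * (h / (2 * π * κ p)) * Real.sin (2 * π * κ p * t / h)) h2 ?_
    simp only [esU]; field_simp
  · have h2 := ((h1.cos).const_sub 1).const_mul (b p * (h / (2 * π * κ p)))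
    refine HasDerivAt.congr_deriv (f := fun t => b p * (h / (2 * π * κ p)) * (1 - Real.cos (2 * π * κ p * t / h))) h2 ?_
    simp only [esU]; field_simp

lemma esV_end {P : Type*} (κ : P → ℕ) (a b : P → ℝ) (h : ℝ) (hh : 0 < h)
    (i : P ⊕ P) (j : ℕ) : esV κ a b h i (h * j) = 0 := by
  rcases i with p | p
  · have := es_sin_end (κ p) h hh j
    push_cast at this
    simp [esV, this]
  · have := es_cos_end (κ p) h hh j
    push_cast at this
    simp [esV, this]

lemma esW_sum {P : Type*} [Fintype P] (κ : P → ℕ) (hκ : ∀ p, 0 < κ p)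
    (hκi : Function.Injective κ) (a b : P → ℝ) (h : ℝ) (hh : 0 < h) (j : ℕ)
    {E : Type*} [AddCommGroup E] [Module ℝ E] (v : P ⊕ P → P ⊕ P → E) :
    ∑ i, ∑ l, (∫ t in (h * j)..(h * (j + 1)), esU κ a b h i t * esV κ a b h l t) • v i l =
      ∑ p, (a p * b p * h ^ 2 / (4 * π * κ p)) • (v (Sum.inr p) (Sum.inl p)
        - v (Sum.inl p) (Sum.inr p)) := by
  classical
  have e1 : ∀ p q, ∫ t in (h * j)..(h * (j + 1)), esU κ a b h (Sum.inl p) t *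
      esV κ a b h (Sum.inl q) t = 0 := by
    intro p q
    have : ∀ t, esU κ a b h (Sum.inl p) t * esV κ a b h (Sum.inl q) t =
      (a p * a q * (h / (2 * π * κ q))) * (Real.sin (2 * π * κ q * t / h) *
        Real.cos (2 * π * κ p * t / h)) := by intro t; simp only [esU, esV]; ring
    simp_rw [this]
    rw [intervalIntegral.integral_const_mul, es_int_sin_cos _ _ h hh, mul_zero]
  have e2 : ∀ p q, ∫ t in (h * j)..(h * (j + 1)), esU κ a b h (Sum.inl p) t *
      esV κ a b h (Sum.inr q) t = if p = q then -(a p * b p * h ^ 2 / (4 * π * κ p)) else 0 := by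
    intro p q
    have : ∀ t, esU κ a b h (Sum.inl p) t * esV κ a b h (Sum.inr q) t =
      (a p * b q * (h / (2 * π * κ q))) * (Real.cos (2 * π * ((κ p : ℤ) : ℝ) * t / h)) -
      (a p * b q * (h / (2 * π * κ q))) * (Real.cos (2 * π * κ p * t / h) *
        Real.cos (2 * π * κ q * t / h)) := by intro t; simp only [esU, esV]; push_cast; ring
    simp_rw [this]
    rw [intervalIntegral.integral_sub (Continuous.intervalIntegrable (by fun_prop) _ _)
      (Continuous.intervalIntegrable (by fun_prop) _ _),
      intervalIntegral.integral_const_mul, intervalIntegral.integral_const_mul,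
      es_int_cos _ (by exact_mod_cast (hκ p).ne') h hh, es_int_cos_cos _ _ (hκ p) h hh]
    by_cases hpq : p = q
    · subst hpq
      have hp : (κ p : ℝ) ≠ 0 := by exact_mod_cast (hκ p).ne'
      simp; field_simp; ring
    · simp [hpq, hκi.ne hpq]
  have e3 : ∀ p q, ∫ t in (h * j)..(h * (j + 1)), esU κ a b h (Sum.inr p) t *
      esV κ a b h (Sum.inl q) t = if p = q then (a p * b p * h ^ 2 / (4 * π * κ p)) else 0 := by
    intro p q
    have : ∀ t, esU κ a b h (Sum.inr p) t * esV κ a b h (Sum.inl q) t =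
      (b p * a q * (h / (2 * π * κ q))) * (Real.sin (2 * π * κ p * t / h) *
        Real.sin (2 * π * κ q * t / h)) := by intro t; simp only [esU, esV]; ring
    simp_rw [this]
    rw [intervalIntegral.integral_const_mul, es_int_sin_sin _ _ (hκ p) h hh]
    by_cases hpq : p = q
    · subst hpq
      have hp : (κ p : ℝ) ≠ 0 := by exact_mod_cast (hκ p).ne'
      simp; field_simp; ring
    · simp [hpq, hκi.ne hpq]
  have e4 : ∀ p q, ∫ t in (h * j)..(h * (j + 1)), esU κ a b h (Sum.inr p) t *
      esV κ a b h (Sum.inr q) t = 0 := by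
    intro p q
    have : ∀ t, esU κ a b h (Sum.inr p) t * esV κ a b h (Sum.inr q) t =
      (b p * b q * (h / (2 * π * κ q))) * (Real.sin (2 * π * ((κ p : ℤ) : ℝ) * t / h)) -
      (b p * b q * (h / (2 * π * κ q))) * (Real.sin (2 * π * κ p * t / h) *
        Real.cos (2 * π * κ q * t / h)) := by intro t; simp only [esU, esV]; push_cast; ring
    simp_rw [this]
    rw [intervalIntegral.integral_sub (Continuous.intervalIntegrable (by fun_prop) _ _)
      (Continuous.intervalIntegrable (by fun_prop) _ _),
      intervalIntegral.integral_const_mul, intervalIntegral.integral_const_mul,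
      es_int_sin _ h hh, es_int_sin_cos _ _ h hh]
    simp
  simp only [Fintype.sum_sum_type, e1, e2, e3, e4, zero_smul, ite_smul, Finset.sum_const_zero,
    zero_add, add_zero, Finset.sum_ite_eq, Finset.mem_univ, if_true]
  rw [← Finset.sum_add_distrib]
  refine Finset.sum_congr rfl fun p _ => ?_
  module

/-- Second-order averaging over one period with trigonometric inputs. -/
lemma es_avg_trig {E : Type*} [NormedAddCommGroup E] [NormedSpace ℝ E]
    {P : Type*} [Fintype P] (κ : P → ℕ) (hκ : ∀ p, 0 < κ p)
    (hκi : Function.Injective κ) (a a' : P → ℝ) (h : ℝ) (hh : 0 < h) (k : ℕ)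
    (c : ℝ) (hc : 0 ≤ c) (hac : ∀ p, |a p| ≤ c) (hac' : ∀ p, |a' p| ≤ c)
    (y : ℝ → E) (hy : ContinuousOn y (Icc (h * k) (h * (k + 1)))) (b : E) (w : ℝ → E)
    (Z : P ⊕ P → E → E) (A : P ⊕ P → E →L[ℝ] E)
    (hyd : ∀ t ∈ Ico (h * k) (h * (k + 1)),
      HasDerivWithinAt y (b + w t + ∑ i, esU κ a a' h i t • Z i (y t)) (Ici t) t)
    (B w0 w1 M L ν d : ℝ) (hB0 : 0 ≤ B) (hM : 0 ≤ M) (hL : 0 ≤ L) (hν : 0 ≤ ν)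
    (hw10 : 0 ≤ w1)
    (hB : ∀ t ∈ Ico (h * k) (h * (k + 1)), ‖b + w t‖ ≤ B)
    (hw : ∀ t ∈ Ico (h * k) (h * (k + 1)), ‖w t‖ ≤ w0 + w1 * ‖y t - y (h * k)‖)
    (hZ : ∀ i, ∀ t ∈ Ico (h * k) (h * (k + 1)), ‖Z i (y t)‖ ≤ M)
    (hA : ∀ i, ‖A i‖ ≤ L)
    (hd : d = h * (B + Fintype.card (P ⊕ P) * c * M))
    (hν' : (∀ t ∈ Icc (h * k) (h * (k + 1)), ‖y t - y (h * k)‖ ≤ d) →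
      ∀ i, ∀ t ∈ Ico (h * k) (h * (k + 1)),
      ‖Z i (y t) - Z i (y (h * k)) - A i (y t - y (h * k))‖ ≤ ν * ‖y t - y (h * k)‖) :
    (∀ t ∈ Icc (h * k) (h * (k + 1)), ‖y t - y (h * k)‖ ≤ d) ∧
    ‖y (h * (k + 1)) - y (h * k) - h • b - ∑ p, (a p * a' p * h ^ 2 / (4 * π * κ p)) •
        (A (Sum.inr p) (Z (Sum.inl p) (y (h * k))) - A (Sum.inl p) (Z (Sum.inr p) (y (h * k))))‖ ≤
      h * (w0 + w1 * d + Fintype.card (P ⊕ P) * c * (ν * d + L * (h *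
        (B + Fintype.card (P ⊕ P) * c * ((L + ν) * d))))) := by
  have hlen : h * (k + 1) - h * k = h := by ring
  have hVc : ∀ i, Continuous (esV κ a a' h i) := fun i =>
    continuous_iff_continuousAt.2 fun t => (esV_deriv κ hκ a a' h hh i t).continuousAt
  have key := es_avg_abstract (esU κ a a' h) (esV κ a a' h)
    (fun i l t => ∫ s in (h * k)..t, esU κ a a' h i s * esV κ a a' h l s)
    (h * k) (h * (k + 1)) (by linarith) (esV_deriv κ hκ a a' h hh)
    (fun i l t => by
      have hcont : Continuous (fun s => esU κ a a' h i s * esV κ a a' h l s) :=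
        (esU_cont κ a a' h i).mul (hVc l)
      exact intervalIntegral.integral_hasDerivAt_right (hcont.intervalIntegrable _ _)
        (hcont.stronglyMeasurableAtFilter _ _) hcont.continuousAt)
    (fun i => esV_end κ a a' h hh i k) (fun i l => by simp) c hc
    (fun i t => by
      rcases i with p | p
      · simp only [esU, abs_mul]
        exact (mul_le_of_le_one_right (abs_nonneg _) (Real.abs_cos_le_one _)).trans (hac p)
      · simp only [esU, abs_mul]
        exact (mul_le_of_le_one_right (abs_nonneg _) (Real.abs_sin_le_one _)).trans (hac' p))
    y hy b w Z A hyd B w0 w1 M L ν d hB0 hM hL hν hw10 hB hw hZ hA (by rw [hlen]; exact hd) hν'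
  refine ⟨key.1, ?_⟩
  have k2 := key.2
  rw [hlen] at k2
  have e := esV_end κ a a' h hh
  have e' : ∀ i, esV κ a a' h i (h * (k + 1)) = 0 := fun i => by
    have := e i (k + 1); push_cast at this; exact this
  simp only [e', zero_smul, Finset.sum_const_zero, sub_zero] at k2
  rw [esW_sum κ hκ hκi a a' h hh k (fun i l => A i (Z l (y (h * k))))] at k2
  exact k2

/-- Scaled form of the averaging estimate. -/
lemma es_bound_scale (h N C c B w0 w1 M L ν q d : ℝ) (hh : 0 < h) (hN : 0 ≤ N) (hC : 0 ≤ C)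
    (hM : 0 ≤ M) (hL : 0 ≤ L) (hν : 0 ≤ ν) (hν1 : ν ≤ 1) (hq : 0 ≤ q) (hq1 : q ≤ 1)
    (hc : 0 ≤ c) (hB : 0 ≤ B)
    (h1 : h * c ≤ C * q) (h2 : h * B ≤ C * q ^ 2) (h3 : h * w1 ≤ C * q ^ 2)
    (h4 : h * w0 ≤ C * (q ^ 2 * ν))
    (hd : d = h * (B + N * c * M)) :
    d ≤ (C + N * C * M) * q ∧
    h * (w0 + w1 * d + N * c * (ν * d + L * (h * (B + N * c * ((L + ν) * d))))) ≤
      (C + C * (C + N * C * M) + N * C * ((C + N * C * M) + L * (C + N * C * ((L + 1) * (C + N * C * M)))))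
        * (q ^ 2 * (ν + q)) := by
  have hq2 : q ^ 2 ≤ q := by nlinarith
  set G := C + N * C * M with hG
  have hG0 : 0 ≤ G := by positivity
  have hdq : d ≤ G * q := by
    rw [hd, hG]
    have a1 : h * (N * c * M) ≤ N * (C * q) * M := by
      calc h * (N * c * M) = N * (h * c) * M := by ring
        _ ≤ _ := by gcongr
    have a2 : C * q ^ 2 ≤ C * q := by gcongr
    nlinarith
  have hd0 : 0 ≤ d := by rw [hd]; positivity
  refine ⟨hdq, ?_⟩
  have b1 : h * B + N * (h * c) * ((L + ν) * d) ≤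
      (C + N * C * ((L + 1) * G)) * q ^ 2 := by
    calc h * B + N * (h * c) * ((L + ν) * d) ≤ C * q ^ 2 + N * (C * q) * ((L + 1) * (G * q)) := by
          gcongr
      _ = _ := by ring
  have b2 : ν * d + L * (h * B + N * (h * c) * ((L + ν) * d)) ≤
      ν * (G * q) + L * ((C + N * C * ((L + 1) * G)) * q ^ 2) := by gcongr
  have b3 : 0 ≤ ν * d + L * (h * B + N * (h * c) * ((L + ν) * d)) := by positivity
  have b4 : N * (h * c) * (ν * d + L * (h * B + N * (h * c) * ((L + ν) * d))) ≤
      N * (C * q) * (ν * (G * q) + L * ((C + N * C * ((L + 1) * G)) * q ^ 2)) := by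
    gcongr
  have b5 : h * w1 * d ≤ C * q ^ 2 * (G * q) := by gcongr
  have b6 : N * (C * q) * (ν * (G * q) + L * ((C + N * C * ((L + 1) * G)) * q ^ 2)) ≤
      N * C * (G + L * (C + N * C * ((L + 1) * G))) * (q ^ 2 * (ν + q)) := by
    have x1 : 0 ≤ N * C * G * q ^ 3 := by positivity
    have x2 : 0 ≤ N * C * (L * (C + N * C * ((L + 1) * G))) * (q ^ 2 * ν) := by positivity
    nlinarith
  have b7 : C * q ^ 2 * (G * q) ≤ C * G * (q ^ 2 * (ν + q)) := by
    have : 0 ≤ C * G * (q ^ 2 * ν) := by positivity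
    nlinarith
  have b8 : C * (q ^ 2 * ν) ≤ C * (q ^ 2 * (ν + q)) := by gcongr; linarith
  calc _ = h * w0 + h * w1 * d + N * (h * c) * (ν * d + L * (h * B + N * (h * c) * ((L + ν) * d))) := by ring
    _ ≤ _ := by linarith

lemma es_fin_min {I : Type*} [Finite I] (r : I → ℝ) (hr : ∀ i, 0 < r i) :
    ∃ r0 > 0, ∀ i, r0 ≤ r i := by
  cases isEmpty_or_nonempty I
  · exact ⟨1, one_pos, fun i => isEmptyElim i⟩
  · obtain ⟨i, hi⟩ := Finite.exists_min r
    exact ⟨r i, hr i, hi⟩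

lemma es_fin_max {I : Type*} [Finite I] (r : I → ℝ) :
    ∃ M, 0 ≤ M ∧ ∀ i, r i ≤ M := by
  cases isEmpty_or_nonempty I
  · exact ⟨1, zero_le_one, fun i => isEmptyElim i⟩
  · obtain ⟨i, hi⟩ := Finite.exists_max r
    exact ⟨max 0 (r i), le_max_left _ _, fun j => (hi j).trans (le_max_right _ _)⟩

/-- Uniform data for a finite family of `C¹` maps on a convex compact set. -/
lemma es_family {E F : Type*} [NormedAddCommGroup E] [NormedSpace ℝ E]
    [NormedAddCommGroup F] [NormedSpace ℝ F] {I : Type*} [Finite I]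
    (f : I → E → F) (D K : Set E) (hKD : K ⊆ D) (hK : IsCompact K)
    (hKc : Convex ℝ K) (hf : ∀ i, ∀ x ∈ D, DifferentiableAt ℝ (f i) x)
    (hf' : ∀ i, ContinuousOn (fderiv ℝ (f i)) D) :
    ∃ M L : ℝ, 0 ≤ M ∧ 0 ≤ L ∧ (∀ i, ∀ x ∈ K, ‖f i x‖ ≤ M) ∧
      (∀ i, ∀ x ∈ K, ‖fderiv ℝ (f i) x‖ ≤ L) ∧
      (∀ ν > 0, ∃ r > 0, ∀ i, ∀ y ∈ K, ∀ x ∈ K, ‖x - y‖ ≤ r →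
      ‖f i x - f i y - fderiv ℝ (f i) y (x - y)‖ ≤ ν * ‖x - y‖) := by
  have h1 : ∀ i, ∃ M, ∀ x ∈ K, ‖f i x‖ ≤ M := fun i =>
    hK.exists_bound_of_continuousOn
      (fun x hx => (hf i x (hKD hx)).continuousAt.continuousWithinAt)
  have h2 : ∀ i, ∃ M, ∀ x ∈ K, ‖fderiv ℝ (f i) x‖ ≤ M := fun i =>
    hK.exists_bound_of_continuousOn ((hf' i).mono hKD)
  choose M hM using h1
  choose L hL using h2
  obtain ⟨M0, hM0, hM1⟩ := es_fin_max M
  obtain ⟨L0, hL0, hL1⟩ := es_fin_max L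
  refine ⟨M0, L0, hM0, hL0, fun i x hx => (hM i x hx).trans (hM1 i),
    fun i x hx => (hL i x hx).trans (hL1 i), fun ν hν => ?_⟩
  choose r hr h using fun i => es_unifC1 (f i) D K hKD hK hKc (hf i) (hf' i) ν hν
  obtain ⟨r0, hr0, hr1⟩ := es_fin_min r hr
  exact ⟨r0, hr0, fun i y hy x hx hxy => h i y hy x hx (hxy.trans (hr1 i))⟩

lemma es_F_inv {n m : ℕ} (f : Fin m → EuclideanSpace ℝ (Fin n) → EuclideanSpace ℝ (Fin n))
    (S₁ : Finset (Fin m)) (S₂ : Finset (Fin m × Fin m))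
    (idx : (↥S₁ ⊕ ↥S₂) ≃ Fin n) (γ₁ : ℝ) (x ξ : EuclideanSpace ℝ (Fin n))
    (hrank : Submodule.span ℝ (Set.range fun j => col f S₁ S₂ idx x j) = ⊤) :
    (∑ s : ↥S₁, avec f S₁ S₂ idx γ₁ x ξ (idx (Sum.inl s)) • f s x) +
    (∑ p : ↥S₂, avec f S₁ S₂ idx γ₁ x ξ (idx (Sum.inr p)) • lieBracket (f p.1.1) (f p.1.2) x)
      = (-γ₁) • (x - ξ) := by
  have hli : LinearIndependent ℝ (fun j => col f S₁ S₂ idx x j) :=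
    linearIndependent_of_top_le_span_of_card_eq_finrank hrank.ge (by simp)
  have hli2 : LinearIndependent ℝ (Fmat f S₁ S₂ idx x).col := by
    have := hli.map' (WithLp.linearEquiv 2 ℝ (Fin n → ℝ)).toLinearMap
      (LinearEquiv.ker _)
    exact this
  have hu : IsUnit (Fmat f S₁ S₂ idx x) := Matrix.linearIndependent_cols_iff_isUnit.1 hli2
  have hdet : IsUnit (Fmat f S₁ S₂ idx x).det := (Matrix.isUnit_iff_isUnit_det _).1 hu
  have hmul : Fmat f S₁ S₂ idx x *ᵥ avec f S₁ S₂ idx γ₁ x ξ = (-γ₁) • (fun i => x i - ξ i) := by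
    rw [avec, Matrix.mulVec_smul, Matrix.mulVec_mulVec, Matrix.mul_nonsing_inv _ hdet,
      Matrix.one_mulVec]
  have hsum : ∑ j, avec f S₁ S₂ idx γ₁ x ξ j • col f S₁ S₂ idx x j = (-γ₁) • (x - ξ) := by
    ext i
    have := congrFun hmul i
    simp only [Matrix.mulVec, dotProduct, Fmat, Matrix.of_apply] at this
    simp only [WithLp.ofLp_sum, Finset.sum_apply, PiLp.smul_apply, smul_eq_mul, PiLp.sub_apply]
    rw [Pi.smul_apply, smul_eq_mul] at this
    rw [← this]
    exact Finset.sum_congr rfl fun j _ => mul_comm _ _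
  rw [← hsum, ← idx.sum_comp, Fintype.sum_sum_type]
  simp [_root_.col]

lemma es_avec_le {n m : ℕ} (f : Fin m → EuclideanSpace ℝ (Fin n) → EuclideanSpace ℝ (Fin n))
    (S₁ : Finset (Fin m)) (S₂ : Finset (Fin m × Fin m))
    (idx : (↥S₁ ⊕ ↥S₂) ≃ Fin n) (γ₁ : ℝ) (hγ₁ : 0 < γ₁) (x ξ : EuclideanSpace ℝ (Fin n)) (α : ℝ)
    (hFinv : ∀ v : EuclideanSpace ℝ (Fin n),
      ‖((WithLp.equiv 2 (Fin n → ℝ)).symm ((Fmat f S₁ S₂ idx x)⁻¹ *ᵥ (fun i => v i)))‖ ≤ α * ‖v‖)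
    (j : Fin n) : |avec f S₁ S₂ idx γ₁ x ξ j| ≤ γ₁ * α * ‖x - ξ‖ := by
  have h1 := hFinv (x - ξ)
  have h2 := (PiLp.norm_apply_le ((WithLp.equiv 2 (Fin n → ℝ)).symm
    ((Fmat f S₁ S₂ idx x)⁻¹ *ᵥ (fun i => (x - ξ) i))) j).trans h1
  have h3 : avec f S₁ S₂ idx γ₁ x ξ j = -γ₁ * (((WithLp.equiv 2 (Fin n → ℝ)).symm
    ((Fmat f S₁ S₂ idx x)⁻¹ *ᵥ (fun i => (x - ξ) i))) j) := by
    simp [avec]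
  rw [h3, abs_mul, abs_neg, abs_of_pos hγ₁, mul_assoc]
  exact mul_le_mul_of_nonneg_left h2 hγ₁.le

/-- amplitudes -/
def esA' {n m : ℕ} (f : Fin m → EuclideanSpace ℝ (Fin n) → EuclideanSpace ℝ (Fin n))
    (S₁ : Finset (Fin m)) (S₂ : Finset (Fin m × Fin m))
    (idx : (↥S₁ ⊕ ↥S₂) ≃ Fin n) (κ : Fin m × Fin m → ℕ) (γ₁ ε : ℝ)
    (x ξ : EuclideanSpace ℝ (Fin n)) (p : ↥S₂) : ℝ :=
  Real.sqrt (4 * π / ε) * Real.sqrt (κ p.1 * |avec f S₁ S₂ idx γ₁ x ξ (idx (Sum.inr p))|)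

/-- signed amplitudes -/
def esA {n m : ℕ} (f : Fin m → EuclideanSpace ℝ (Fin n) → EuclideanSpace ℝ (Fin n))
    (S₁ : Finset (Fin m)) (S₂ : Finset (Fin m × Fin m))
    (idx : (↥S₁ ⊕ ↥S₂) ≃ Fin n) (κ : Fin m × Fin m → ℕ) (γ₁ ε : ℝ)
    (x ξ : EuclideanSpace ℝ (Fin n)) (p : ↥S₂) : ℝ :=
  esA' f S₁ S₂ idx κ γ₁ ε x ξ p * Real.sign (avec f S₁ S₂ idx γ₁ x ξ (idx (Sum.inr p)))

/-- fields of the oscillating inputs -/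
def esZ {n m : ℕ} (f : Fin m → EuclideanSpace ℝ (Fin n) → EuclideanSpace ℝ (Fin n))
    (S₂ : Finset (Fin m × Fin m)) : ↥S₂ ⊕ ↥S₂ → EuclideanSpace ℝ (Fin n) → EuclideanSpace ℝ (Fin n)
  | Sum.inl p => f p.1.1
  | Sum.inr p => f p.1.2

lemma es_ctrl_sum {n m : ℕ} (f : Fin m → EuclideanSpace ℝ (Fin n) → EuclideanSpace ℝ (Fin n))
    (S₁ : Finset (Fin m)) (S₂ : Finset (Fin m × Fin m))
    (idx : (↥S₁ ⊕ ↥S₂) ≃ Fin n) (κ : Fin m × Fin m → ℕ) (γ₁ ε : ℝ)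
    (x ξ y : EuclideanSpace ℝ (Fin n)) (t : ℝ) :
    ∑ i : Fin m, ctrl f S₁ S₂ idx κ γ₁ ε x ξ i t • f i y =
      (∑ s : ↥S₁, avec f S₁ S₂ idx γ₁ x ξ (idx (Sum.inl s)) • f s y) +
      ∑ q : ↥S₂ ⊕ ↥S₂, esU (fun p : ↥S₂ => κ p.1) (esA f S₁ S₂ idx κ γ₁ ε x ξ)
        (esA' f S₁ S₂ idx κ γ₁ ε x ξ) ε q t • esZ f S₂ q y := by
  simp only [ctrl, add_smul, Finset.sum_add_distrib, Finset.sum_smul, Finset.mul_sum, mul_add]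
  congr 1
  · rw [Finset.sum_comm, Finset.univ_eq_attach]
    refine Finset.sum_congr rfl fun s _ => ?_
    rw [Finset.sum_eq_single (s : Fin m)]
    · simp
    · intro b _ hb; simp [hb]
    · simp
  · rw [Fintype.sum_sum_type]
    congr 1
    · rw [Finset.sum_comm, Finset.univ_eq_attach]
      refine Finset.sum_congr rfl fun p _ => ?_
      rw [Finset.sum_eq_single p.1.1]
      · simp only [esU, esA, esA', esZ, if_true]; congr 1; ring
      · intro b _ hb; simp [hb]
      · simp
    · rw [Finset.sum_comm, Finset.univ_eq_attach]
      refine Finset.sum_congr rfl fun p _ => ?_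
      rw [Finset.sum_eq_single p.1.2]
      · simp only [esU, esA, esA', esZ, if_true]; congr 1; ring
      · intro b _ hb; simp [hb]
      · simp

lemma esA_mul {n m : ℕ} (f : Fin m → EuclideanSpace ℝ (Fin n) → EuclideanSpace ℝ (Fin n))
    (S₁ : Finset (Fin m)) (S₂ : Finset (Fin m × Fin m))
    (idx : (↥S₁ ⊕ ↥S₂) ≃ Fin n) (κ : Fin m × Fin m → ℕ) (γ₁ ε : ℝ) (hε : 0 < ε)
    (x ξ : EuclideanSpace ℝ (Fin n)) (p : ↥S₂) (hκ : 0 < κ p.1) :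
    esA f S₁ S₂ idx κ γ₁ ε x ξ p * esA' f S₁ S₂ idx κ γ₁ ε x ξ p * ε ^ 2 / (4 * π * κ p.1) =
      ε * avec f S₁ S₂ idx γ₁ x ξ (idx (Sum.inr p)) := by
  have hk : (κ p.1 : ℝ) ≠ 0 := by exact_mod_cast hκ.ne'
  set a := avec f S₁ S₂ idx γ₁ x ξ (idx (Sum.inr p)) with ha
  have h1 : Real.sqrt (4 * π / ε) * Real.sqrt (4 * π / ε) = 4 * π / ε :=
    Real.mul_self_sqrt (by positivity)
  have h2 : Real.sqrt (κ p.1 * |a|) * Real.sqrt (κ p.1 * |a|) = κ p.1 * |a| :=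
    Real.mul_self_sqrt (by positivity)
  have h3 : |a| * Real.sign a = a := by
    rcases lt_trichotomy a 0 with h | h | h
    · rw [Real.sign_of_neg h, abs_of_neg h]; ring
    · simp [h]
    · rw [Real.sign_of_pos h, abs_of_pos h]; ring
  have : esA f S₁ S₂ idx κ γ₁ ε x ξ p * esA' f S₁ S₂ idx κ γ₁ ε x ξ p =
      (Real.sqrt (4 * π / ε) * Real.sqrt (4 * π / ε)) *
      ((Real.sqrt (κ p.1 * |a|) * Real.sqrt (κ p.1 * |a|)) * Real.sign a) := by
    simp only [esA, esA', ← ha]; ring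
  rw [this, h1, h2, mul_assoc (κ p.1 : ℝ), h3]
  field_simp

lemma esA'_le {n m : ℕ} (f : Fin m → EuclideanSpace ℝ (Fin n) → EuclideanSpace ℝ (Fin n))
    (S₁ : Finset (Fin m)) (S₂ : Finset (Fin m × Fin m))
    (idx : (↥S₁ ⊕ ↥S₂) ≃ Fin n) (κ : Fin m × Fin m → ℕ) (γ₁ ε : ℝ) (hε : 0 < ε)
    (x ξ : EuclideanSpace ℝ (Fin n)) (p : ↥S₂) (k0 c0 e : ℝ) (hk : (κ p.1 : ℝ) ≤ k0)
    (hk0 : 0 ≤ k0) (hc0 : 0 ≤ c0) (he : 0 ≤ e)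
    (ha : |avec f S₁ S₂ idx γ₁ x ξ (idx (Sum.inr p))| ≤ c0 * e) :
    |esA' f S₁ S₂ idx κ γ₁ ε x ξ p| ≤ Real.sqrt (4 * π * k0 * c0) * Real.sqrt (ε * e) / ε ∧
    |esA f S₁ S₂ idx κ γ₁ ε x ξ p| ≤ Real.sqrt (4 * π * k0 * c0) * Real.sqrt (ε * e) / ε := by
  have h1 : |esA' f S₁ S₂ idx κ γ₁ ε x ξ p| ≤
      Real.sqrt (4 * π * k0 * c0) * Real.sqrt (ε * e) / ε := by
    refine abs_le_of_sq_le_sq ?_ (by positivity)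
    rw [esA', mul_pow, div_pow, mul_pow, Real.sq_sqrt (by positivity), Real.sq_sqrt (by positivity),
      Real.sq_sqrt (by positivity), Real.sq_sqrt (by positivity)]
    have : 4 * π * k0 * c0 * (ε * e) / ε ^ 2 = 4 * π / ε * (k0 * (c0 * e)) := by field_simp
    rw [this]
    gcongr
  refine ⟨h1, ?_⟩
  rw [esA, abs_mul]
  refine (mul_le_of_le_one_right (abs_nonneg _) ?_).trans h1
  rcases Real.sign_apply_eq (avec f S₁ S₂ idx γ₁ x ξ (idx (Sum.inr p))) with h | h | h <;>
    simp [h]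

set_option maxHeartbeats 1000000 in
lemma es_step {n m : ℕ} (D K : Set (EuclideanSpace ℝ (Fin n))) (hD : IsOpen D)
    (f : Fin m → EuclideanSpace ℝ (Fin n) → EuclideanSpace ℝ (Fin n))
    (hf_smooth : ∀ i, ContDiffOn ℝ 2 (f i) D)
    (S₁ : Finset (Fin m)) (S₂ : Finset (Fin m × Fin m))
    (idx : (↥S₁ ⊕ ↥S₂) ≃ Fin n)
    (hrank : ∀ x ∈ D, Submodule.span ℝ (Set.range fun j => col f S₁ S₂ idx x j) = ⊤)
    (α : ℝ) (hα : 0 < α)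
    (hFinv : ∀ x ∈ D, ∀ v : EuclideanSpace ℝ (Fin n),
      ‖((WithLp.equiv 2 (Fin n → ℝ)).symm ((Fmat f S₁ S₂ idx x)⁻¹ *ᵥ (fun i => v i)))‖ ≤ α * ‖v‖)
    (κ : Fin m × Fin m → ℕ) (hκpos : ∀ p ∈ S₂, 0 < κ p)
    (hκinj : Set.InjOn κ S₂) (γ₁ : ℝ) (hγ₁ : 0 < γ₁)
    (hKD : K ⊆ D) (hK : IsCompact K) (hKc : Convex ℝ K) :
    ∃ G : ℝ, 0 ≤ G ∧ ∃ q0 : ℝ, 0 < q0 ∧ ∀ ε : ℝ, 0 < ε → ∀ (j : ℕ)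
      (x : ℝ → EuclideanSpace ℝ (Fin n)) (z : EuclideanSpace ℝ (Fin n)),
      Real.sqrt (ε * ‖x (ε * j) - z‖) ≤ q0 → ∀ t1 ∈ Icc (ε * j) (ε * (j + 1)),
      ContinuousOn x (Icc (ε * j) t1) → (∀ t ∈ Icc (ε * j) t1, x t ∈ K) →
      (∀ t ∈ Ico (ε * j) t1, HasDerivWithinAt x
        (∑ i : Fin m, ctrl f S₁ S₂ idx κ γ₁ ε (x (ε * j)) z i t • f i (x t)) (Ici t) t) →
      ‖x t1 - x (ε * j)‖ ≤ G * Real.sqrt (ε * ‖x (ε * j) - z‖) ∧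
      (t1 = ε * (j + 1) → ‖x t1 - z - (1 - ε * γ₁) • (x (ε * j) - z)‖ ≤
        ε * ‖x (ε * j) - z‖ * (γ₁ / 2)) := by
  obtain ⟨M, L, hM, hL, hfM, hfL, hfr⟩ := es_family f D K hKD hK hKc
    (fun i x hx => ((hf_smooth i).differentiableOn (by norm_num)).differentiableAt (hD.mem_nhds hx))
    (fun i => (hf_smooth i).continuousOn_fderiv_of_isOpen hD (by norm_num))
  obtain ⟨k0, hk0, hk1⟩ := es_fin_max (fun p : ↥S₂ => (κ p.1 : ℝ))
  set N : ℝ := (Fintype.card (↥S₂ ⊕ ↥S₂) : ℝ) with hN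
  set N1 : ℝ := (Fintype.card ↥S₁ : ℝ) with hN1
  have hN0 : 0 ≤ N := by positivity
  have hN10 : 0 ≤ N1 := by positivity
  set C0 := Real.sqrt (4 * π * k0 * (γ₁ * α)) with hC0
  have hC00 : 0 ≤ C0 := Real.sqrt_nonneg _
  set C := C0 + N1 * (γ₁ * α) * M + N1 * (γ₁ * α) * (L + 1) with hC
  have hCn : 0 ≤ C := by positivity
  clear_value C
  set G := C + N * C * M with hG
  have hGn : 0 ≤ G := by positivity
  set K0 := (C + C * (C + N * C * M) + N * C * ((C + N * C * M) +
    L * (C + N * C * ((L + 1) * (C + N * C * M))))) with hK0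
  have hK0n : 0 ≤ K0 := by positivity
  clear_value K0 G
  set ν := min 1 (γ₁ / (4 * (K0 + 1))) with hν
  have hνp : 0 < ν := lt_min one_pos (by positivity)
  obtain ⟨r, hr, hfr⟩ := hfr ν hνp
  refine ⟨G, hGn, min 1 (min ν (r / (G + 1))), lt_min one_pos (lt_min hνp (by positivity)), ?_⟩
  intro ε hε j x z hq t1 ht1 hxc hxK hxd
  set e := ‖x (ε * j) - z‖ with he
  have he0 : 0 ≤ e := norm_nonneg _
  set q := Real.sqrt (ε * e) with hqdef
  have hq0 : 0 ≤ q := Real.sqrt_nonneg _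
  have hq1 : q ≤ 1 := hq.trans (min_le_left _ _)
  have hq2 : q ≤ ν := hq.trans ((min_le_right _ _).trans (min_le_left _ _))
  have hq3 : q ≤ r / (G + 1) := hq.trans ((min_le_right _ _).trans (min_le_right _ _))
  have hqsq : q ^ 2 = ε * e := Real.sq_sqrt (by positivity)
  have hx0K : x (ε * j) ∈ K := hxK _ ⟨le_rfl, ht1.1⟩
  have hx0D := hKD hx0K
  have hab := es_avec_le f S₁ S₂ idx γ₁ hγ₁ (x (ε * j)) z α (hFinv _ hx0D)
  set a := avec f S₁ S₂ idx γ₁ (x (ε * j)) z with ha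
  set b := ∑ s : ↥S₁, a (idx (Sum.inl s)) • f s (x (ε * j)) with hb
  set w : ℝ → EuclideanSpace ℝ (Fin n) := fun t =>
    ∑ s : ↥S₁, a (idx (Sum.inl s)) • (f s (x t) - f s (x (ε * j))) with hw
  have hbw : ∀ t, b + w t = ∑ s : ↥S₁, a (idx (Sum.inl s)) • f s (x t) := by
    intro t
    rw [hb, hw, ← Finset.sum_add_distrib]
    exact Finset.sum_congr rfl fun s _ => by rw [← smul_add]; congr 1; abel
  set c := C * q / ε with hc
  have hcn : 0 ≤ c := by positivity
  set B := N1 * (γ₁ * α * e) * M with hB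
  have hBn : 0 ≤ B := by positivity
  have hC0C : C0 ≤ C := by
    have : 0 ≤ N1 * (γ₁ * α) * M := by positivity
    have : 0 ≤ N1 * (γ₁ * α) * (L + 1) := by positivity
    linarith
  have hamp : ∀ p, |esA' f S₁ S₂ idx κ γ₁ ε (x (ε * j)) z p| ≤ c ∧
      |esA f S₁ S₂ idx κ γ₁ ε (x (ε * j)) z p| ≤ c := by
    intro p
    have := esA'_le f S₁ S₂ idx κ γ₁ ε hε (x (ε * j)) z p k0 (γ₁ * α) e (hk1 p) hk0
      (by positivity) he0 (hab _)
    have h2 : C0 * q / ε ≤ c := by rw [hc]; gcongr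
    exact ⟨this.1.trans h2, this.2.trans h2⟩
  have hZM : ∀ q', ∀ y ∈ K, ‖esZ f S₂ q' y‖ ≤ M := by
    rintro (p | p) y hy
    · exact hfM _ y hy
    · exact hfM _ y hy
  have hSsum : ∀ (v : ↥S₁ → EuclideanSpace ℝ (Fin n)) (m' : ℝ), (∀ s, ‖v s‖ ≤ m') →
      ‖∑ s : ↥S₁, a (idx (Sum.inl s)) • v s‖ ≤ N1 * (γ₁ * α * e) * m' := by
    intro v m' hv
    calc ‖∑ s : ↥S₁, a (idx (Sum.inl s)) • v s‖ ≤ ∑ s : ↥S₁, (γ₁ * α * e) * m' := by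
          refine norm_sum_le_of_le _ fun i _ => ?_
          rw [norm_smul, Real.norm_eq_abs]
          exact mul_le_mul (hab _) (hv i) (norm_nonneg _) (by positivity)
      _ = _ := by rw [Finset.sum_const, Finset.card_univ, nsmul_eq_mul]; ring
  have hBb : ∀ t ∈ Ico (ε * j) t1, ‖b + w t‖ ≤ B := by
    intro t ht
    rw [hbw]
    exact hSsum _ M fun s => hfM _ _ (hxK t ⟨ht.1, ht.2.le⟩)
  have hxd' : ∀ t ∈ Ico (ε * j) t1, HasDerivWithinAt x (b + w t +
      ∑ i, esU (fun p : ↥S₂ => κ p.1) (esA f S₁ S₂ idx κ γ₁ ε (x (ε * j)) z)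
        (esA' f S₁ S₂ idx κ γ₁ ε (x (ε * j)) z) ε i t • esZ f S₂ i (x t)) (Ici t) t := by
    intro t ht
    have := hxd t ht
    rw [es_ctrl_sum] at this
    rw [hbw]
    exact this
  set d := ε * (B + N * c * M) with hd
  have hscale := es_bound_scale ε N C c B 0 (N1 * (γ₁ * α * e) * (L + 1)) M L ν q d hε hN0 hCn hM
    hL hνp.le (min_le_left _ _) hq0 hq1 hcn hBn
    (by rw [hc]; apply le_of_eq; field_simp)
    (by
      rw [hqsq, hB]
      have : ε * (N1 * (γ₁ * α * e) * M) = (N1 * (γ₁ * α) * M) * (ε * e) := by ring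
      rw [this]
      gcongr
      have : 0 ≤ N1 * (γ₁ * α) * (L + 1) := by positivity
      linarith)
    (by
      rw [hqsq]
      have : ε * (N1 * (γ₁ * α * e) * (L + 1)) = (N1 * (γ₁ * α) * (L + 1)) * (ε * e) := by ring
      rw [this]
      gcongr
      have : 0 ≤ N1 * (γ₁ * α) * M := by positivity
      linarith)
    (by rw [mul_zero]; positivity) hd
  rw [← hK0, ← hG] at hscale
  have hdG : d ≤ G * q := hscale.1
  have hdr : d ≤ r := by
    refine hdG.trans ?_
    have hG1 : 0 < G + 1 := by linarith
    have h1 : q * (G + 1) ≤ r := (le_div_iff₀ hG1).1 hq3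
    refine le_trans ?_ h1
    rw [mul_add, mul_one, mul_comm G q]
    exact le_add_of_nonneg_right hq0
  have hdisp : ∀ t ∈ Icc (ε * j) t1, ‖x t - x (ε * j)‖ ≤ d := by
    intro t2 ht2
    have husum : ∀ t ∈ Ico (ε * j) t1, ‖∑ i, esU (fun p : ↥S₂ => κ p.1)
        (esA f S₁ S₂ idx κ γ₁ ε (x (ε * j)) z)
        (esA' f S₁ S₂ idx κ γ₁ ε (x (ε * j)) z) ε i t • esZ f S₂ i (x t)‖ ≤ N * c * M := by
      intro t ht
      calc _ ≤ ∑ i : ↥S₂ ⊕ ↥S₂, c * M := by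
            refine norm_sum_le_of_le _ fun i _ => ?_
            rw [norm_smul, Real.norm_eq_abs]
            refine mul_le_mul ?_ (hZM i _ (hxK t ⟨ht.1, ht.2.le⟩)) (norm_nonneg _) hcn
            rcases i with p | p
            · simp only [esU, abs_mul]
              exact (mul_le_of_le_one_right (abs_nonneg _) (Real.abs_cos_le_one _)).trans (hamp p).2
            · simp only [esU, abs_mul]
              exact (mul_le_of_le_one_right (abs_nonneg _) (Real.abs_sin_le_one _)).trans (hamp p).1
        _ = _ := by rw [Finset.sum_const, Finset.card_univ, nsmul_eq_mul]; ring
    have := norm_image_sub_le_of_norm_deriv_right_le_segment hxc hxd' (C := B + N * c * M)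
      (fun s hs => (norm_add_le _ _).trans (add_le_add (hBb s hs) (husum s hs))) t2 ht2
    refine this.trans ?_
    rw [hd, mul_comm]
    exact mul_le_mul_of_nonneg_right (by linarith [ht1.2, ht2.2]) (by positivity)
  constructor
  · exact (hdisp t1 ⟨ht1.1, le_rfl⟩).trans hdG
  · intro htt
    subst htt
    have key := es_avg_trig (fun p : ↥S₂ => κ p.1) (fun p => hκpos p.1 p.2)
      (fun p p' h => Subtype.ext (hκinj p.2 p'.2 h))
      (esA f S₁ S₂ idx κ γ₁ ε (x (ε * j)) z) (esA' f S₁ S₂ idx κ γ₁ ε (x (ε * j)) z) ε hε j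
      c hcn (fun p => (hamp p).2) (fun p => (hamp p).1) x hxc b w (esZ f S₂)
      (fun i => fderiv ℝ (esZ f S₂ i) (x (ε * j))) hxd' B 0 (N1 * (γ₁ * α * e) * (L + 1)) M L ν d
      hBn hM hL hνp.le (by positivity) hBb
      (by
        intro t ht
        have hdt : ‖x t - x (ε * j)‖ ≤ r :=
          (hdisp t ⟨ht.1, ht.2.le⟩).trans hdr
        rw [zero_add, mul_assoc]
        refine hSsum _ _ fun s => ?_
        have h1 := hfr s _ hx0K _ (hxK t ⟨ht.1, ht.2.le⟩) hdt
        have h2 : ‖fderiv ℝ (f s) (x (ε * j)) (x t - x (ε * j))‖ ≤ L * ‖x t - x (ε * j)‖ :=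
          ContinuousLinearMap.le_of_opNorm_le _ (hfL s _ hx0K) _
        have h3 : f s (x t) - f s (x (ε * j)) = (f s (x t) - f s (x (ε * j)) -
          fderiv ℝ (f s) (x (ε * j)) (x t - x (ε * j))) +
          fderiv ℝ (f s) (x (ε * j)) (x t - x (ε * j)) := by abel
        rw [h3]
        refine (norm_add_le_of_le h1 h2).trans ?_
        rw [← add_mul, add_comm ν L]
        exact mul_le_mul_of_nonneg_right (add_le_add le_rfl (min_le_left _ _)) (norm_nonneg _))
      (fun i t ht => hZM i _ (hxK t ⟨ht.1, ht.2.le⟩))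
      (by
        rintro (p | p)
        · exact hfL _ _ hx0K
        · exact hfL _ _ hx0K)
      hd
      (by
        intro hh i t ht
        have h5 := (hh t ⟨ht.1, ht.2.le⟩).trans hdr
        rcases i with p | p
        · exact hfr _ _ hx0K _ (hxK t ⟨ht.1, ht.2.le⟩) h5
        · exact hfr _ _ hx0K _ (hxK t ⟨ht.1, ht.2.le⟩) h5)
    have k2 := key.2.trans hscale.2
    have hF := es_F_inv f S₁ S₂ idx γ₁ (x (ε * j)) z (hrank _ hx0D)
    have hvec : x (ε * (j + 1)) - z - (1 - ε * γ₁) • (x (ε * j) - z) =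
        x (ε * (j + 1)) - x (ε * j) - ε • b - ∑ p : ↥S₂,
        (esA f S₁ S₂ idx κ γ₁ ε (x (ε * j)) z p * esA' f S₁ S₂ idx κ γ₁ ε (x (ε * j)) z p * ε ^ 2 /
          (4 * π * κ p.1)) •
        (fderiv ℝ (esZ f S₂ (Sum.inr p)) (x (ε * j)) (esZ f S₂ (Sum.inl p) (x (ε * j))) -
          fderiv ℝ (esZ f S₂ (Sum.inl p)) (x (ε * j)) (esZ f S₂ (Sum.inr p) (x (ε * j)))) := by
      have e1 : ∀ p : ↥S₂, (esA f S₁ S₂ idx κ γ₁ ε (x (ε * j)) z p *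
          esA' f S₁ S₂ idx κ γ₁ ε (x (ε * j)) z p * ε ^ 2 / (4 * π * κ p.1)) •
        (fderiv ℝ (esZ f S₂ (Sum.inr p)) (x (ε * j)) (esZ f S₂ (Sum.inl p) (x (ε * j))) -
          fderiv ℝ (esZ f S₂ (Sum.inl p)) (x (ε * j)) (esZ f S₂ (Sum.inr p) (x (ε * j)))) =
          ε • (a (idx (Sum.inr p)) • lieBracket (f p.1.1) (f p.1.2) (x (ε * j))) := by
        intro p
        rw [esA_mul f S₁ S₂ idx κ γ₁ ε hε _ _ p (hκpos p.1 p.2), mul_smul]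
        rfl
      rw [Finset.sum_congr rfl (fun p _ => e1 p), ← Finset.smul_sum, sub_sub _ (ε • b), ← smul_add, hF]
      module
    rw [hvec]
    refine k2.trans ?_
    rw [← hqsq]
    have : K0 * (ν + q) ≤ γ₁ / 2 := by
      have h1 : ν ≤ γ₁ / (4 * (K0 + 1)) := min_le_right _ _
      calc K0 * (ν + q) ≤ (K0 + 1) * (γ₁ / (4 * (K0 + 1)) + γ₁ / (4 * (K0 + 1))) := by
            gcongr
            · linarith
            · linarith
        _ = γ₁ / 2 := by field_simp; ring
    calc K0 * (q ^ 2 * (ν + q)) = q ^ 2 * (K0 * (ν + q)) := by ring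
      _ ≤ _ := by gcongr

lemma es_track {n m : ℕ} (D K : Set (EuclideanSpace ℝ (Fin n))) (hD : IsOpen D)
    (f : Fin m → EuclideanSpace ℝ (Fin n) → EuclideanSpace ℝ (Fin n))
    (hf_smooth : ∀ i, ContDiffOn ℝ 2 (f i) D)
    (S₁ : Finset (Fin m)) (S₂ : Finset (Fin m × Fin m))
    (idx : (↥S₁ ⊕ ↥S₂) ≃ Fin n)
    (hrank : ∀ x ∈ D, Submodule.span ℝ (Set.range fun j => col f S₁ S₂ idx x j) = ⊤)
    (α : ℝ) (hα : 0 < α)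
    (hFinv : ∀ x ∈ D, ∀ v : EuclideanSpace ℝ (Fin n),
      ‖((WithLp.equiv 2 (Fin n → ℝ)).symm ((Fmat f S₁ S₂ idx x)⁻¹ *ᵥ (fun i => v i)))‖ ≤ α * ‖v‖)
    (κ : Fin m × Fin m → ℕ) (hκpos : ∀ p ∈ S₂, 0 < κ p)
    (hκinj : Set.InjOn κ S₂) (γ₁ : ℝ) (hγ₁ : 0 < γ₁)
    (hKD : K ⊆ D) (hK : IsCompact K) (hKc : Convex ℝ K) (τ : ℝ) (hτ : 0 < τ) :
    ∃ s0 > 0, ∀ ε ∈ Ioc (0:ℝ) (1 / γ₁), ∀ s, 0 ≤ s → s ≤ s0 →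
      ∀ (x ξ : ℝ → EuclideanSpace ℝ (Fin n)) (T : ℝ), x 0 = ξ 0 →
      ContinuousOn x (Ici 0) → (∀ t ∈ Icc 0 T, x t ∈ K) →
      (∀ a b, 0 ≤ a → a ≤ b → b ≤ T → ‖ξ b - ξ a‖ ≤ s * (b - a)) →
      (∀ j : ℕ, ∀ t ∈ Set.Ico (ε * j) (ε * (j + 1)),
              HasDerivWithinAt x
                (∑ i : Fin m,
                  ctrl f S₁ S₂ idx κ γ₁ ε (x (ε * j)) (ξ (ε * j)) i t • f i (x t))
                (Set.Ici t) t) →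
      ∀ t ∈ Icc 0 T, ‖x t - ξ t‖ ≤ τ := by
  obtain ⟨G, hG, q0, hq0, hstep⟩ := es_step D K hD f hf_smooth S₁ S₂ idx hrank α hα hFinv κ hκpos
    hκinj γ₁ hγ₁ hKD hK hKc
  refine ⟨min (γ₁ * τ / 6) (min (q0 ^ 2 * γ₁ ^ 2 / 2) ((τ * γ₁ / (2 * (G + 1))) ^ 2 / 2)),
    lt_min (by positivity) (lt_min (by positivity) (by positivity)), ?_⟩
  intro ε hε s hs hs0 x ξ T hx0 hxc hxK hξ hode
  have hs1 : s ≤ γ₁ * τ / 6 := hs0.trans (min_le_left _ _)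
  have hs2 : s ≤ q0 ^ 2 * γ₁ ^ 2 / 2 := hs0.trans ((min_le_right _ _).trans (min_le_left _ _))
  have hs3 : s ≤ (τ * γ₁ / (2 * (G + 1))) ^ 2 / 2 :=
    hs0.trans ((min_le_right _ _).trans (min_le_right _ _))
  have hε0 : 0 < ε := hε.1
  have hεγ : ε * γ₁ ≤ 1 := (le_div_iff₀ hγ₁).1 hε.2
  set eb := 2 * s / γ₁ with heb
  have heb0 : 0 ≤ eb := by positivity
  have hεeb : ε * eb ≤ 2 * s / γ₁ ^ 2 := by
    calc ε * eb ≤ (1 / γ₁) * eb := by gcongr; exact hε.2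
      _ = _ := by rw [heb]; field_simp
  have hsq1 : ∀ e, e ≤ eb → Real.sqrt (ε * e) ≤ q0 := by
    intro e he
    apply Real.sqrt_le_iff.2 ⟨hq0.le, ?_⟩
    calc ε * e ≤ ε * eb := by gcongr
      _ ≤ 2 * s / γ₁ ^ 2 := hεeb
      _ ≤ q0 ^ 2 := by rw [div_le_iff₀ (by positivity)]; linarith
  have hsq2 : ∀ e, e ≤ eb → G * Real.sqrt (ε * e) ≤ τ / 2 := by
    intro e he
    have : Real.sqrt (ε * e) ≤ τ / (2 * (G + 1)) := by
      apply Real.sqrt_le_iff.2 ⟨by positivity, ?_⟩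
      calc ε * e ≤ ε * eb := by gcongr
        _ ≤ 2 * s / γ₁ ^ 2 := hεeb
        _ ≤ (τ / (2 * (G + 1))) ^ 2 := by
          rw [div_le_iff₀ (by positivity), ← mul_pow]
          have : τ / (2 * (G + 1)) * γ₁ = τ * γ₁ / (2 * (G + 1)) := by ring
          rw [this]; linarith
    calc G * Real.sqrt (ε * e) ≤ (G + 1) * (τ / (2 * (G + 1))) := by gcongr; linarith
      _ = τ / 2 := by field_simp
  have hmain : ∀ j : ℕ, ε * j ≤ T → ‖x (ε * j) - ξ (ε * j)‖ ≤ eb := by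
    intro j
    induction j with
    | zero => intro _; simp [hx0, heb0]
    | succ j ih =>
      intro hj
      push_cast at hj ⊢
      have hj0 : 0 ≤ ε * j := by positivity
      have hjj : ε * j ≤ ε * (j + 1) := by gcongr; linarith
      have ih' := ih (hjj.trans hj)
      have h1 := (hstep ε hε0 j x (ξ (ε * j)) (hsq1 _ ih') (ε * (j + 1)) ⟨hjj, le_rfl⟩
        (hxc.mono fun t ht => hj0.trans ht.1)
        (fun t ht => hxK t ⟨hj0.trans ht.1, ht.2.trans hj⟩) (hode j)).2 rfl
      have h2 := hξ (ε * j) (ε * (j + 1)) hj0 hjj hj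
      have h3 : ε * (j + 1) - ε * j = ε := by ring
      rw [h3] at h2
      set e := ‖x (ε * j) - ξ (ε * j)‖ with he
      have h4 : ‖(1 - ε * γ₁) • (x (ε * j) - ξ (ε * j))‖ = (1 - ε * γ₁) * e := by
        rw [norm_smul, Real.norm_eq_abs, abs_of_nonneg (by linarith)]
      have h5 : x (ε * (j + 1)) - ξ (ε * (j + 1)) =
        (x (ε * (j + 1)) - ξ (ε * j) - (1 - ε * γ₁) • (x (ε * j) - ξ (ε * j))) +
        (1 - ε * γ₁) • (x (ε * j) - ξ (ε * j)) - (ξ (ε * (j + 1)) - ξ (ε * j)) := by abel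
      rw [h5]
      refine (norm_sub_le_of_le (norm_add_le_of_le h1 h4.le) h2).trans ?_
      have h6 : ε * e * (γ₁ / 2) + (1 - ε * γ₁) * e + s * ε = (1 - ε * γ₁ / 2) * e + s * ε := by ring
      rw [h6]
      have h7 : (1 - ε * γ₁ / 2) * e ≤ (1 - ε * γ₁ / 2) * eb := by
        apply mul_le_mul_of_nonneg_left ih'; linarith
      have h8 : ε * γ₁ / 2 * eb = s * ε := by rw [heb]; field_simp
      linarith
  intro t ht
  set j := ⌊t / ε⌋₊ with hj
  have hj1 : ε * j ≤ t := by
    have := Nat.floor_le (a := t / ε) (div_nonneg ht.1 hε0.le)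
    rw [le_div_iff₀ hε0] at this
    linarith
  have hj2 : t ≤ ε * (j + 1) := by
    have := (Nat.lt_floor_add_one (t / ε)).le
    rw [div_le_iff₀ hε0] at this
    linarith
  have hj0 : 0 ≤ ε * j := by positivity
  have he := hmain j (hj1.trans ht.2)
  have h1 := (hstep ε hε0 j x (ξ (ε * j)) (hsq1 _ he) t ⟨hj1, hj2⟩
    (hxc.mono fun t ht => hj0.trans ht.1)
    (fun t' ht' => hxK t' ⟨hj0.trans ht'.1, ht'.2.trans ht.2⟩)
    (fun t' ht' => hode j t' ⟨ht'.1, ht'.2.trans_le hj2⟩)).1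
  have h2 := hξ (ε * j) t hj0 hj1 ht.2
  have h3 : x t - ξ t = (x t - x (ε * j)) + (x (ε * j) - ξ (ε * j)) - (ξ t - ξ (ε * j)) := by abel
  rw [h3]
  refine (norm_sub_le_of_le (norm_add_le_of_le h1 he) h2).trans ?_
  have h4 := hsq2 _ he
  have h5 : s * (t - ε * j) ≤ s / γ₁ := by
    rw [div_eq_mul_one_div]
    apply mul_le_mul_of_nonneg_left _ hs
    linarith [hε.2]
  have h6 : eb + s / γ₁ ≤ τ / 2 := by
    have : eb + s / γ₁ = 3 * s / γ₁ := by rw [heb]; ring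
    rw [this, div_le_iff₀ hγ₁]; linarith
  linarith

/-- If the derivative of a continuous map extends continuously, then the map is differentiable. -/
lemma es_diff_of_tendsto {E F : Type*} [NormedAddCommGroup E] [NormedSpace ℝ E]
    [NormedAddCommGroup F] [NormedSpace ℝ F] (f : E → F) (D : Set E) (hD : IsOpen D) (xs : E)
    (hxs : xs ∈ D) (hd : ∀ x ∈ D, x ≠ xs → DifferentiableAt ℝ f x) (hc : ContinuousAt f xs)
    (hc' : ContinuousAt (fderiv ℝ f) xs) : DifferentiableAt ℝ f xs := by
  refine HasFDerivAt.differentiableAt (f' := fderiv ℝ f xs) ?_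
  rw [hasFDerivAt_iff_isLittleO, Asymptotics.isLittleO_iff]
  intro c hcpos
  rw [Metric.continuousAt_iff] at hc'
  obtain ⟨r, hr, h⟩ := hc' c hcpos
  obtain ⟨r', hr', hD'⟩ := Metric.isOpen_iff.1 hD xs hxs
  filter_upwards [Metric.ball_mem_nhds xs (lt_min hr hr')] with x hx
  rw [mem_ball] at hx
  set A := fderiv ℝ f xs with hA
  by_cases hxx : x = xs
  · simp [hxx]
  have hpath : ∀ t ∈ Ico (0:ℝ) 1, x + t • (xs - x) ∈ D ∧ x + t • (xs - x) ≠ xs ∧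
      dist (x + t • (xs - x)) xs < r := by
    intro t ht
    have e : x + t • (xs - x) - xs = (1 - t) • (x - xs) := by module
    have hn : dist (x + t • (xs - x)) xs ≤ dist x xs := by
      rw [dist_eq_norm, e, norm_smul, Real.norm_eq_abs, abs_of_nonneg (by linarith [ht.2]),
        dist_eq_norm]
      exact mul_le_of_le_one_left (norm_nonneg _) (by linarith [ht.1])
    refine ⟨hD' (hn.trans_lt (hx.trans_le (min_le_right _ _))), fun h0 => ?_,
      hn.trans_lt (hx.trans_le (min_le_left _ _))⟩
    rw [h0, sub_self] at e
    rcases smul_eq_zero.1 e.symm with h1 | h1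
    · linarith [ht.2]
    · exact hxx (sub_eq_zero.1 h1)
  have hline : ∀ t : ℝ, HasDerivAt (fun t : ℝ => x + t • (xs - x)) (xs - x) t := fun t => by
    simpa using ((hasDerivAt_id t).smul_const (xs - x)).const_add x
  have key := norm_image_sub_le_of_norm_deriv_right_le_segment (a := (0:ℝ)) (b := 1)
    (f := fun t : ℝ => f (x + t • (xs - x)) - A (x + t • (xs - x)))
    (f' := fun t => fderiv ℝ f (x + t • (xs - x)) (xs - x) - A (xs - x))
    (C := c * ‖xs - x‖)
    (by
      intro t ht
      refine ContinuousWithinAt.sub ?_ (by fun_prop)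
      refine ContinuousAt.continuousWithinAt ?_
      rcases eq_or_lt_of_le ht.2 with h1 | h1
      · subst h1
        refine ContinuousAt.comp (f := fun t : ℝ => x + t • (xs - x)) (g := f) ?_ (by fun_prop)
        simpa using hc
      · have := hpath t ⟨ht.1, h1⟩
        exact ContinuousAt.comp (f := fun t : ℝ => x + t • (xs - x)) (g := f)
          (hd _ this.1 this.2.1).continuousAt (by fun_prop))
    (fun t ht => by
      have := hpath t ht
      exact (((hd _ this.1 this.2.1).hasFDerivAt.comp_hasDerivAt t (hline t)).sub
        (A.hasFDerivAt.comp_hasDerivAt t (hline t))).hasDerivWithinAt)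
    (fun t ht => by
      have := h (hpath t ht).2.2
      rw [dist_eq_norm] at this
      rw [← ContinuousLinearMap.sub_apply]
      exact ContinuousLinearMap.le_of_opNorm_le _ this.le _) 1 (by simp)
  simp only [one_smul, zero_smul, add_zero, sub_zero, mul_one, add_sub_cancel] at key
  rw [norm_sub_rev x xs]
  refine le_trans (le_of_eq ?_) key
  rw [← norm_neg]
  congr 1
  rw [map_sub]
  abel

/-- `g` is differentiable at `J x` if `g ∘ J` is differentiable at `x` and `J` is regular there. -/
lemma es_comp_diff {E : Type*} [NormedAddCommGroup E] [NormedSpace ℝ E]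
    (g : ℝ → ℝ) (J : E → ℝ) (x v : E) (hJ : ContDiffAt ℝ 1 J x)
    (hv : fderiv ℝ J x v ≠ 0) (hgJ : DifferentiableAt ℝ (fun y => g (J y)) x) :
    DifferentiableAt ℝ g (J x) := by
  have hl : HasStrictDerivAt (fun t : ℝ => x + t • v) v 0 := by
    simpa using ((hasStrictDerivAt_id (0:ℝ)).smul_const v).const_add x
  have hJs : HasStrictFDerivAt J (fderiv ℝ J x) (x + (0:ℝ) • v) := by
    simpa using hJ.hasStrictFDerivAt (by norm_num)
  have hs : HasStrictDerivAt (fun t : ℝ => J (x + t • v)) (fderiv ℝ J x v) 0 :=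
    hJs.comp_hasStrictDerivAt (0:ℝ) hl
  set ψ := hs.localInverse _ _ _ hv with hψ
  have h0 : J x = J (x + (0:ℝ) • v) := by simp
  have hψd : HasStrictDerivAt ψ (fderiv ℝ J x v)⁻¹ (J (x + (0:ℝ) • v)) := hs.to_localInverse hv
  have hψ0 : ψ (J (x + (0:ℝ) • v)) = 0 :=
    HasStrictFDerivAt.localInverse_apply_image _
  have hev : ∀ᶠ z in nhds (J (x + (0:ℝ) • v)), J (x + ψ z • v) = z :=
    HasStrictFDerivAt.eventually_right_inverse
      (hs.hasStrictFDerivAt_equiv hv)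
  rw [h0]
  have hcomp : DifferentiableAt ℝ (fun z => g (J (x + ψ z • v))) (J (x + (0:ℝ) • v)) := by
    refine DifferentiableAt.comp (g := fun y => g (J y)) (f := fun z => x + ψ z • v) _ ?_ ?_
    · rw [hψ0]; simpa using hgJ
    · exact (hψd.hasDerivAt.differentiableAt.smul_const v).const_add x
  refine hcomp.congr_of_eventuallyEq ?_
  filter_upwards [hev] with z hz
  rw [hz]

lemma es_G_C1 {n : ℕ} (hn : 0 < n)
    (D : Set (EuclideanSpace ℝ (Fin n))) (hD : IsOpen D)
    (J : EuclideanSpace ℝ (Fin n) → ℝ) (hJsmooth : ContDiffOn ℝ 2 J D)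
    (xs : EuclideanSpace ℝ (Fin n)) (hxs : xs ∈ D)
    (hreg : ∀ x ∈ D, x ≠ xs → fderiv ℝ J x ≠ 0)
    (γ₂ : ℝ) (hγ₂ : 0 < γ₂)
    (g : Fin n ⊕ Fin n → ℝ → ℝ)
    (hgrel : ∀ j : Fin n, ∀ z : ℝ,
      g (Sum.inl j) z * deriv (g (Sum.inr j)) z -
        g (Sum.inr j) z * deriv (g (Sum.inl j)) z = -γ₂)
    (hg_smooth : ∀ j, ContDiffOn ℝ 2 (fun x => g j (J x)) (D \ {xs}))
    (hg_cont1 : ∀ i j, ContinuousOn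
      (fun x => fderiv ℝ (Gfield g J i) x (Gfield g J j x)) D)
    (hcx : ∀ j, ContinuousAt (fun x => g j (J x)) xs) :
    (∀ i, ∀ x ∈ D, DifferentiableAt ℝ (Gfield g J i) x) ∧
    (∀ i, ContinuousOn (fderiv ℝ (Gfield g J i)) D) ∧
    (∀ x ∈ D, ∑ p : Fin n, (fderiv ℝ (Gfield g J (Sum.inr p)) x (Gfield g J (Sum.inl p) x) -
      fderiv ℝ (Gfield g J (Sum.inl p)) x (Gfield g J (Sum.inr p) x)) =
      (-γ₂) • gradient J x) := by
  have hDo : IsOpen (D \ {xs}) := hD.sdiff isClosed_singleton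
  have hGs : ∀ i, ContDiffOn ℝ 2 (Gfield g J i) (D \ {xs}) := fun i =>
    (hg_smooth i).smul contDiffOn_const
  have hcG : ∀ i, ContinuousAt (Gfield g J i) xs := fun i =>
    (hcx i).smul continuousAt_const
  have hdoff : ∀ i, ∀ x ∈ D, x ≠ xs → DifferentiableAt ℝ (Gfield g J i) x := fun i x hx hne =>
    ((hGs i).differentiableOn (by norm_num)).differentiableAt (hDo.mem_nhds ⟨hx, hne⟩)
  have hcfd : ∀ i, ContinuousAt (fderiv ℝ (Gfield g J i)) xs := by
    intro i
    have hb : ∀ p : Fin n, ContinuousAt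
        (fun x => fderiv ℝ (Gfield g J i) x (EuclideanSpace.single p (1:ℝ))) xs := by
      intro p
      obtain ⟨j, hjp, hj0⟩ : ∃ j : Fin n ⊕ Fin n, Sum.elim id id j = p ∧ g j (J xs) ≠ 0 := by
        by_contra! hcon
        have h1 := hcon (Sum.inl p) rfl
        have h2 := hcon (Sum.inr p) rfl
        have := hgrel p (J xs)
        rw [h1, h2] at this
        simp at this
        linarith
      have h1 : ContinuousAt (fun x => (g j (J x))⁻¹ •
          fderiv ℝ (Gfield g J i) x (Gfield g J j x)) xs :=
        ((hcx j).inv₀ hj0).smul ((hg_cont1 i j).continuousAt (hD.mem_nhds hxs))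
      refine h1.congr ?_
      filter_upwards [(hcx j).eventually_ne hj0] with x hx
      have hGj : Gfield g J j x = g j (J x) • EuclideanSpace.single p (1:ℝ) := by
        rw [Gfield, hjp]
      rw [hGj, map_smul, smul_smul, inv_mul_cancel₀ hx, one_smul]
    have hclm : ∀ v, ContinuousAt (fun x => fderiv ℝ (Gfield g J i) x v) xs := by
      intro v
      have hv : v = ∑ p, v p • EuclideanSpace.single p (1:ℝ) := by
        have := (EuclideanSpace.basisFun (Fin n) ℝ).sum_repr v
        simpa using this.symm
      have : (fun x => fderiv ℝ (Gfield g J i) x v) =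
          fun x => ∑ p, v p • fderiv ℝ (Gfield g J i) x (EuclideanSpace.single p (1:ℝ)) := by
        funext x
        conv_lhs => rw [hv]
        rw [map_sum]; simp only [map_smul]
      rw [this]
      exact tendsto_finsetSum _ fun p _ => (hb p).const_smul (v p)
    exact continuousAt_clm_apply.2 hclm
  have hdiff : ∀ i, ∀ x ∈ D, DifferentiableAt ℝ (Gfield g J i) x := by
    intro i x hx
    by_cases hxx : x = xs
    · subst hxx
      exact es_diff_of_tendsto _ D hD x hx (hdoff i) (hcG i) (hcfd i)
    · exact hdoff i x hx hxx
  have hcontfd : ∀ i, ContinuousOn (fderiv ℝ (Gfield g J i)) D := by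
    intro i x hx
    by_cases hxx : x = xs
    · subst hxx; exact (hcfd i).continuousWithinAt
    · exact (((hGs i).continuousOn_fderiv_of_isOpen hDo (by norm_num)).continuousAt
        (hDo.mem_nhds ⟨hx, hxx⟩)).continuousWithinAt
  have hJd : ∀ x ∈ D, DifferentiableAt ℝ J x := fun x hx =>
    (hJsmooth.differentiableOn (by norm_num)).differentiableAt (hD.mem_nhds hx)
  have hJc : ContinuousOn (fderiv ℝ J) D := hJsmooth.continuousOn_fderiv_of_isOpen hD (by norm_num)
  refine ⟨hdiff, hcontfd, ?_⟩
  have hoff : ∀ x ∈ D, x ≠ xs →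
      ∑ p : Fin n, (fderiv ℝ (Gfield g J (Sum.inr p)) x (Gfield g J (Sum.inl p) x) -
      fderiv ℝ (Gfield g J (Sum.inl p)) x (Gfield g J (Sum.inr p) x)) =
      (-γ₂) • gradient J x := by
    intro x hx hne
    obtain ⟨v, hv⟩ : ∃ v, fderiv ℝ J x v ≠ 0 := by
      by_contra! hcon
      exact hreg x hx hne (ContinuousLinearMap.ext hcon)
    have hgd : ∀ j, DifferentiableAt ℝ (g j) (J x) := fun j =>
      es_comp_diff (g j) J x v ((hJsmooth.contDiffAt (hD.mem_nhds hx)).of_le (by norm_num)) hv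
        (((hg_smooth j).differentiableOn (by norm_num)).differentiableAt (hDo.mem_nhds ⟨hx, hne⟩))
    have hfd : ∀ j w, fderiv ℝ (Gfield g J j) x w =
        (deriv (g j) (J x) * fderiv ℝ J x w) • EuclideanSpace.single (Sum.elim id id j) (1:ℝ) := by
      intro j w
      have h1 : HasFDerivAt (fun y => g j (J y)) (deriv (g j) (J x) • fderiv ℝ J x) x :=
        (hgd j).hasDerivAt.comp_hasFDerivAt x (hJd x hx).hasFDerivAt
      have h2 : HasFDerivAt (Gfield g J j) _ x :=
        h1.smul_const (EuclideanSpace.single (Sum.elim id id j) (1:ℝ))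
      rw [h2.fderiv]
      simp
    have hgr : ∀ p, gradient J x p = fderiv ℝ J x (EuclideanSpace.single p (1:ℝ)) := by
      intro p
      have h1 : inner ℝ (gradient J x) (EuclideanSpace.single p (1:ℝ)) =
        fderiv ℝ J x (EuclideanSpace.single p (1:ℝ)) := by
        simp [gradient]
      rw [← h1, EuclideanSpace.inner_single_right]; simp
    have hterm : ∀ p : Fin n, fderiv ℝ (Gfield g J (Sum.inr p)) x (Gfield g J (Sum.inl p) x) -
      fderiv ℝ (Gfield g J (Sum.inl p)) x (Gfield g J (Sum.inr p) x) =
      (-γ₂) • (gradient J x p • EuclideanSpace.single p (1:ℝ)) := by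
      intro p
      rw [hfd, hfd, hgr, smul_smul, ← hgrel p (J x)]
      simp only [Gfield, Sum.elim_inl, Sum.elim_inr, id, map_smul, smul_eq_mul]
      rw [← sub_smul]
      congr 1
      ring
    rw [Finset.sum_congr rfl (fun p _ => hterm p), ← Finset.smul_sum]
    congr 1
    have := (EuclideanSpace.basisFun (Fin n) ℝ).sum_repr (gradient J x)
    simpa using this
  intro x hx
  by_cases hxx : x = xs
  swap
  · exact hoff x hx hxx
  subst hxx
  haveI : Nonempty (Fin n) := ⟨⟨0, hn⟩⟩
  have hc1 : ContinuousAt (fun x => ∑ p : Fin n,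
      (fderiv ℝ (Gfield g J (Sum.inr p)) x (Gfield g J (Sum.inl p) x) -
      fderiv ℝ (Gfield g J (Sum.inl p)) x (Gfield g J (Sum.inr p) x))) x :=
    tendsto_finsetSum _ fun p _ =>
      ((hg_cont1 (Sum.inr p) (Sum.inl p)).continuousAt (hD.mem_nhds hx)).sub
      ((hg_cont1 (Sum.inl p) (Sum.inr p)).continuousAt (hD.mem_nhds hx))
  have hc2 : ContinuousAt (fun x => (-γ₂) • gradient J x) x := by
    have : ContinuousAt (fun x => gradient J x) x := by
      refine ContinuousAt.comp (f := fderiv ℝ J)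
        (g := (InnerProductSpace.toDual ℝ (EuclideanSpace ℝ (Fin n))).symm) ?_
        (hJc.continuousAt (hD.mem_nhds hx))
      exact (LinearIsometryEquiv.continuous _).continuousAt
    exact this.const_smul (-γ₂)
  haveI : (nhdsWithin x {x}ᶜ).NeBot := inferInstance
  refine tendsto_nhds_unique (hc1.tendsto.mono_left (nhdsWithin_le_nhds (s := {x}ᶜ)))
    ((hc2.tendsto.mono_left (nhdsWithin_le_nhds (s := {x}ᶜ))).congr' ?_)
  filter_upwards [self_mem_nhdsWithin, nhdsWithin_le_nhds (hD.mem_nhds hx)] with y hy hyD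
  exact (hoff y hyD hy).symm

lemma es_dither_eq {n : ℕ} (k : Fin n → ℕ) (μ η : ℝ) (hμ : 0 < μ) (hη : 0 < η)
    (i : Fin n ⊕ Fin n) (t : ℝ) :
    (1 / η) * dither k μ i (t / η) =
      esU k (fun p => (1 / η) * Real.sqrt (4 * π * k p / μ))
        (fun p => (1 / η) * Real.sqrt (4 * π * k p / μ)) (μ * η) i t := by
  have e : ∀ p : Fin n, 2 * π * k p * (t / η) / μ = 2 * π * k p * t / (μ * η) := by
    intro p; field_simp
  rcases i with p | p
  · simp only [dither, esU, e]; ring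
  · simp only [dither, esU, e]; ring

lemma es_amp {n : ℕ} (k : Fin n → ℕ) (k0 : ℝ) (hk0 : ∀ p, (k p : ℝ) ≤ k0) (μ η : ℝ)
    (hμ : 0 < μ) (hη : 0 < η) (p : Fin n) :
    |(1 / η) * Real.sqrt (4 * π * k p / μ)| ≤ Real.sqrt (4 * π * k0) / (η * Real.sqrt μ) := by
  rw [abs_of_nonneg (by positivity), Real.sqrt_div (by positivity)]
  have h1 : Real.sqrt (4 * π * k p) ≤ Real.sqrt (4 * π * k0) := by
    apply Real.sqrt_le_sqrt
    have := hk0 p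
    gcongr
  have hs : 0 < Real.sqrt μ := Real.sqrt_pos.2 hμ
  calc 1 / η * (Real.sqrt (4 * π * k p) / Real.sqrt μ) =
        Real.sqrt (4 * π * k p) / (η * Real.sqrt μ) := by field_simp
    _ ≤ _ := by gcongr

lemma es_speed {n : ℕ} (k : Fin n → ℕ) (k0 : ℝ) (hk0 : ∀ p, (k p : ℝ) ≤ k0) (μ η : ℝ)
    (hμ : 0 < μ) (hη : 0 < η) (t : ℝ) (v : Fin n ⊕ Fin n → EuclideanSpace ℝ (Fin n)) (M : ℝ)
    (hv : ∀ i, ‖v i‖ ≤ M) :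
    ‖∑ i, ((1 / η) * dither k μ i (t / η)) • v i‖ ≤
      (Fintype.card (Fin n ⊕ Fin n) : ℝ) * (Real.sqrt (4 * π * k0) / (η * Real.sqrt μ)) * M := by
  have hs : 0 < Real.sqrt μ := Real.sqrt_pos.2 hμ
  calc _ ≤ ∑ i : Fin n ⊕ Fin n, (Real.sqrt (4 * π * k0) / (η * Real.sqrt μ)) * M := by
        refine norm_sum_le_of_le _ fun i _ => ?_
        rw [norm_smul, Real.norm_eq_abs]
        refine mul_le_mul ?_ (hv i) (norm_nonneg _) (by positivity)
        rw [es_dither_eq k μ η hμ hη]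
        rcases i with p | p
        · rw [esU, abs_mul]
          exact (mul_le_of_le_one_right (abs_nonneg _) (Real.abs_cos_le_one _)).trans
            (es_amp k k0 hk0 μ η hμ hη p)
        · rw [esU, abs_mul]
          exact (mul_le_of_le_one_right (abs_nonneg _) (Real.abs_sin_le_one _)).trans
            (es_amp k k0 hk0 μ η hμ hη p)
    _ = _ := by rw [Finset.sum_const, Finset.card_univ, nsmul_eq_mul]; ring

set_option maxHeartbeats 1000000 in
lemma es_slow {n : ℕ} (D K : Set (EuclideanSpace ℝ (Fin n)))
    (hKD : K ⊆ D) (hK : IsCompact K) (hKc : Convex ℝ K)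
    (J : EuclideanSpace ℝ (Fin n) → ℝ)
    (hJd : ∀ x ∈ D, DifferentiableAt ℝ J x) (hJc : ContinuousOn (fderiv ℝ J) D)
    (Z : Fin n ⊕ Fin n → EuclideanSpace ℝ (Fin n) → EuclideanSpace ℝ (Fin n))
    (hZd : ∀ i, ∀ x ∈ D, DifferentiableAt ℝ (Z i) x)
    (hZc : ∀ i, ContinuousOn (fderiv ℝ (Z i)) D)
    (γ₂ σ21 V0 : ℝ) (hγ₂ : 0 < γ₂) (hσ21 : 0 < σ21)
    (hbr : ∀ x ∈ D, ∑ p : Fin n, (fderiv ℝ (Z (Sum.inr p)) x (Z (Sum.inl p) x) -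
      fderiv ℝ (Z (Sum.inl p)) x (Z (Sum.inr p) x)) = (-γ₂) • gradient J x)
    (hPL : ∀ x ∈ D, σ21 * (J x - V0) ≤ ‖gradient J x‖ ^ 2)
    (k : Fin n → ℕ) (hkpos : ∀ j, 0 < k j) (hkinj : Function.Injective k) :
    ∃ Cg : ℝ, 0 ≤ Cg ∧
    (∀ μ > 0, ∀ η > 0, ∀ t, ∀ x ∈ K,
      ‖∑ i, ((1 / η) * dither k μ i (t / η)) • Z i x‖ ≤ Cg / (η * Real.sqrt μ)) ∧
    ∀ θ > 0, ∃ μbar > 0, ∀ μ ∈ Ioc (0:ℝ) μbar, μ * (γ₂ * σ21) ≤ 1 ∧ Cg * Real.sqrt μ ≤ θ ∧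
      ∃ τ > 0, ∀ η > 0, ∀ (x ξ : ℝ → EuclideanSpace ℝ (Fin n)) (j : ℕ),
      ContinuousOn ξ (Ici 0) →
      (∀ t ∈ Icc (μ * η * j) (μ * η * (j + 1)), x t ∈ K ∧ ξ t ∈ K ∧ ‖x t - ξ t‖ ≤ τ) →
      (∀ t : ℝ, 0 ≤ t → HasDerivWithinAt ξ
        (∑ i : Fin n ⊕ Fin n, ((1 / η) * dither k μ i (t / η)) • Z i (x t)) (Ici t) t) →
      J (ξ (μ * η * (j + 1))) - V0 ≤
        (1 - μ * (γ₂ * σ21)) * (J (ξ (μ * η * j)) - V0) + μ * θ := by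
  obtain ⟨M, L, hM, hL, hfM, hfL, hfr⟩ := es_family Z D K hKD hK hKc hZd hZc
  obtain ⟨_, LJ, _, hLJ, _, hJL, hJr⟩ := es_family (fun _ : Unit => J) D K hKD hK hKc
    (fun _ => hJd) (fun _ => hJc)
  obtain ⟨k0, hk0, hk1⟩ := es_fin_max (fun p : Fin n => (k p : ℝ))
  set N : ℝ := (Fintype.card (Fin n ⊕ Fin n) : ℝ) with hN
  have hN0 : 0 ≤ N := by positivity
  set C0 := Real.sqrt (4 * π * k0) with hC0
  have hC00 : 0 ≤ C0 := Real.sqrt_nonneg _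
  have hsp := fun μ η hμ hη t v M' hv => es_speed k k0 hk1 μ η hμ hη t v M' hv
  rw [← hN, ← hC0] at hsp
  have hamp := es_amp k k0 hk1
  rw [← hC0] at hamp
  clear_value C0
  have hNeq : (Fintype.card (Fin n ⊕ Fin n) : ℝ) = N := hN.symm
  clear_value N
  refine ⟨N * C0 * M, by positivity, ?_, ?_⟩
  · intro μ hμ η hη t x hx
    refine (hsp μ η hμ hη t _ M (fun i => hfM i x hx)).trans (le_of_eq ?_)
    ring
  intro θ hθ
  set C := C0 + N * L * C0 with hC
  have hCn : 0 ≤ C := by positivity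
  have hC1 : C0 ≤ C := by
    have : 0 ≤ N * L * C0 := by positivity
    linarith
  have hC2 : N * L * C0 ≤ C := by linarith
  clear_value C
  set G := C + N * C * M with hG
  have hGn : 0 ≤ G := by positivity
  set K0 := (C + C * (C + N * C * M) + N * C * ((C + N * C * M) +
    L * (C + N * C * ((L + 1) * (C + N * C * M))))) with hK0
  have hK0n : 0 ≤ K0 := by positivity
  clear_value K0 G
  set ν := min 1 (θ / (2 * (2 * K0 * LJ + 1))) with hν
  have hνp : 0 < ν := lt_min one_pos (by positivity)
  have hν1 : ν ≤ 1 := min_le_left _ _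
  have hν2 : LJ * (2 * K0 * ν) ≤ θ / 2 := by
    have h1 : ν ≤ θ / (2 * (2 * K0 * LJ + 1)) := min_le_right _ _
    rw [le_div_iff₀ (by positivity)] at h1
    nlinarith
  set ν' := θ / (2 * (γ₂ * LJ + 2 * K0 + 1)) with hν'
  have hνp' : 0 < ν' := by positivity
  have hν2' : ν' * (γ₂ * LJ + 2 * K0) ≤ θ / 2 := by
    have h1 : ν' * (2 * (γ₂ * LJ + 2 * K0 + 1)) = θ := by rw [hν']; field_simp
    nlinarith
  clear_value ν ν'
  obtain ⟨r, hr, hfr⟩ := hfr ν hνp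
  obtain ⟨r', hr', hJr⟩ := hJr ν' hνp'
  set Q := min (min 1 ν) (min (min (r / (G + 1)) (r' / (G + 1))) (θ / (N * C0 * M + 1))) with hQ
  have hQp : 0 < Q := by
    refine lt_min (lt_min one_pos hνp) (lt_min (lt_min ?_ ?_) ?_) <;> positivity
  have hQ1 : Q ≤ 1 := (min_le_left _ _).trans (min_le_left _ _)
  have hQ2 : Q ≤ ν := (min_le_left _ _).trans (min_le_right _ _)
  have hQ3 : Q ≤ r / (G + 1) :=
    (min_le_right _ _).trans ((min_le_left _ _).trans (min_le_left _ _))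
  have hQ4 : Q ≤ r' / (G + 1) :=
    (min_le_right _ _).trans ((min_le_left _ _).trans (min_le_right _ _))
  have hQ5 : Q ≤ θ / (N * C0 * M + 1) := (min_le_right _ _).trans (min_le_right _ _)
  clear_value Q
  refine ⟨min (Q ^ 2) (1 / (γ₂ * σ21)), lt_min (by positivity) (by positivity), ?_⟩
  intro μ hμ
  have hμ0 : 0 < μ := hμ.1
  set q := Real.sqrt μ with hq
  have hq0 : 0 < q := Real.sqrt_pos.2 hμ0
  have hqsq : q ^ 2 = μ := Real.sq_sqrt hμ0.le
  have hqQ : q ≤ Q := by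
    rw [hq]
    exact Real.sqrt_le_iff.2 ⟨hQp.le, hμ.2.trans (min_le_left _ _)⟩
  clear_value q
  have hμc : μ * (γ₂ * σ21) ≤ 1 :=
    (le_div_iff₀ (by positivity)).1 (hμ.2.trans (min_le_right _ _))
  have hrad : ∀ ρ : ℝ, Q ≤ ρ / (G + 1) → G * q ≤ ρ := by
    intro ρ hρ
    have h1 : Q * (G + 1) ≤ ρ := (le_div_iff₀ (by linarith)).1 hρ
    nlinarith
  refine ⟨hμc, ?_, q * ν, by positivity, ?_⟩
  · have h1 : Q * (N * C0 * M + 1) ≤ θ := (le_div_iff₀ (by positivity)).1 hQ5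
    have h2 : 0 ≤ N * C0 * M := by positivity
    nlinarith
  intro η hη x ξ j hξc hxξ hode
  set h := μ * η with hh
  have hh0 : 0 < h := by positivity
  set c := C0 / (η * q) with hc
  have hc0 : 0 ≤ c := by positivity
  have hhc : h * c = C0 * q := by
    rw [hc, hh, ← hqsq]; field_simp
  have hj0 : 0 ≤ h * j := by positivity
  set u : Fin n ⊕ Fin n → ℝ → ℝ := fun i t => (1 / η) * dither k μ i (t / η) with hu
  set w : ℝ → EuclideanSpace ℝ (Fin n) := fun t =>
    ∑ i, u i t • (Z i (x t) - Z i (ξ t)) with hw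
  set B := N * c * (L * (q * ν)) with hB
  have hB0 : 0 ≤ B := by positivity
  have hwB : ∀ t ∈ Ico (h * j) (h * (j + 1)), ‖w t‖ ≤ B := by
    intro t ht
    obtain ⟨h1, h2, h3⟩ := hxξ t ⟨ht.1, ht.2.le⟩
    have := hsp μ η hμ0 hη t (fun i => Z i (x t) - Z i (ξ t)) (L * (q * ν)) (by
      intro i
      have := hKc.norm_image_sub_le_of_norm_fderiv_le (𝕜 := ℝ) (f := Z i) (C := L)
        (fun z hz => hZd i z (hKD hz)) (fun z hz => hfL i z hz) h2 h1
      exact this.trans (mul_le_mul_of_nonneg_left h3 hL))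
    rw [← hq] at this
    exact this
  have hyd : ∀ t ∈ Ico (h * j) (h * (j + 1)), HasDerivWithinAt ξ
      (0 + w t + ∑ i, esU k (fun p => (1 / η) * Real.sqrt (4 * π * k p / μ))
        (fun p => (1 / η) * Real.sqrt (4 * π * k p / μ)) h i t • Z i (ξ t)) (Ici t) t := by
    intro t ht
    have h1 := hode t (hj0.trans ht.1)
    convert h1 using 1
    rw [zero_add, hw, ← Finset.sum_add_distrib]
    refine Finset.sum_congr rfl fun i _ => ?_
    rw [← es_dither_eq k μ η hμ0 hη, ← smul_add]
    simp [hu]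
  set d := h * (B + N * c * M) with hd
  have hhB : h * B ≤ C * (q ^ 2 * ν) := by
    calc h * B = (N * L) * (h * c) * (q * ν) := by rw [hB]; ring
      _ = (N * L * C0) * (q ^ 2 * ν) := by rw [hhc]; ring
      _ ≤ _ := by gcongr
  have hscale := es_bound_scale h N C c B B 0 M L ν q d hh0 hN0 hCn hM hL hνp.le hν1 hq0.le
    (hqQ.trans hQ1) hc0 hB0 (by rw [hhc]; gcongr)
    (hhB.trans (by
      have : q ^ 2 * ν ≤ q ^ 2 * 1 := by gcongr
      rw [mul_one] at this
      gcongr))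
    (by rw [mul_zero]; positivity) hhB hd
  rw [← hK0, ← hG] at hscale
  have hsub : Icc (h * j) (h * (j + 1)) ⊆ Ici (0:ℝ) := fun t ht => hj0.trans ht.1
  have hle : h * j ≤ h * (j + 1) := by
    have : (j:ℝ) ≤ j + 1 := by linarith
    gcongr
  have hy0 := (hxξ (h * j) ⟨le_rfl, hle⟩).2.1
  have hy1 := (hxξ (h * (j + 1)) ⟨hle, le_rfl⟩).2.1
  have key := es_avg_trig k hkpos hkinj (fun p => (1 / η) * Real.sqrt (4 * π * k p / μ))
    (fun p => (1 / η) * Real.sqrt (4 * π * k p / μ)) h hh0 j c hc0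
    (fun p => by have := hamp μ η hμ0 hη p; rw [← hq] at this; exact this)
    (fun p => by have := hamp μ η hμ0 hη p; rw [← hq] at this; exact this) ξ (hξc.mono hsub) 0 w Z
    (fun i => fderiv ℝ (Z i) (ξ (h * j))) hyd B B 0 M L ν d hB0 hM hL hνp.le le_rfl
    (fun t ht => by rw [zero_add]; exact hwB t ht)
    (fun t ht => by rw [zero_mul, add_zero]; exact hwB t ht)
    (fun i t ht => hfM i _ (hxξ t ⟨ht.1, ht.2.le⟩).2.1)
    (fun i => hfL i _ hy0) (by rw [hNeq])
    (fun hdis i t ht => hfr i _ hy0 _ (hxξ t ⟨ht.1, ht.2.le⟩).2.1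
      ((hdis t ⟨ht.1, ht.2.le⟩).trans (hscale.1.trans (hrad r hQ3))))
  rw [hNeq] at key
  have hdis := (key.1 (h * (j + 1)) ⟨hle, le_rfl⟩).trans (hscale.1.trans (hrad r' hQ4))
  have hR := key.2.trans hscale.2
  have hco : ∀ p : Fin n, (1 / η) * Real.sqrt (4 * π * k p / μ) *
      ((1 / η) * Real.sqrt (4 * π * k p / μ)) * h ^ 2 / (4 * π * k p) = μ := by
    intro p
    have hkp : (0:ℝ) < k p := by exact_mod_cast hkpos p
    have h1 : Real.sqrt (4 * π * k p / μ) * Real.sqrt (4 * π * k p / μ) = 4 * π * k p / μ :=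
      Real.mul_self_sqrt (by positivity)
    have h2 : (1 / η) * Real.sqrt (4 * π * k p / μ) * ((1 / η) * Real.sqrt (4 * π * k p / μ)) =
      (1 / η) ^ 2 * (4 * π * k p / μ) := by
      refine Eq.trans ?_ (congrArg (fun z => (1 / η) ^ 2 * z) h1)
      ring
    rw [h2, hh]
    have := Real.pi_pos
    field_simp
  simp only [hco] at hR
  rw [← Finset.smul_sum, hbr _ (hKD hy0), smul_zero, sub_zero, hqsq] at hR
  set y0 := ξ (h * j) with hy0d
  set y1 := ξ (h * (j + 1)) with hy1d
  have hJe := hJr () y0 hy0 y1 hy1 hdis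
  have hPL0 := hPL y0 (hKD hy0)
  have hLJ0 : ‖gradient J y0‖ ≤ LJ := by
    have := hJL () y0 hy0
    rw [gradient, LinearIsometryEquiv.norm_map]; exact this
  set p := gradient J y0 with hp
  have hfd : ∀ v, fderiv ℝ J y0 v = inner ℝ p v := by
    intro v; rw [hp]; simp [gradient]
  set R := y1 - y0 - μ • (-γ₂) • p with hRd
  have hΔ : y1 - y0 = R - (μ * γ₂) • p := by rw [hRd]; module
  have hRb : ‖R‖ ≤ μ * (2 * K0 * ν) := by
    refine hR.trans ?_
    have : ν + q ≤ 2 * ν := by linarith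
    calc K0 * (μ * (ν + q)) ≤ K0 * (μ * (2 * ν)) := by gcongr
      _ = _ := by ring
  have hΔn : ‖y1 - y0‖ ≤ μ * (γ₂ * LJ + 2 * K0) := by
    rw [hΔ]
    have h1 : ‖(μ * γ₂) • p‖ ≤ μ * γ₂ * LJ := by
      rw [norm_smul, Real.norm_of_nonneg (by positivity)]; gcongr
    have h2 : μ * (2 * K0 * ν) ≤ μ * (2 * K0 * 1) := by gcongr
    have := (norm_sub_le R ((μ * γ₂) • p))
    linarith
  have hin : inner ℝ p (y1 - y0) ≤ LJ * (μ * (2 * K0 * ν)) - μ * γ₂ * ‖p‖ ^ 2 := by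
    rw [hΔ, inner_sub_right, real_inner_smul_right, real_inner_self_eq_norm_sq]
    have h1 := real_inner_le_norm p R
    have h2 : ‖p‖ * ‖R‖ ≤ LJ * (μ * (2 * K0 * ν)) := by gcongr
    linarith
  have hJe' : J y1 - J y0 - inner ℝ p (y1 - y0) ≤ ν' * (μ * (γ₂ * LJ + 2 * K0)) := by
    have h1 : |J y1 - J y0 - fderiv ℝ J y0 (y1 - y0)| ≤ ν' * ‖y1 - y0‖ := hJe
    rw [hfd] at h1
    refine (le_abs_self _).trans (h1.trans ?_)
    gcongr
  have f1 : LJ * (μ * (2 * K0 * ν)) ≤ μ * (θ / 2) := by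
    calc LJ * (μ * (2 * K0 * ν)) = μ * (LJ * (2 * K0 * ν)) := by ring
      _ ≤ _ := by gcongr
  have f2 : ν' * (μ * (γ₂ * LJ + 2 * K0)) ≤ μ * (θ / 2) := by
    calc ν' * (μ * (γ₂ * LJ + 2 * K0)) = μ * (ν' * (γ₂ * LJ + 2 * K0)) := by ring
      _ ≤ _ := by gcongr
  have f3 : μ * γ₂ * (σ21 * (J y0 - V0)) ≤ μ * γ₂ * ‖p‖ ^ 2 := by gcongr
  linarith

lemma es_bootstrap (φ : ℝ → ℝ) (r1 : ℝ) (hφ : ContinuousOn φ (Ici 0)) (h0 : φ 0 < r1)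
    (hb : ∀ T, 0 ≤ T → (∀ t ∈ Icc 0 T, φ t ≤ r1) → φ T < r1) :
    ∀ t, 0 ≤ t → φ t ≤ r1 := by
  intro t1 ht1
  by_contra! hcon
  have hc : ContinuousOn φ (Icc 0 t1) := hφ.mono fun t ht => ht.1
  have hcl : IsClosed (Icc 0 t1 ∩ φ ⁻¹' (Ici r1)) :=
    hc.preimage_isClosed_of_isClosed isClosed_Icc isClosed_Ici
  have hcomp : IsCompact (Icc 0 t1 ∩ φ ⁻¹' (Ici r1)) :=
    isCompact_Icc.of_isClosed_subset hcl inter_subset_left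
  obtain ⟨s, hs, hmin⟩ := hcomp.exists_isLeast ⟨t1, ⟨ht1, le_rfl⟩, hcon.le⟩
  have hlt : ∀ t ∈ Icc 0 s, t < s → φ t < r1 := by
    intro t ht hts
    by_contra! h
    exact absurd (hmin ⟨⟨ht.1, ht.2.trans hs.1.2⟩, h⟩) (not_le.2 hts)
  have hseq : φ s ≤ r1 := by
    by_contra! h
    have hiv := intermediate_value_Icc hs.1.1 (hc.mono (Icc_subset_Icc_right hs.1.2))
    obtain ⟨t, ht, hte⟩ := hiv ⟨h0.le, h.le⟩
    have : t < s := lt_of_le_of_ne ht.2 (fun e => by rw [e] at hte; linarith)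
    have := hlt t ht this
    linarith
  have := hb s hs.1.1 (fun t ht => by
    rcases lt_or_eq_of_le ht.2 with h | h
    · exact (hlt t ht h).le
    · rw [h]; exact hseq)
  have h2 : r1 ≤ φ s := hs.2
  linarith

lemma es_ball_sub {E : Type*} [NormedAddCommGroup E] [NormedSpace ℝ E] (D : Set E)
    (hD : IsOpen D) (x : E) (hx : x ∈ D) : ball x (infDist x (frontier D)) ⊆ D := by
  intro y hy
  by_contra hyD
  have hpre : IsPreconnected (ball x (infDist x (frontier D))) := (convex_ball _ _).isPreconnected
  have hx' : x ∈ ball x (infDist x (frontier D)) :=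
    mem_ball_self (dist_nonneg.trans_lt hy)
  have hnf : ∀ z ∈ ball x (infDist x (frontier D)), z ∉ frontier D := by
    intro z hz hzf
    have := infDist_le_dist_of_mem (x := x) hzf
    rw [mem_ball, dist_comm] at hz
    linarith
  obtain ⟨z, _, hz1, hz2⟩ := hpre D (closure D)ᶜ hD isClosed_closure.isOpen_compl
    (fun z hz => by
      by_cases h : z ∈ D
      · exact Or.inl h
      · refine Or.inr fun hcl => hnf z hz ⟨hcl, ?_⟩
        rw [hD.interior_eq]; exact h)
    ⟨x, hx', hx⟩ ⟨y, hy, fun hcl => hnf y hy ⟨hcl, by rw [hD.interior_eq]; exact hyD⟩⟩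
  exact hz2 (subset_closure hz1)

lemma es_decay (V : ℕ → ℝ) (a θ c0 μ : ℝ) (ha : a = μ * c0) (hc0 : 0 < c0) (hμ : 0 < μ)
    (ha1 : a ≤ 1) (hθ : 0 < θ) (hV0 : 0 ≤ V 0) (n : ℕ)
    (hV : ∀ j < n, V (j + 1) ≤ (1 - a) * V j + μ * θ) :
    ∀ j ≤ n, V j ≤ Real.exp (-(a * j)) * V 0 + θ / c0 := by
  intro j
  induction j with
  | zero =>
    intro _
    simp
    positivity
  | succ j ih =>
    intro hj
    have h1 := ih (by omega)
    have h2 := hV j (by omega)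
    have h3 : (1 - a) * V j ≤ (1 - a) * (Real.exp (-(a * j)) * V 0 + θ / c0) := by
      gcongr
    have h4 : (1 - a) * (Real.exp (-(a * j)) * V 0) ≤
        Real.exp (-a) * (Real.exp (-(a * j)) * V 0) := by
      gcongr
      have := Real.add_one_le_exp (-a); linarith
    have h5 : Real.exp (-a) * (Real.exp (-(a * j)) * V 0) =
        Real.exp (-(a * ((j + 1 : ℕ) : ℝ))) * V 0 := by
      rw [← mul_assoc, ← Real.exp_add]; congr 2; push_cast; ring
    have h6 : (1 - a) * (θ / c0) + μ * θ = θ / c0 := by rw [ha]; field_simp; ring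
    linarith

lemma es_sqrt_est (e e0 σ11 σ12 V V0 a j θ c0 r : ℝ) (he0 : 0 ≤ e0) (hσ11 : 0 < σ11)
    (hσ12 : 0 < σ12) (hc0 : 0 < c0) (hr : 0 < r) (hθ : θ ≤ r ^ 2 * (c0 * σ11))
    (h1 : σ11 * e ^ 2 ≤ V) (h2 : V0 ≤ σ12 * e0 ^ 2)
    (h3 : V ≤ Real.exp (-(a * j)) * V0 + θ / c0) :
    e ≤ Real.sqrt (σ12 / σ11) * e0 * Real.exp (-(a * j) / 2) + r := by
  have hE : Real.exp (-(a * j)) = Real.exp (-(a * j) / 2) ^ 2 := by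
    rw [← Real.exp_nat_mul]; congr 1; push_cast; ring
  set X := Real.exp (-(a * j) / 2) with hX
  have hX0 : 0 < X := Real.exp_pos _
  set S := Real.sqrt (σ12 / σ11) with hS
  have hS0 : 0 ≤ S := Real.sqrt_nonneg _
  have hS2 : S ^ 2 = σ12 / σ11 := Real.sq_sqrt (by positivity)
  have hS3 : σ11 * S ^ 2 = σ12 := by rw [hS2]; field_simp
  clear_value X S
  have h4 : θ / c0 ≤ r ^ 2 * σ11 := by
    rw [div_le_iff₀ hc0]; linarith
  have h5 : X ^ 2 * V0 ≤ X ^ 2 * (σ12 * e0 ^ 2) := by gcongr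
  rw [hE] at h3
  have h6 : σ11 * e ^ 2 ≤ σ11 * ((S * e0 * X) ^ 2 + r ^ 2) := by
    have : σ11 * ((S * e0 * X) ^ 2 + r ^ 2) = X ^ 2 * ((σ11 * S ^ 2) * e0 ^ 2) + r ^ 2 * σ11 := by
      ring
    rw [this, hS3]; linarith
  have h7 := le_of_mul_le_mul_left h6 hσ11
  have h8 : 0 ≤ S * e0 * X := by positivity
  refine abs_le_of_sq_le_sq' ?_ (by positivity) |>.2
  nlinarith

set_option maxHeartbeats 2000000

/-- **Slow-extension variant of Theorem 1.** If the dithers `v_j^μ(t)` of the dynamic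
extension are replaced by `ṽ_j^μ(t) = (1/η)v_j^μ(t/η)` with a time-scale parameter `η > 0`,
then for every `δ ∈ (0, √(σ₁₁/σ₁₂)·dist(x*,∂D))` and every `ρ > 0` there exist `μ̄ > 0`,
a threshold `ε̄(μ) > 0`, and a threshold `η̄(ε,μ) > 0` such that for all `μ ∈ (0,μ̄]`,
`ε ∈ (0,ε̄(μ)]`, and `η ≥ η̄(ε,μ)`, there are `β, λ > 0` such that every `π_ε`-solution of
the closed loop with `x(0) = ξ(0) = x⁰ ∈ B̄_δ(x*)` satisfies
`‖x(t) − x*‖ ≤ β‖x⁰ − x*‖e^{−λt/η} + ρ` for all `t ≥ 0`. -/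
theorem extremum_seeking_nonholonomic_slow_extension
    (n m : ℕ) (hn : 0 < n) (hmn : m < n)
    (D : Set (EuclideanSpace ℝ (Fin n))) (hD : IsOpen D)
    (f : Fin m → EuclideanSpace ℝ (Fin n) → EuclideanSpace ℝ (Fin n))
    (hf_smooth : ∀ i, ContDiffOn ℝ 2 (f i) D)
    (hf_indep : ∀ x ∈ D, LinearIndependent ℝ fun i : Fin m => f i x)
    (S₁ : Finset (Fin m)) (S₂ : Finset (Fin m × Fin m))
    (hcard : S₁.card + S₂.card = n)
    (idx : (↥S₁ ⊕ ↥S₂) ≃ Fin n)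
    (hrank : ∀ x ∈ D, Submodule.span ℝ (Set.range fun j => col f S₁ S₂ idx x j) = ⊤)
    (α : ℝ) (hα : 0 < α)
    (hFinv : ∀ x ∈ D, ∀ v : EuclideanSpace ℝ (Fin n),
      ‖((WithLp.equiv 2 (Fin n → ℝ)).symm ((Fmat f S₁ S₂ idx x)⁻¹ *ᵥ (fun i => v i)))‖ ≤ α * ‖v‖)
    (J : EuclideanSpace ℝ (Fin n) → ℝ) (hJsmooth : ContDiffOn ℝ 2 J D)
    (xs : EuclideanSpace ℝ (Fin n)) (hxs : xs ∈ D)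
    (σ11 σ12 σ21 σ22 σ3 : ℝ)
    (hσ11 : 0 < σ11) (hσ12 : 0 < σ12) (hσ21 : 0 < σ21) (hσ22 : 0 < σ22) (hσ3 : 0 < σ3)
    (hJ1 : ∀ x ∈ D, σ11 * ‖x - xs‖ ^ 2 ≤ J x - J xs ∧ J x - J xs ≤ σ12 * ‖x - xs‖ ^ 2)
    (hJ2 : ∀ x ∈ D, σ21 * (J x - J xs) ≤ ‖gradient J x‖ ^ 2 ∧
      ‖gradient J x‖ ^ 2 ≤ σ22 * (J x - J xs))
    (hJ3 : ∀ x ∈ D, ‖fderiv ℝ (fun y => fderiv ℝ J y) x‖ ≤ σ3)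
    (γ₂ : ℝ) (hγ₂ : 0 < γ₂)
    (g : Fin n ⊕ Fin n → ℝ → ℝ)
    (hgrel : ∀ j : Fin n, ∀ z : ℝ,
      g (Sum.inl j) z * deriv (g (Sum.inr j)) z -
        g (Sum.inr j) z * deriv (g (Sum.inl j)) z = -γ₂)
    (hg_smooth : ∀ j, ContDiffOn ℝ 2 (fun x => g j (J x)) (D \ {xs}))
    (hg_cont1 : ∀ i j, ContinuousOn
      (fun x => fderiv ℝ (Gfield g J i) x (Gfield g J j x)) D)
    (hg_cont2 : ∀ i j l, ContinuousOn
      (fun x => fderiv ℝ (fun y => fderiv ℝ (Gfield g J i) y (Gfield g J j y)) x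
        (Gfield g J l x)) D)
    (hg_lip : ∀ D' ⊆ D, IsCompact D' → ∃ Lg L2g M3g : ℝ, 0 ≤ Lg ∧ 0 ≤ L2g ∧ 0 ≤ M3g ∧
      ∀ x ∈ D', ∀ ξ ∈ D',
        (∀ i, |g i (J x) - g i (J ξ)| ≤ Lg * ‖x - ξ‖) ∧
        (∀ i j, ‖fderiv ℝ (Gfield g J i) ξ (Gfield g J j x - Gfield g J j ξ)‖ ≤
          L2g * ‖x - ξ‖) ∧
        (∀ i j l, ‖fderiv ℝ (fun y => fderiv ℝ (Gfield g J i) y (Gfield g J j y)) ξ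
          (Gfield g J l x)‖ ≤ M3g))
    (κ : Fin m × Fin m → ℕ) (hκpos : ∀ p ∈ S₂, 0 < κ p)
    (hκinj : Set.InjOn κ S₂)
    (k : Fin n → ℕ) (hkpos : ∀ j, 0 < k j) (hkinj : Function.Injective k)
    (γ₁ : ℝ) (hγ₁ : 0 < γ₁)
    (δ ρ : ℝ) (hδ0 : 0 < δ)
    (hδ : δ < Real.sqrt (σ11 / σ12) * Metric.infDist xs (frontier D))
    (hρ : 0 < ρ) :
    ∃ μbar > 0, ∃ εbar : ℝ → ℝ, ∃ ηbar : ℝ → ℝ → ℝ,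
      (∀ μ ∈ Set.Ioc (0:ℝ) μbar, 0 < εbar μ) ∧
      (∀ μ ∈ Set.Ioc (0:ℝ) μbar, ∀ ε ∈ Set.Ioc (0:ℝ) (εbar μ), 0 < ηbar ε μ) ∧
      (∀ μ ∈ Set.Ioc (0:ℝ) μbar, ∀ ε ∈ Set.Ioc (0:ℝ) (εbar μ),
        ∀ η, ηbar ε μ ≤ η →
        ∃ β > 0, ∃ lam > 0,
          ∀ (x ξ : ℝ → EuclideanSpace ℝ (Fin n)) (x0 : EuclideanSpace ℝ (Fin n)),
            x0 ∈ Metric.closedBall xs δ →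
            x 0 = x0 → ξ 0 = x0 →
            (∀ t : ℝ, 0 ≤ t → x t ∈ D ∧ ξ t ∈ D) →
            ContinuousOn x (Set.Ici 0) → ContinuousOn ξ (Set.Ici 0) →
            (∀ j : ℕ, ∀ t ∈ Set.Ico (ε * j) (ε * (j + 1)),
              HasDerivWithinAt x
                (∑ i : Fin m,
                  ctrl f S₁ S₂ idx κ γ₁ ε (x (ε * j)) (ξ (ε * j)) i t • f i (x t))
                (Set.Ici t) t) →
            (∀ t : ℝ, 0 ≤ t →
              HasDerivWithinAt ξ
                (∑ j : Fin n ⊕ Fin n, ((1 / η) * dither k μ j (t / η)) • Gfield g J j (x t))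
                (Set.Ici t) t) →
            ∀ t : ℝ, 0 ≤ t →
              ‖x t - xs‖ ≤ β * ‖x0 - xs‖ * Real.exp (-lam * t / η) + ρ) := by
  set S := Real.sqrt (σ12 / σ11) with hS
  have hS0 : 0 < S := Real.sqrt_pos.2 (by positivity)
  have hSS : S * Real.sqrt (σ11 / σ12) = 1 := by
    rw [hS, ← Real.sqrt_mul (by positivity)]
    have : σ12 / σ11 * (σ11 / σ12) = 1 := by field_simp
    rw [this, Real.sqrt_one]
  set r := Metric.infDist xs (frontier D) with hr
  have hbD : ball xs r ⊆ D := es_ball_sub D hD xs hxs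
  set r0 := S * δ with hr0
  have hr0r : r0 < r := by
    have h1 : S * δ < S * (Real.sqrt (σ11 / σ12) * r) := mul_lt_mul_of_pos_left hδ hS0
    rw [← mul_assoc, hSS, one_mul] at h1
    exact h1
  have hr0p : 0 < r0 := by positivity
  clear_value r
  obtain ⟨r1, hr01, hr1r⟩ := exists_between hr0r
  obtain ⟨r3, hr13, hr3r⟩ := exists_between hr1r
  set K := closedBall xs r3 with hKdef
  have hKD : K ⊆ D := (closedBall_subset_ball hr3r).trans hbD
  have hK : IsCompact K := isCompact_closedBall xs r3
  have hKc : Convex ℝ K := convex_closedBall xs r3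
  have hxsK : K ∈ nhds xs := closedBall_mem_nhds xs (by linarith)
  have hcx : ∀ j, ContinuousAt (fun x => g j (J x)) xs := by
    intro j
    obtain ⟨Lg, _, _, hLg, _, _, hlip⟩ := hg_lip K hKD hK
    rw [ContinuousAt, tendsto_iff_dist_tendsto_zero]
    have h0 : Filter.Tendsto (fun x => Lg * ‖x - xs‖) (nhds xs) (nhds 0) := by
      have : Continuous fun x : EuclideanSpace ℝ (Fin n) => Lg * ‖x - xs‖ := by fun_prop
      have := this.tendsto xs
      simpa using this
    refine squeeze_zero' (Filter.Eventually.of_forall fun _ => dist_nonneg) ?_ h0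
    filter_upwards [hxsK] with x hx
    rw [Real.dist_eq]
    exact (hlip x hx xs (mem_of_mem_nhds hxsK)).1 j
  have hreg : ∀ x ∈ D, x ≠ xs → fderiv ℝ J x ≠ 0 := by
    intro x hx hne h0
    have h1 : gradient J x = 0 := by rw [gradient, h0]; simp
    have h2 := (hJ2 x hx).1
    have h3 := (hJ1 x hx).1
    have h4 : 0 < ‖x - xs‖ := norm_pos_iff.2 (sub_ne_zero.2 hne)
    rw [h1, norm_zero] at h2
    have h5 : 0 < σ21 * (J x - J xs) := by
      have : 0 < σ11 * ‖x - xs‖ ^ 2 := by positivity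
      exact mul_pos hσ21 (by linarith)
    norm_num at h2
    linarith
  obtain ⟨hGd, hGc, hbr⟩ := es_G_C1 hn D hD J hJsmooth xs hxs hreg γ₂ hγ₂ g hgrel hg_smooth
    hg_cont1 hcx
  obtain ⟨Cg, hCg, hspeed, hslow⟩ := es_slow D K hKD hK hKc J
    (fun x hx => (hJsmooth.differentiableOn (by norm_num)).differentiableAt (hD.mem_nhds hx))
    (hJsmooth.continuousOn_fderiv_of_isOpen hD (by norm_num)) (Gfield g J) hGd hGc γ₂ σ21 (J xs)
    hγ₂ hσ21 hbr (fun x hx => (hJ2 x hx).1) k hkpos hkinj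
  set c0 := γ₂ * σ21 with hc0d
  have hc0 : 0 < c0 := by positivity
  clear_value c0
  set ρ' := min ρ ((r1 - r0) / 2) with hρ'
  have hρ'p : 0 < ρ' := lt_min hρ (by linarith)
  have hρ1 : ρ' ≤ ρ := min_le_left _ _
  have hρ2 : ρ' ≤ (r1 - r0) / 2 := min_le_right _ _
  clear_value ρ'
  set θ := min (ρ' / 3) ((ρ' / 3) ^ 2 * (c0 * σ11)) with hθd
  have hθ : 0 < θ := lt_min (by positivity) (by positivity)
  have hθ1 : θ ≤ ρ' / 3 := min_le_left _ _
  have hθ2 : θ ≤ (ρ' / 3) ^ 2 * (c0 * σ11) := min_le_right _ _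
  clear_value θ
  obtain ⟨μbar, hμbar, hslow⟩ := hslow θ hθ
  have hmain : ∀ μ : ℝ, ∃ ηb > 0, μ ∈ Set.Ioc (0:ℝ) μbar → ∀ ε ∈ Set.Ioc (0:ℝ) (1 / γ₁),
      ∀ η, ηb ≤ η →
        ∃ β > 0, ∃ lam > 0,
          ∀ (x ξ : ℝ → EuclideanSpace ℝ (Fin n)) (x0 : EuclideanSpace ℝ (Fin n)),
            x0 ∈ Metric.closedBall xs δ →
            x 0 = x0 → ξ 0 = x0 →
            (∀ t : ℝ, 0 ≤ t → x t ∈ D ∧ ξ t ∈ D) →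
            ContinuousOn x (Set.Ici 0) → ContinuousOn ξ (Set.Ici 0) →
            (∀ j : ℕ, ∀ t ∈ Set.Ico (ε * j) (ε * (j + 1)),
              HasDerivWithinAt x
                (∑ i : Fin m,
                  ctrl f S₁ S₂ idx κ γ₁ ε (x (ε * j)) (ξ (ε * j)) i t • f i (x t))
                (Set.Ici t) t) →
            (∀ t : ℝ, 0 ≤ t →
              HasDerivWithinAt ξ
                (∑ j : Fin n ⊕ Fin n, ((1 / η) * dither k μ j (t / η)) • Gfield g J j (x t))
                (Set.Ici t) t) →
            ∀ t : ℝ, 0 ≤ t →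
              ‖x t - xs‖ ≤ β * ‖x0 - xs‖ * Real.exp (-lam * t / η) + ρ := by
    intro μ
    by_cases hμ : μ ∈ Set.Ioc (0:ℝ) μbar
    swap
    · exact ⟨1, one_pos, fun h => absurd h hμ⟩
    obtain ⟨hμc, hCμ, τ, hτ, hstep⟩ := hslow μ hμ
    have hμ0 : 0 < μ := hμ.1
    have hsq0 : 0 < Real.sqrt μ := Real.sqrt_pos.2 hμ0
    set τ' := min τ (min (ρ' / 3) (r3 - r1)) with hτ'
    have hτ'p : 0 < τ' := lt_min hτ (lt_min (by positivity) (by linarith))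
    have hτ1 : τ' ≤ τ := min_le_left _ _
    have hτ2 : τ' ≤ ρ' / 3 := (min_le_right _ _).trans (min_le_left _ _)
    have hτ3 : τ' ≤ r3 - r1 := (min_le_right _ _).trans (min_le_right _ _)
    clear_value τ'
    obtain ⟨s0, hs0, htrack⟩ := es_track D K hD f hf_smooth S₁ S₂ idx hrank α hα hFinv κ hκpos
      hκinj γ₁ hγ₁ hKD hK hKc τ' hτ'p
    refine ⟨(Cg + 1) / (s0 * Real.sqrt μ), by positivity, fun _ ε hε η hη => ?_⟩
    have hη0 : 0 < η := lt_of_lt_of_le (by positivity) hη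
    set s := Cg / (η * Real.sqrt μ) with hsd
    have hsn : 0 ≤ s := by positivity
    have hss0 : s ≤ s0 := by
      rw [hsd, div_le_iff₀ (by positivity)]
      have h1 := (div_le_iff₀ (by positivity)).1 hη
      linarith
    refine ⟨S * Real.exp (c0 * μ / 2), by positivity, c0 / 2, by positivity, ?_⟩
    intro x ξ x0 hx0 hxi hξi _ hxc hξc hxode hξode
    set e0 := ‖x0 - xs‖ with he0
    have he0n : 0 ≤ e0 := norm_nonneg _
    have he0δ : e0 ≤ δ := by
      have := hx0; rw [mem_closedBall, dist_eq_norm] at this; exact this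
    set h := μ * η with hh
    have hh0 : 0 < h := by positivity
    have hsh : s * h ≤ θ := by
      refine le_trans (le_of_eq ?_) hCμ
      rw [hsd, hh]
      rw [div_mul_eq_mul_div, div_eq_iff (by positivity)]
      calc Cg * (μ * η) = Cg * ((Real.sqrt μ * Real.sqrt μ) * η) := by
            rw [Real.mul_self_sqrt hμ0.le]
        _ = _ := by ring
    have hSe : S * e0 ≤ r0 := by rw [hr0]; gcongr
    have hSn1 : (1:ℝ) ≤ σ12 / σ11 ∨ e0 = 0 := by
      by_cases he : e0 = 0
      · exact Or.inr he
      · left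
        have hx0D : x0 ∈ D := by rw [← hxi]; exact (‹∀ t : ℝ, 0 ≤ t → x t ∈ D ∧ ξ t ∈ D› 0 le_rfl).1
        obtain ⟨h1, h2⟩ := hJ1 x0 hx0D
        have h3 := h1.trans h2
        rw [le_div_iff₀ hσ11, one_mul]
        exact le_of_mul_le_mul_right h3 (by positivity)
    have he0r : e0 ≤ r0 := by
      rcases hSn1 with h1 | h1
      · have : 1 ≤ S := by rw [hS]; exact Real.one_le_sqrt.2 h1
        nlinarith
      · rw [h1]; exact hr0p.le
    have hest : ∀ T, 0 ≤ T → (∀ t ∈ Icc 0 T, ‖x t - xs‖ ≤ r1) → ∃ j : ℕ, T < h * (j + 1) ∧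
        ‖x T - xs‖ ≤ S * e0 * Real.exp (-(μ * c0 * j) / 2) + ρ' := by
      intro T hT hxT
      have hxK : ∀ t ∈ Icc 0 T, x t ∈ K := by
        intro t ht
        rw [hKdef, mem_closedBall, dist_eq_norm]
        linarith [hxT t ht]
      have hξlip : ∀ a b, 0 ≤ a → a ≤ b → b ≤ T → ‖ξ b - ξ a‖ ≤ s * (b - a) := by
        intro a b ha hab hb
        exact norm_image_sub_le_of_norm_deriv_right_le_segment
          (hξc.mono fun t ht => ha.trans ht.1)
          (fun t ht => hξode t (ha.trans ht.1))
          (fun t ht => hspeed μ hμ0 η hη0 t (x t) (hxK t ⟨ha.trans ht.1, ht.2.le.trans hb⟩))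
          b ⟨hab, le_rfl⟩
      have htr := htrack ε hε s hsn hss0 x ξ T (by rw [hxi, hξi]) hxc hxK hξlip hxode
      have hξK : ∀ t ∈ Icc 0 T, ξ t ∈ K := by
        intro t ht
        rw [hKdef, mem_closedBall, dist_eq_norm]
        have h1 : ξ t - xs = (x t - xs) - (x t - ξ t) := by abel
        rw [h1]
        have := norm_sub_le (x t - xs) (x t - ξ t)
        linarith [hxT t ht, htr t ht]
      set j := ⌊T / h⌋₊ with hj
      have hj1 : h * j ≤ T := by
        have := Nat.floor_le (a := T / h) (by positivity)
        rw [le_div_iff₀ hh0] at this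
        linarith
      have hj2 : T < h * (j + 1) := by
        have := Nat.lt_floor_add_one (T / h)
        rw [div_lt_iff₀ hh0] at this
        linarith
      clear_value j
      have hV := es_decay (fun i => J (ξ (h * i)) - J xs) (μ * c0) θ c0 μ rfl hc0 hμ0 hμc hθ
        (by
          have h1 := (hJ1 _ (hKD (hξK 0 ⟨le_rfl, hT⟩))).1
          simp only [Nat.cast_zero, mul_zero]
          refine le_trans ?_ h1
          positivity) j
        (by
          intro i hi
          have hle : h * (i + 1) ≤ T := by
            have : (i:ℝ) + 1 ≤ j := by exact_mod_cast hi
            refine le_trans ?_ hj1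
            gcongr
          have := hstep η hη0 x ξ i hξc
            (fun t ht => by
              have hi0 : 0 ≤ h * i := by positivity
              have htT : t ∈ Icc 0 T := ⟨hi0.trans ht.1, ht.2.trans hle⟩
              exact ⟨hxK t htT, hξK t htT, (htr t htT).trans hτ1⟩) hξode
          push_cast
          exact this) j le_rfl
      have hjn : 0 ≤ h * j := by positivity
      have hξj := hξK (h * j) ⟨hjn, hj1⟩
      have hfin := es_sqrt_est ‖ξ (h * j) - xs‖ e0 σ11 σ12 (J (ξ (h * j)) - J xs)
        (J (ξ (h * (0 : ℕ))) - J xs) (μ * c0) j θ c0 (ρ' / 3) he0n hσ11 hσ12 hc0 (by positivity)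
        hθ2 (hJ1 _ (hKD hξj)).1
        (by
          have h1 := (hJ1 _ (hKD (hξK 0 ⟨le_rfl, hT⟩))).2
          simp only [Nat.cast_zero, mul_zero]
          rw [hξi] at h1 ⊢
          exact h1) hV
      refine ⟨j, hj2, ?_⟩
      have h1 := hξlip (h * j) T hjn hj1 le_rfl
      have h2 : s * (T - h * j) ≤ s * h := by
        apply mul_le_mul_of_nonneg_left _ hsn; linarith
      have h3 := htr T ⟨hT, le_rfl⟩
      have h4 : x T - xs = (x T - ξ T) + (ξ T - ξ (h * j)) + (ξ (h * j) - xs) := by abel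
      rw [h4]
      refine (norm_add₃_le).trans ?_
      linarith
    have hall : ∀ t, 0 ≤ t → ‖x t - xs‖ ≤ r1 := by
      refine es_bootstrap (fun t => ‖x t - xs‖) r1
        ((hxc.sub continuousOn_const).norm) ?_ ?_
      · rw [hxi]; exact lt_of_le_of_lt he0r hr01
      · intro T hT hxT
        obtain ⟨j, _, h1⟩ := hest T hT hxT
        have h2 : Real.exp (-(μ * c0 * j) / 2) ≤ 1 := by
          rw [Real.exp_le_one_iff]
          have : 0 ≤ μ * c0 * j := by positivity
          linarith
        have h3 : S * e0 * Real.exp (-(μ * c0 * j) / 2) ≤ S * e0 * 1 := by gcongr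
        show ‖x T - xs‖ < r1
        linarith
    intro t ht
    obtain ⟨j, hj, h1⟩ := hest t ht (fun u hu => hall u hu.1)
    have h2 : Real.exp (-(μ * c0 * j) / 2) ≤
        Real.exp (c0 * μ / 2) * Real.exp (-(c0 / 2) * t / η) := by
      rw [← Real.exp_add, Real.exp_le_exp]
      have h3 : t / η ≤ μ * (j + 1) := by
        rw [div_le_iff₀ hη0]
        have : h * (j + 1) = μ * (j + 1) * η := by rw [hh]; ring
        linarith
      have h4 : -(c0 / 2) * t / η = -(c0 / 2) * (t / η) := by ring
      rw [h4]
      have h5 : c0 / 2 * (t / η) ≤ c0 / 2 * (μ * (j + 1)) := by gcongr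
      linarith
    have h3 : S * e0 * Real.exp (-(μ * c0 * j) / 2) ≤
        S * e0 * (Real.exp (c0 * μ / 2) * Real.exp (-(c0 / 2) * t / η)) := by gcongr
    have h4 : S * e0 * (Real.exp (c0 * μ / 2) * Real.exp (-(c0 / 2) * t / η)) =
      S * Real.exp (c0 * μ / 2) * e0 * Real.exp (-(c0 / 2) * t / η) := by ring
    linarith
  choose ηb hηb hfinal using hmain
  exact ⟨μbar, hμbar, fun _ => 1 / γ₁, fun _ μ => ηb μ, fun _ _ => by positivity,
    fun μ _ _ _ => hηb μ, fun μ hμ ε hε η hη => hfinal μ hμ ε hε η hη⟩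
end
end

section
/- Let D ⊆ ℝⁿ, ξ* ∈ D, and let h₁, …, h_l : D → ℝⁿ be Lipschitz continuous on D with Lipschitz constant L, satisfying the regularity conditions needed for the Chen–Fliess expansion (h_i ∈ C² away from the common zero set, with first and second Lie derivatives continuous on D). Let w_i ∈ C([0,τ]; ℝ), ν = max_{t∈[0,τ]} Σ_{i=1}^l |w_i(t)|, and let ξ : [0,τ] → D be a solution of ξ̇ = Σ_{i=1}^l h_i(ξ)w_i(t). Assume there exist M₁, M₃ ≥ 0, m ≥ 1, and ϖ ∈ {0} ∪ [1, ∞) such that max_{1≤i₁≤l} ‖h_{i₁}(ξ(0))‖ ≤ M₁‖ξ(0) − ξ*‖^m and max_{1≤i₁,i₂,i₃≤l} ‖(L_{h_{i₃}}L_{h_{i₂}}h_{i₁})(ξ)‖ ≤ M₃‖ξ − ξ*‖^ϖ for all ξ ∈ D. Then for all t ∈ [0, τ], the remainder R(t) = Σ_{i₁,i₂,i₃=1}^l ∫₀ᵗ ∫₀ᵛ ∫₀ˢ (L_{h_{i₃}}L_{h_{i₂}}h_{i₁})(ξ(p)) w_{i₁}(v) w_{i₂}(s) w_{i₃}(p)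 dp ds dv satisfies ‖R(t)‖ ≤ (2^{ϖ−1}/6)(tν)³ M₃ ‖ξ(0) − ξ*‖^ϖ (1 + M₁^ϖ (τν)^ϖ e^{νLϖτ} ‖ξ(0) − ξ*‖^{ϖ(m−1)}). -/
open Set intervalIntegral

theorem cf_rpow {x y p : ℝ} (hx : 0 ≤ x) (hy : 0 ≤ y) (hp : 1 ≤ p) :
    (x + y) ^ p ≤ 2 ^ (p - 1) * (x ^ p + y ^ p) := by
  lift x to NNReal using hx
  lift y to NNReal using hy
  exact_mod_cast NNReal.rpow_add_le_mul_rpow_add_rpow x y hp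

theorem cf_gronwall_aux (ε K x y : ℝ) (hε : 0 ≤ ε) (hK : 0 ≤ K) (hx : 0 ≤ x) (hxy : x ≤ y) :
    gronwallBound 0 K ε x ≤ ε * y * Real.exp (K * y) := by
  have h2 : ε * x * Real.exp (K * x) ≤ ε * y * Real.exp (K * y) := by
    have := Real.exp_le_exp.2 (mul_le_mul_of_nonneg_left hxy hK)
    have hy : 0 ≤ y := hx.trans hxy
    gcongr
  refine le_trans ?_ h2
  rcases hK.eq_or_lt with h0 | h0
  · subst h0
    simp [gronwallBound_K0]
  · rw [gronwallBound_of_K_ne_0 h0.ne']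
    have h1 : Real.exp (K * x) - 1 ≤ K * x * Real.exp (K * x) := by
      have a1 := Real.add_one_le_exp (-(K * x))
      have a2 : Real.exp (-(K * x)) * Real.exp (K * x) = 1 := by
        rw [← Real.exp_add]; simp
      nlinarith [Real.exp_pos (K * x)]
    calc 0 * Real.exp (K * x) + ε / K * (Real.exp (K * x) - 1)
        ≤ 0 * Real.exp (K * x) + ε / K * (K * x * Real.exp (K * x)) := by gcongr
      _ = ε * x * Real.exp (K * x) := by field_simp; ring

theorem cf_intble {E : Type*} [NormedAddCommGroup E] [NormedSpace ℝ E] {τ : ℝ}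
    {f : ℝ → E} (hf : ContinuousOn f (Icc 0 τ)) {t : ℝ} (ht : t ∈ Icc 0 τ) :
    IntervalIntegrable f MeasureTheory.volume 0 t := by
  apply ContinuousOn.intervalIntegrable
  rw [uIcc_of_le ht.1]
  exact hf.mono (Icc_subset_Icc_right ht.2)

theorem cf_prim {E : Type*} [NormedAddCommGroup E] [NormedSpace ℝ E] [CompleteSpace E] {τ : ℝ}
    (hτ : 0 ≤ τ)
    {f : ℝ → E} (hf : ContinuousOn f (Icc 0 τ)) :
    ContinuousOn (fun t => ∫ s in (0:ℝ)..t, f s) (Icc 0 τ) := by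
  have := continuousOn_primitive_interval (μ := MeasureTheory.volume) (f := f) (a := 0) (b := τ)
    (by rw [uIcc_of_le hτ]; exact hf.integrableOn_Icc)
  rwa [uIcc_of_le hτ] at this

theorem cf_step {E : Type*} [NormedAddCommGroup E] [NormedSpace ℝ E] {l : ℕ} {τ ν : ℝ}
    {w : Fin l → ℝ → ℝ} (hw : ∀ i, ContinuousOn (w i) (Icc 0 τ))
    (hν : ∀ t ∈ Icc 0 τ, ∑ i, |w i t| ≤ ν)
    {F : Fin l → ℝ → E} (hF : ∀ i, ContinuousOn (F i) (Icc 0 τ)) {C : ℝ} (hC : 0 ≤ C) (k : ℕ)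
    (hb : ∀ i, ∀ t ∈ Icc 0 τ, ‖F i t‖ ≤ C * t ^ k) {t : ℝ} (ht : t ∈ Icc 0 τ) :
    ‖∑ i, ∫ s in (0:ℝ)..t, w i s • F i s‖ ≤ (ν * C / (k + 1)) * t ^ (k + 1) := by
  rw [← integral_finsetSum (f := fun i s => w i s • F i s)
    (fun i _ => cf_intble ((hw i).smul (hF i)) ht)]
  calc _ ≤ ∫ s in (0:ℝ)..t, (ν * C) * s ^ k := by
        apply norm_integral_le_of_norm_le ht.1
        · refine Filter.Eventually.of_forall fun s hs => ?_
          have hs' : s ∈ Icc 0 τ := ⟨hs.1.le, hs.2.trans ht.2⟩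
          calc _ ≤ ∑ i, ‖w i s • F i s‖ := norm_sum_le _ _
            _ ≤ ∑ i, |w i s| * (C * s ^ k) := by
                gcongr with i
                rw [norm_smul, Real.norm_eq_abs]
                exact mul_le_mul_of_nonneg_left (hb i s hs') (abs_nonneg _)
            _ = (∑ i, |w i s|) * (C * s ^ k) := by rw [Finset.sum_mul]
            _ ≤ ν * (C * s ^ k) := by
                have := hs'.1
                exact mul_le_mul_of_nonneg_right (hν s hs') (by positivity)
            _ = _ := by ring
        · exact (by fun_prop : Continuous fun s : ℝ => (ν * C) * s ^ k).intervalIntegrable _ _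
    _ = _ := by
        rw [integral_const_mul, integral_pow]; simp; ring

theorem cf_pull {E : Type*} [NormedAddCommGroup E] [NormedSpace ℝ E] {ι : Type*} [Fintype ι]
    {τ : ℝ} {w : ℝ → ℝ} (hw : ContinuousOn w (Icc 0 τ))
    {F : ι → ℝ → E} (hF : ∀ i, ContinuousOn (F i) (Icc 0 τ)) {t : ℝ} (ht : t ∈ Icc 0 τ) :
    ∑ i, ∫ s in (0:ℝ)..t, w s • F i s = ∫ s in (0:ℝ)..t, w s • ∑ i, F i s := by
  rw [← integral_finsetSum (f := fun i s => w s • F i s)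
    (fun i _ => cf_intble (hw.smul (hF i)) ht)]
  simp only [Finset.smul_sum]

theorem cf_triple {E : Type*} [NormedAddCommGroup E] [NormedSpace ℝ E] [CompleteSpace E]
    {l : ℕ} {τ ν : ℝ} (hτ : 0 ≤ τ) (hν0 : 0 ≤ ν)
    {w : Fin l → ℝ → ℝ} (hw : ∀ i, ContinuousOn (w i) (Icc 0 τ))
    (hν : ∀ t ∈ Icc 0 τ, ∑ i, |w i t| ≤ ν)
    {F : Fin l → Fin l → Fin l → ℝ → E} (hF : ∀ i j k, ContinuousOn (F i j k) (Icc 0 τ))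
    {C : ℝ} (hC : 0 ≤ C)
    (hb : ∀ i j k, ∀ t ∈ Icc 0 τ, ‖F i j k t‖ ≤ C) {t : ℝ} (ht : t ∈ Icc 0 τ) :
    ‖∑ i₁ : Fin l, ∑ i₂ : Fin l, ∑ i₃ : Fin l,
          ∫ v in (0:ℝ)..t, w i₁ v •
            ∫ s in (0:ℝ)..v, w i₂ s •
              ∫ p in (0:ℝ)..s, w i₃ p • F i₁ i₂ i₃ p‖ ≤ (t * ν) ^ 3 / 6 * C := by
  have cG : ∀ i j k, ContinuousOn (fun s => ∫ p in (0:ℝ)..s, w k p • F i j k p) (Icc 0 τ) :=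
    fun i j k => cf_prim hτ ((hw k).smul (hF i j k))
  have cH : ∀ i j k, ContinuousOn (fun v => ∫ s in (0:ℝ)..v, w j s •
      ∫ p in (0:ℝ)..s, w k p • F i j k p) (Icc 0 τ) :=
    fun i j k => cf_prim hτ ((hw j).smul (cG i j k))
  have cG' : ∀ i j, ContinuousOn (fun s => ∑ k, ∫ p in (0:ℝ)..s, w k p • F i j k p) (Icc 0 τ) :=
    fun i j => continuousOn_finsetSum _ fun k _ => cG i j k
  have cH1 : ∀ i j, ContinuousOn (fun v => ∑ k, ∫ s in (0:ℝ)..v, w j s •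
      ∫ p in (0:ℝ)..s, w k p • F i j k p) (Icc 0 τ) :=
    fun i j => continuousOn_finsetSum _ fun k _ => cH i j k
  have cH' : ∀ i, ContinuousOn (fun v => ∑ j, ∑ k, ∫ s in (0:ℝ)..v, w j s •
      ∫ p in (0:ℝ)..s, w k p • F i j k p) (Icc 0 τ) :=
    fun i => continuousOn_finsetSum _ fun j _ => cH1 i j
  have b1 : ∀ i j, ∀ s ∈ Icc 0 τ, ‖∑ k, ∫ p in (0:ℝ)..s, w k p • F i j k p‖
      ≤ (ν * C) * s ^ 1 := by
    intro i j s hs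
    have := cf_step hw hν (hF i j) hC 0 (by simpa using hb i j) hs
    simpa using this
  have b2 : ∀ i, ∀ v ∈ Icc 0 τ, ‖∑ j, ∑ k, ∫ s in (0:ℝ)..v, w j s •
      ∫ p in (0:ℝ)..s, w k p • F i j k p‖ ≤ (ν * (ν * C) / 2) * v ^ 2 := by
    intro i v hv
    have := cf_step hw hν (cG' i) (mul_nonneg hν0 hC) 1 (b1 i) hv
    rw [Finset.sum_congr rfl fun j _ => cf_pull (hw j) (cG i j) hv]
    convert this using 3
    norm_num
  have b3 := cf_step hw hν cH' (by positivity) 2 b2 ht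
  have e : ∀ i₁, ∑ i₂ : Fin l, ∑ i₃ : Fin l,
          ∫ v in (0:ℝ)..t, w i₁ v •
            ∫ s in (0:ℝ)..v, w i₂ s •
              ∫ p in (0:ℝ)..s, w i₃ p • F i₁ i₂ i₃ p = ∫ v in (0:ℝ)..t, w i₁ v •
          ∑ j, ∑ k, ∫ s in (0:ℝ)..v, w j s • ∫ p in (0:ℝ)..s, w k p • F i₁ j k p := by
    intro i
    rw [← cf_pull (hw i) (cH1 i) ht]
    exact Finset.sum_congr rfl fun j _ => cf_pull (hw i) (cH i j) ht
  rw [Finset.sum_congr rfl fun i _ => e i]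
  refine b3.trans (le_of_eq ?_)
  push_cast
  ring

/-- **Lemma 3 (bound on the Chen–Fliess remainder).** Under the regularity needed for the
Chen–Fliess expansion, if `maxᵢ‖hᵢ(ξ(0))‖ ≤ M₁‖ξ(0) − ξ*‖^m` and the (extended) second Lie
derivatives satisfy `‖L_{h_{i₃}}L_{h_{i₂}}h_{i₁}(ξ)‖ ≤ M₃‖ξ − ξ*‖^ϖ` on `D`, then the
remainder `R(t)` of the expansion satisfies
`‖R(t)‖ ≤ (2^{ϖ−1}/6)(tν)³M₃‖ξ(0) − ξ*‖^ϖ(1 + M₁^ϖ(τν)^ϖ e^{νLϖτ}‖ξ(0) − ξ*‖^{ϖ(m−1)})`. -/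
theorem chen_fliess_remainder_bound {n l : ℕ}
    (D : Set (EuclideanSpace ℝ (Fin n)))
    (ξs : EuclideanSpace ℝ (Fin n)) (hξs : ξs ∈ D)
    (τ : ℝ) (hτ : 0 ≤ τ)
    (h : Fin l → EuclideanSpace ℝ (Fin n) → EuclideanSpace ℝ (Fin n))
    (L : ℝ) (hL : 0 ≤ L)
    (hLip : ∀ i, LipschitzOnWith (Real.toNNReal L) (h i) D)
    (hC2 : ∀ i, ContDiffOn ℝ 2 (h i) (D \ {x ∈ D | ∀ j, h j x = 0}))
    (LD2 : Fin l → Fin l →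
      EuclideanSpace ℝ (Fin n) → EuclideanSpace ℝ (Fin n))
    (LD3 : Fin l → Fin l → Fin l →
      EuclideanSpace ℝ (Fin n) → EuclideanSpace ℝ (Fin n))
    (hLD2agree : ∀ j i, ∀ x ∈ D \ {x ∈ D | ∀ j', h j' x = 0},
      LD2 j i x = fderiv ℝ (h i) x (h j x))
    (hLD2cont : ∀ j i, ContinuousOn (LD2 j i) D)
    (hLD3agree : ∀ l' j i, ∀ x ∈ D \ {x ∈ D | ∀ j', h j' x = 0},
      LD3 l' j i x = fderiv ℝ (LD2 j i) x (h l' x))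
    (hLD3cont : ∀ l' j i, ContinuousOn (LD3 l' j i) D)
    (w : Fin l → ℝ → ℝ) (hw : ∀ i, ContinuousOn (w i) (Icc 0 τ))
    (ν : ℝ) (hν : IsGreatest ((fun t => ∑ i : Fin l, |w i t|) '' Icc 0 τ) ν)
    (ξ : ℝ → EuclideanSpace ℝ (Fin n))
    (hξD : ∀ t ∈ Icc 0 τ, ξ t ∈ D)
    (hode : ∀ t ∈ Icc 0 τ,
      HasDerivWithinAt ξ (∑ i : Fin l, w i t • h i (ξ t)) (Icc 0 τ) t)
    (M₁ M₃ m ϖ : ℝ) (hM₁ : 0 ≤ M₁) (hM₃ : 0 ≤ M₃) (hm : 1 ≤ m)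
    (hϖ : ϖ = 0 ∨ 1 ≤ ϖ)
    (hbound1 : ∀ i₁ : Fin l, ‖h i₁ (ξ 0)‖ ≤ M₁ * ‖ξ 0 - ξs‖ ^ m)
    (hbound3 : ∀ i₁ i₂ i₃ : Fin l, ∀ x ∈ D, ‖LD3 i₃ i₂ i₁ x‖ ≤ M₃ * ‖x - ξs‖ ^ ϖ) :
    ∀ t ∈ Icc 0 τ,
      ‖∑ i₁ : Fin l, ∑ i₂ : Fin l, ∑ i₃ : Fin l,
          ∫ v in (0:ℝ)..t, w i₁ v •
            ∫ s in (0:ℝ)..v, w i₂ s •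
              ∫ p in (0:ℝ)..s, w i₃ p • LD3 i₃ i₂ i₁ (ξ p)‖ ≤
        (2 : ℝ) ^ (ϖ - 1) / 6 * (t * ν) ^ 3 * M₃ * ‖ξ 0 - ξs‖ ^ ϖ *
          (1 + M₁ ^ ϖ * (τ * ν) ^ ϖ * Real.exp (ν * L * ϖ * τ) *
            ‖ξ 0 - ξs‖ ^ (ϖ * (m - 1))) := by
  have hνle : ∀ t ∈ Icc 0 τ, ∑ i, |w i t| ≤ ν := fun t ht => hν.2 ⟨t, ht, rfl⟩
  have hν0 : 0 ≤ ν := le_trans (Finset.sum_nonneg fun i _ => abs_nonneg _)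
    (hνle 0 ⟨le_rfl, hτ⟩)
  have hξc : ContinuousOn ξ (Icc 0 τ) := fun t ht => (hode t ht).continuousWithinAt
  have h0 : (0:ℝ) ∈ Icc 0 τ := ⟨le_rfl, hτ⟩
  set a := ‖ξ 0 - ξs‖ with ha
  have ha0 : 0 ≤ a := norm_nonneg _
  have hgr : ∀ p ∈ Icc 0 τ, ‖ξ p - ξ 0‖ ≤ (ν * (M₁ * a ^ m)) * τ * Real.exp ((ν * L) * τ) := by
    intro p hp
    have key := norm_le_gronwallBound_of_norm_deriv_right_le (f := fun t => ξ t - ξ 0)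
      (f' := fun t => ∑ i : Fin l, w i t • h i (ξ t)) (δ := 0) (K := ν * L)
      (ε := ν * (M₁ * a ^ m)) (a := 0) (b := τ) (hξc.sub continuousOn_const)
      (fun x hx => ((hode x ⟨hx.1, hx.2.le⟩).sub_const _).mono_of_mem_nhdsWithin
        (Filter.mem_of_superset (Icc_mem_nhdsGE hx.2) (Icc_subset_Icc_left hx.1)))
      (by simp) (by
        intro x hx
        have hx' : x ∈ Icc 0 τ := ⟨hx.1, hx.2.le⟩
        calc _ ≤ ∑ i, ‖w i x • h i (ξ x)‖ := norm_sum_le _ _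
          _ ≤ ∑ i, |w i x| * (M₁ * a ^ m + L * ‖ξ x - ξ 0‖) := by
              gcongr with i
              rw [norm_smul, Real.norm_eq_abs]
              apply mul_le_mul_of_nonneg_left _ (abs_nonneg _)
              have h1 := (hLip i).norm_sub_le (hξD x hx') (hξD 0 h0)
              rw [Real.coe_toNNReal L hL] at h1
              have h2 := norm_le_norm_add_norm_sub' (h i (ξ x)) (h i (ξ 0))
              linarith [hbound1 i]
          _ = (∑ i, |w i x|) * (M₁ * a ^ m + L * ‖ξ x - ξ 0‖) := by rw [Finset.sum_mul]
          _ ≤ ν * (M₁ * a ^ m + L * ‖ξ x - ξ 0‖) :=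
              mul_le_mul_of_nonneg_right (hνle x hx') (by positivity)
          _ = _ := by ring) p hp
    refine key.trans ?_
    rw [sub_zero]
    exact cf_gronwall_aux _ _ _ _ (by positivity) (by positivity) hp.1 hp.2
  set B := 1 + M₁ ^ ϖ * (τ * ν) ^ ϖ * Real.exp (ν * L * ϖ * τ) * a ^ (ϖ * (m - 1)) with hB
  have hB0 : 0 ≤ B := by positivity
  have hpt : ∀ p ∈ Icc 0 τ, ‖ξ p - ξs‖ ^ ϖ ≤ 2 ^ (ϖ - 1) * (a ^ ϖ * B) := by
    intro p hp
    rcases hϖ with h1 | h1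
    · subst h1
      rw [hB]
      norm_num [Real.rpow_neg_one]
    · have hϖ0 : 0 ≤ ϖ := by linarith
      have t1 : ‖ξ p - ξs‖ ≤ a + (ν * (M₁ * a ^ m)) * τ * Real.exp ((ν * L) * τ) := by
        have := norm_sub_le_norm_sub_add_norm_sub (ξ p) (ξ 0) ξs
        linarith [hgr p hp]
      have t2 := Real.rpow_le_rpow (norm_nonneg _) t1 hϖ0
      refine t2.trans ((cf_rpow ha0 (by positivity) h1).trans ?_)
      apply le_of_eq
      congr 1
      have e1 : ν * (M₁ * a ^ m) * τ * Real.exp (ν * L * τ)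
          = M₁ * (τ * ν) * Real.exp (ν * L * τ) * a ^ m := by ring
      have e2 : (a ^ m) ^ ϖ = a ^ ϖ * a ^ (ϖ * (m - 1)) := by
        rw [← Real.rpow_mul ha0, ← Real.rpow_add_of_nonneg ha0 hϖ0
          (mul_nonneg hϖ0 (by linarith))]
        congr 1; ring
      rw [e1, Real.mul_rpow (by positivity) (by positivity),
        Real.mul_rpow (by positivity) (by positivity),
        Real.mul_rpow (by positivity) (by positivity), e2, ← Real.exp_mul, hB]
      rw [show ν * L * τ * ϖ = ν * L * ϖ * τ by ring]
      ring
  intro t ht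
  have := cf_triple (C := M₃ * (2 ^ (ϖ - 1) * (a ^ ϖ * B))) hτ hν0 hw hνle
    (F := fun i₁ i₂ i₃ p => LD3 i₃ i₂ i₁ (ξ p))
    (fun i j k => (hLD3cont k j i).comp hξc hξD) (by positivity)
    (fun i j k p hp => (hbound3 i j k _ (hξD p hp)).trans
      (mul_le_mul_of_nonneg_left (hpt p hp) hM₃)) ht
  refine this.trans (le_of_eq ?_)
  ring
end

section
/- Let D ⊆ ℝⁿ be a bounded convex domain, W ∈ C²(D; ℝ), x* ∈ D, m ≥ 1, and suppose that for all x ∈ D: σ₁₁‖x − x*‖^{2m} ≤ W(x) ≤ σ₁₂‖x − x*‖^{2m}, σ₂₁ W(x)^{2−1/m} ≤ ‖∇W(x)‖² ≤ σ₂₂ W(x)^{2−1/m}, and ‖∂²W(x)/∂x²‖ ≤ σ₃ W(x)^{1−1/m}, where σ₁₁, σ₁₂, σ₂₁, σ₂₂, σ₃ are positive constants. Let x⁰ ∈ D∖{x*}, γ > 0, ε > 0, r_ε ∈ ℝⁿ, and let x¹ = x⁰ − γε∇W(x⁰) + r_ε ∈ D. Then W(x¹) ≤ W(x⁰)(1 −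 (εκ₁/m)W(x⁰)^{1−1/m} + (ε²κ₂/(2m²))W(x⁰)^{2−2/m})^m, where κ₁ = γσ₂₁ − (√σ₂₂ ‖r_ε‖ W(x⁰)^{1/(2m)−1})/ε and κ₂ = ((m−1)σ₂₂ + mσ₃)(γ√σ₂₂ + (‖r_ε‖ W(x⁰)^{1/(2m)−1})/ε)². -/
open Set

lemma mono_except {h h' : ℝ → ℝ} (c : ℝ) (hc : ContinuousOn h (Icc 0 1))
    (hd : ∀ t ∈ Ioo (0:ℝ) 1, t ≠ c → HasDerivAt h (h' t) t ∧ 0 ≤ h' t) :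
    MonotoneOn h (Icc 0 1) := by
  have key : ∀ a b : ℝ, 0 ≤ a → b ≤ 1 → c ∉ Ioo a b → MonotoneOn h (Icc a b) := by
    intro a b ha hb hcab
    apply monotoneOn_of_hasDerivWithinAt_nonneg (f' := h') (convex_Icc a b)
      (hc.mono (Icc_subset_Icc ha hb))
    · intro x hx
      rw [interior_Icc] at hx
      exact (hd x ⟨by linarith [hx.1], by linarith [hx.2]⟩
        (fun e => hcab (e ▸ hx))).1.hasDerivWithinAt
    · intro x hx
      rw [interior_Icc] at hx
      exact (hd x ⟨by linarith [hx.1], by linarith [hx.2]⟩ (fun e => hcab (e ▸ hx))).2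
  by_cases h01 : c ∈ Ioo (0:ℝ) 1
  · have h1 := key 0 c le_rfl h01.2.le (by simp)
    have h2 := key c 1 h01.1.le le_rfl (by simp)
    have := h1.union_right h2 (isGreatest_Icc h01.1.le) (isLeast_Icc h01.2.le)
    rwa [Icc_union_Icc_eq_Icc h01.1.le h01.2.le] at this
  · exact key 0 1 le_rfl le_rfl h01

lemma taylor_except {v g g' : ℝ → ℝ} (c K : ℝ) (hv : ContinuousOn v (Icc 0 1))
    (hg : ContinuousOn g (Icc 0 1))
    (hd : ∀ t ∈ Ioo (0:ℝ) 1, t ≠ c →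
      HasDerivAt v (g t) t ∧ HasDerivAt g (g' t) t ∧ g' t ≤ K) :
    v 1 ≤ v 0 + g 0 + K / 2 := by
  have m1 : MonotoneOn (fun t => K * t - g t) (Icc 0 1) := by
    apply mono_except (h' := fun t => K * 1 - g' t) c
    · exact (by fun_prop : ContinuousOn (fun t : ℝ => K * t) _).sub hg
    · intro t ht htc
      obtain ⟨-, h2, h3⟩ := hd t ht htc
      exact ⟨((hasDerivAt_id t).const_mul K).sub h2, by linarith⟩
  have m2 : MonotoneOn (fun t => (g 0 * t + K / 2 * t ^ 2) - v t) (Icc 0 1) := by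
    apply mono_except (h' := fun t => (g 0 * 1 + K / 2 * (2 * t)) - g t) c
    · exact (by fun_prop : ContinuousOn (fun t : ℝ => g 0 * t + K / 2 * t ^ 2) _).sub hv
    · intro t ht htc
      obtain ⟨h1, h2, h3⟩ := hd t ht htc
      refine ⟨HasDerivAt.sub (HasDerivAt.add ((hasDerivAt_id t).const_mul _)
        (HasDerivAt.const_mul _ (by simpa using hasDerivAt_pow 2 t))) h1, ?_⟩
      have := m1 (⟨le_rfl, zero_le_one⟩ : (0:ℝ) ∈ Icc (0:ℝ) 1) ⟨ht.1.le, ht.2.le⟩ ht.1.le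
      simp only at this
      linarith
  have := m2 (⟨le_rfl, zero_le_one⟩ : (0:ℝ) ∈ Icc (0:ℝ) 1) ⟨zero_le_one, le_rfl⟩ zero_le_one
  simp only at this
  linarith

lemma seg_taylor {E : Type*} [NormedAddCommGroup E] [NormedSpace ℝ E]
    (D : Set E) (hDconv : Convex ℝ D) (hDopen : IsOpen D)
    (W : E → ℝ) (hW : ContDiffOn ℝ 2 W D) (xs : E) (m : ℝ) (hm : 1 ≤ m)
    (σ22 σ3 : ℝ) (hσ22 : 0 < σ22) (hσ3 : 0 < σ3)
    (hnn : ∀ x ∈ D, 0 ≤ W x) (hpos : ∀ x ∈ D, x ≠ xs → 0 < W x)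
    (hW2 : ∀ x ∈ D, ‖fderiv ℝ W x‖ ^ 2 ≤ σ22 * W x ^ (2 - 1 / m))
    (hW3 : ∀ x ∈ D, ‖fderiv ℝ (fun y => fderiv ℝ W y) x‖ ≤ σ3 * W x ^ (1 - 1 / m))
    (x0 : E) (hx0 : x0 ∈ D) (hx0ne : x0 ≠ xs) (d : E) (hx1 : x0 + d ∈ D) :
    W (x0 + d) ^ (1 / m) ≤ W x0 ^ (1 / m) + 1 / m * W x0 ^ (1 / m - 1) * fderiv ℝ W x0 d
      + (σ3 / m * ‖d‖ ^ 2) / 2 := by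
  have hm0 : 0 < m := by linarith
  have hmi : 0 < 1 / m := by positivity
  have hmi1 : 1 / m ≤ 1 := by rw [div_le_one hm0]; exact hm
  set x : ℝ → E := fun t => x0 + t • d with hx
  have hxD : ∀ t ∈ Icc (0:ℝ) 1, x t ∈ D := by
    intro t ht
    have := hDconv.add_smul_mem hx0 hx1 ht
    simpa [hx] using this
  have hxd : ∀ t, HasDerivAt x d t := by
    intro t
    have := ((hasDerivAt_id t).smul_const d).const_add x0
    rw [one_smul] at this
    exact this
  have hWd : ∀ y ∈ D, HasFDerivAt W (fderiv ℝ W y) y := fun y hy =>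
    ((hW.contDiffAt (hDopen.mem_nhds hy)).differentiableAt (by norm_num)).hasFDerivAt
  have hWdd : ∀ y ∈ D, HasFDerivAt (fun y => fderiv ℝ W y)
      (fderiv ℝ (fun y => fderiv ℝ W y) y) y := fun y hy => by
    have h1 : ContDiffAt ℝ 1 (fderiv ℝ W) y :=
      (hW.contDiffAt (hDopen.mem_nhds hy)).fderiv_right (by norm_num)
    exact (h1.differentiableAt (by norm_num)).hasFDerivAt
  have hφ : ∀ t ∈ Icc (0:ℝ) 1, HasDerivAt (fun t => W (x t)) (fderiv ℝ W (x t) d) t :=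
    fun t ht => (hWd _ (hxD t ht)).comp_hasDerivAt t (hxd t)
  have hφ' : ∀ t ∈ Icc (0:ℝ) 1, HasDerivAt (fun t => fderiv ℝ W (x t) d)
      (fderiv ℝ (fun y => fderiv ℝ W y) (x t) d d) t := by
    intro t ht
    have := (hWdd _ (hxD t ht)).comp_hasDerivAt t (hxd t)
    simpa using this.clm_apply (hasDerivAt_const t d)
  set g : ℝ → ℝ := fun t => fderiv ℝ W (x t) d * (1 / m) * W (x t) ^ (1 / m - 1) with hg
  set g' : ℝ → ℝ := fun t =>
    (fderiv ℝ (fun y => fderiv ℝ W y) (x t) d d * (1 / m)) * W (x t) ^ (1 / m - 1) +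
      fderiv ℝ W (x t) d * (1 / m) *
        (fderiv ℝ W (x t) d * (1 / m - 1) * W (x t) ^ (1 / m - 1 - 1)) with hg'
  have hgd : ∀ t ∈ Icc (0:ℝ) 1, W (x t) ≠ 0 → HasDerivAt g (g' t) t := by
    intro t ht h0
    exact ((hφ' t ht).mul_const (1 / m)).mul ((hφ t ht).rpow_const (Or.inl h0))
  have hvd : ∀ t ∈ Icc (0:ℝ) 1, W (x t) ≠ 0 →
      HasDerivAt (fun t => W (x t) ^ (1 / m)) (g t) t := by
    intro t ht h0
    exact (hφ t ht).rpow_const (Or.inl h0)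
  have hφc : ContinuousOn (fun t => W (x t)) (Icc 0 1) := fun t ht =>
    (hφ t ht).continuousAt.continuousWithinAt
  have hgb : ∀ t ∈ Icc (0:ℝ) 1, |g t| ≤ Real.sqrt σ22 * ‖d‖ * (1 / m) * W (x t) ^ (1 / (2 * m)) := by
    intro t ht
    have hw := hnn _ (hxD t ht)
    have h2 := hW2 _ (hxD t ht)
    rcases hw.eq_or_lt with h0 | h0
    · rw [← h0, Real.zero_rpow (by linarith), mul_zero] at h2
      have : fderiv ℝ W (x t) = 0 := by
        rw [← norm_eq_zero]; nlinarith [norm_nonneg (fderiv ℝ W (x t))]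
      simp only [hg, this]
      simp
      positivity
    · have h3 : ‖fderiv ℝ W (x t)‖ ≤ Real.sqrt σ22 * W (x t) ^ (1 - 1 / (2 * m)) := by
        rw [← abs_of_nonneg (norm_nonneg (fderiv ℝ W (x t)))]
        apply abs_le_of_sq_le_sq _ (by positivity)
        rw [mul_pow, Real.sq_sqrt hσ22.le, ← Real.rpow_natCast (W (x t) ^ _), ← Real.rpow_mul hw]
        have e0 : (1 - 1 / (2 * m)) * ((2 : ℕ) : ℝ) = 2 - 1 / m := by
          push_cast; field_simp
        rw [e0]; exact h2
      have h4 : |fderiv ℝ W (x t) d| ≤ Real.sqrt σ22 * W (x t) ^ (1 - 1 / (2 * m)) * ‖d‖ :=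
        ((fderiv ℝ W (x t)).le_opNorm d).trans (by gcongr)
      have e1 : W (x t) ^ (1 - 1 / (2 * m)) * W (x t) ^ (1 / m - 1) = W (x t) ^ (1 / (2 * m)) := by
        rw [← Real.rpow_add h0]; congr 1; field_simp; ring
      simp only [hg]
      rw [abs_mul, abs_mul, abs_of_pos hmi, abs_of_pos (Real.rpow_pos_of_pos h0 _)]
      calc _ ≤ Real.sqrt σ22 * W (x t) ^ (1 - 1 / (2 * m)) * ‖d‖ * (1 / m) * W (x t) ^ (1 / m - 1) := by
            gcongr
        _ = Real.sqrt σ22 * ‖d‖ * (1 / m) * (W (x t) ^ (1 - 1 / (2 * m)) * W (x t) ^ (1 / m - 1)) := by ring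
        _ = _ := by rw [e1]
  have hgc : ContinuousOn g (Icc 0 1) := by
    intro t ht
    by_cases h0 : W (x t) = 0
    · have hgt : g t = 0 := by
        have := hgb t ht
        rw [h0, Real.zero_rpow (by positivity), mul_zero] at this
        exact abs_nonpos_iff.1 this
      unfold ContinuousWithinAt
      rw [hgt]
      apply squeeze_zero_norm' (a := fun t => Real.sqrt σ22 * ‖d‖ * (1 / m) * W (x t) ^ (1 / (2 * m)))
      · filter_upwards [self_mem_nhdsWithin] with s hs using hgb s hs
      · have : ContinuousWithinAt (fun t => Real.sqrt σ22 * ‖d‖ * (1 / m) * W (x t) ^ (1 / (2 * m)))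
            (Icc 0 1) t :=
          ((hφc t ht).rpow_const (Or.inr (by positivity))).const_mul _
        unfold ContinuousWithinAt at this
        beta_reduce at this
        rwa [h0, Real.zero_rpow (by positivity), mul_zero] at this
    · exact (hgd t ht h0).continuousAt.continuousWithinAt
  have hc : ∃ c : ℝ, ∀ t, t ≠ c → x t ≠ xs := by
    by_cases h : ∃ c, x c = xs
    · obtain ⟨c, hc⟩ := h
      refine ⟨c, fun t htc he => ?_⟩
      have h1 : (t - c) • d = 0 := by
        rw [sub_smul, sub_eq_zero]
        have := he.trans hc.symm
        simpa [hx] using this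
      rcases smul_eq_zero.1 h1 with h | h
      · exact htc (sub_eq_zero.1 h)
      · apply hx0ne; simpa [hx, h] using hc
    · exact ⟨0, fun t _ he => h ⟨t, he⟩⟩
  obtain ⟨c, hc⟩ := hc
  have := taylor_except (v := fun t => W (x t) ^ (1 / m)) (g := g) (g' := g') c (σ3 / m * ‖d‖ ^ 2)
    (hφc.rpow_const (fun _ _ => Or.inr hmi.le)) hgc (by
      intro t ht htc
      have ht' : t ∈ Icc (0:ℝ) 1 := ⟨ht.1.le, ht.2.le⟩
      have hp := hpos _ (hxD t ht') (hc t htc)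
      refine ⟨hvd t ht' hp.ne', hgd t ht' hp.ne', ?_⟩
      have h3 : fderiv ℝ (fun y => fderiv ℝ W y) (x t) d d ≤ σ3 * W (x t) ^ (1 - 1 / m) * ‖d‖ ^ 2 := by
        refine (le_abs_self _).trans ?_
        refine (ContinuousLinearMap.le_opNorm₂ (fderiv ℝ (fun y => fderiv ℝ W y) (x t)) d d).trans ?_
        rw [mul_assoc, ← sq]
        gcongr
        exact hW3 _ (hxD t ht')
      have e1 : W (x t) ^ (1 - 1 / m) * W (x t) ^ (1 / m - 1) = 1 := by
        rw [← Real.rpow_add hp]; simp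
      have i1 : (fderiv ℝ (fun y => fderiv ℝ W y) (x t) d d * (1 / m)) * W (x t) ^ (1 / m - 1)
          ≤ σ3 / m * ‖d‖ ^ 2 := by
        calc _ ≤ (σ3 * W (x t) ^ (1 - 1 / m) * ‖d‖ ^ 2 * (1 / m)) * W (x t) ^ (1 / m - 1) := by
              gcongr
          _ = σ3 * (1 / m) * ‖d‖ ^ 2 * (W (x t) ^ (1 - 1 / m) * W (x t) ^ (1 / m - 1)) := by ring
          _ = _ := by rw [e1]; ring
      have i2 : fderiv ℝ W (x t) d * (1 / m) *
          (fderiv ℝ W (x t) d * (1 / m - 1) * W (x t) ^ (1 / m - 1 - 1)) ≤ 0 := by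
        have : 0 ≤ (fderiv ℝ W (x t) d) ^ 2 * (1 / m) * (1 - 1 / m) * W (x t) ^ (1 / m - 1 - 1) := by
          have : 0 ≤ 1 - 1 / m := by linarith
          positivity
        linarith
      simp only [hg']
      linarith)
  simp only [hg, hx, one_smul, zero_smul, add_zero] at this
  linarith

/-- **Lemma 4 (decay along an approximate gradient step).** If `W ∈ C²(D)` on a bounded convex
domain satisfies the quadratic-type growth/gradient/Hessian bounds of order `m ≥ 1`, and
`x¹ = x⁰ − γε∇W(x⁰) + r_ε ∈ D`, then
`W(x¹) ≤ W(x⁰)(1 − (εκ₁/m)W(x⁰)^{1−1/m} + (ε²κ₂/(2m²))W(x⁰)^{2−2/m})^m` with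
`κ₁ = γσ₂₁ − √σ₂₂‖r_ε‖W(x⁰)^{1/(2m)−1}/ε` and
`κ₂ = ((m−1)σ₂₂ + mσ₃)(γ√σ₂₂ + ‖r_ε‖W(x⁰)^{1/(2m)−1}/ε)²`. -/
theorem gradient_step_decay {n : ℕ}
    (D : Set (EuclideanSpace ℝ (Fin n)))
    (hDconv : Convex ℝ D) (hDbdd : Bornology.IsBounded D) (hDopen : IsOpen D)
    (W : EuclideanSpace ℝ (Fin n) → ℝ) (hW : ContDiffOn ℝ 2 W D)
    (xs : EuclideanSpace ℝ (Fin n)) (hxs : xs ∈ D)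
    (m : ℝ) (hm : 1 ≤ m)
    (σ11 σ12 σ21 σ22 σ3 : ℝ)
    (hσ11 : 0 < σ11) (hσ12 : 0 < σ12) (hσ21 : 0 < σ21) (hσ22 : 0 < σ22) (hσ3 : 0 < σ3)
    (hW1 : ∀ x ∈ D, σ11 * ‖x - xs‖ ^ (2 * m) ≤ W x ∧ W x ≤ σ12 * ‖x - xs‖ ^ (2 * m))
    (hW2 : ∀ x ∈ D, σ21 * W x ^ (2 - 1 / m) ≤ ‖gradient W x‖ ^ 2 ∧
      ‖gradient W x‖ ^ 2 ≤ σ22 * W x ^ (2 - 1 / m))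
    (hW3 : ∀ x ∈ D, ‖fderiv ℝ (fun y => fderiv ℝ W y) x‖ ≤ σ3 * W x ^ (1 - 1 / m))
    (x0 : EuclideanSpace ℝ (Fin n)) (hx0 : x0 ∈ D) (hx0ne : x0 ≠ xs)
    (γ ε : ℝ) (hγ : 0 < γ) (hε : 0 < ε)
    (r : EuclideanSpace ℝ (Fin n))
    (x1 : EuclideanSpace ℝ (Fin n))
    (hx1def : x1 = x0 - (γ * ε) • gradient W x0 + r)
    (hx1 : x1 ∈ D) :
    W x1 ≤ W x0 *
      (1 - ε * (γ * σ21 - Real.sqrt σ22 * ‖r‖ * W x0 ^ (1 / (2 * m) - 1) / ε) / m *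
          W x0 ^ (1 - 1 / m)
        + ε ^ 2 * (((m - 1) * σ22 + m * σ3) *
            (γ * Real.sqrt σ22 + ‖r‖ * W x0 ^ (1 / (2 * m) - 1) / ε) ^ 2) / (2 * m ^ 2) *
          W x0 ^ (2 - 2 / m)) ^ m := by
  have hm0 : 0 < m := by linarith
  have hmi : 0 < 1 / m := by positivity
  have hgn : ∀ x, ‖gradient W x‖ = ‖fderiv ℝ W x‖ := fun x => by simp [gradient]
  have hgi : ∀ x y, fderiv ℝ W x y = inner ℝ (gradient W x) y := fun x y => by
    simp [gradient]
  have hpos : ∀ x ∈ D, x ≠ xs → 0 < W x := fun x hx hne => by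
    have : 0 < ‖x - xs‖ := norm_pos_iff.2 (sub_ne_zero.2 hne)
    exact lt_of_lt_of_le (by positivity) (hW1 x hx).1
  have hnn : ∀ x ∈ D, 0 ≤ W x := fun x hx => le_trans (by positivity) (hW1 x hx).1
  have hw := hpos x0 hx0 hx0ne
  set d : EuclideanSpace ℝ (Fin n) := -((γ * ε) • gradient W x0) + r with hd
  have hx1d : x1 = x0 + d := by rw [hx1def, hd]; abel
  have hT := seg_taylor D hDconv hDopen W hW xs m hm σ22 σ3 hσ22 hσ3 hnn hpos
    (fun x hx => by rw [← hgn]; exact (hW2 x hx).2) hW3 x0 hx0 hx0ne d (hx1d ▸ hx1)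
  rw [← hx1d, hgi] at hT
  obtain ⟨hl, hu⟩ := hW2 x0 hx0
  set w := W x0 with hwdef
  set G := ‖gradient W x0‖ with hG
  have hG0 : 0 ≤ G := norm_nonneg _
  have hs := Real.sq_sqrt hσ22.le
  have hs0 := Real.sqrt_nonneg σ22
  set s := Real.sqrt σ22
  -- power variables
  set q := w ^ (1 / (2 * m)) with hq
  have hq0 : 0 < q := Real.rpow_pos_of_pos hw _
  have e1 : w ^ (1 / m) = q ^ 2 := by
    rw [hq, ← Real.rpow_natCast, ← Real.rpow_mul hw.le]; congr 1; push_cast; field_simp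
  have e2 : w ^ (1 / m - 1) = q ^ 2 / w := by rw [Real.rpow_sub hw, e1, Real.rpow_one]
  have e3 : w ^ (2 - 1 / m) = w ^ 2 / q ^ 2 := by
    rw [Real.rpow_sub hw, e1, Real.rpow_ofNat]
  have e4 : w ^ (1 / (2 * m) - 1) = q / w := by rw [Real.rpow_sub hw, Real.rpow_one]
  have e5 : w ^ (1 - 1 / m) = w / q ^ 2 := by rw [Real.rpow_sub hw, e1, Real.rpow_one]
  have e6 : w ^ (2 - 2 / m) = w ^ 2 / q ^ 4 := by
    rw [Real.rpow_sub hw, Real.rpow_ofNat, show (2 / m : ℝ) = 1 / m * (2:ℕ) by push_cast; ring,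
      Real.rpow_mul hw.le, e1, Real.rpow_natCast]; ring
  rw [e3] at hl hu
  have hGu : G ≤ s * (w / q) := by
    rw [← abs_of_nonneg hG0]
    apply abs_le_of_sq_le_sq _ (by positivity)
    rw [mul_pow, hs, div_pow]; exact hu
  have hin : inner ℝ (gradient W x0) d ≤ -(γ * ε) * (σ21 * (w ^ 2 / q ^ 2)) + s * (w / q) * ‖r‖ := by
    rw [hd, inner_add_right, inner_neg_right, inner_smul_right, real_inner_self_eq_norm_sq]
    have h1 : inner ℝ (gradient W x0) r ≤ s * (w / q) * ‖r‖ :=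
      (real_inner_le_norm _ _).trans (by gcongr)
    have h2 := mul_le_mul_of_nonneg_left hl (by positivity : 0 ≤ γ * ε)
    linarith
  have hdn : ‖d‖ ≤ ε * (w / q) * (γ * s + ‖r‖ * (q / w) / ε) := by
    have h1 : ‖d‖ ≤ γ * ε * G + ‖r‖ := by
      refine (norm_add_le _ _).trans ?_
      rw [norm_neg, norm_smul, Real.norm_of_nonneg (by positivity)]
    have h2 := mul_le_mul_of_nonneg_left hGu (by positivity : 0 ≤ γ * ε)
    refine (h1.trans (by linarith : _ ≤ γ * ε * (s * (w / q)) + ‖r‖)).trans (le_of_eq ?_)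
    field_simp
  rw [e4, e5, e6]
  set Q := γ * s + ‖r‖ * (q / w) / ε with hQ
  set B := 1 - ε * (γ * σ21 - s * ‖r‖ * (q / w) / ε) / m * (w / q ^ 2) +
    ε ^ 2 * (((m - 1) * σ22 + m * σ3) * Q ^ 2) / (2 * m ^ 2) * (w ^ 2 / q ^ 4) with hB
  have hfin : W x1 ^ (1 / m) ≤ q ^ 2 * B := by
    refine hT.trans ?_
    rw [e1, e2]
    have hk : σ3 / m ≤ ((m - 1) * σ22 + m * σ3) / m ^ 2 := by
      rw [div_le_div_iff₀ hm0 (by positivity)]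
      have : 0 ≤ (m - 1) * σ22 * m := mul_nonneg (mul_nonneg (by linarith) hσ22.le) hm0.le
      nlinarith
    calc _ ≤ q ^ 2 + 1 / m * (q ^ 2 / w) *
            (-(γ * ε) * (σ21 * (w ^ 2 / q ^ 2)) + s * (w / q) * ‖r‖)
          + (((m - 1) * σ22 + m * σ3) / m ^ 2 * (ε * (w / q) * Q) ^ 2) / 2 := by
          have : 0 ≤ ((m - 1) * σ22 + m * σ3) / m ^ 2 := le_trans (by positivity) hk
          gcongr
      _ = _ := by
          rw [hB]
          field_simp
          ring
  have hx1n := hnn x1 hx1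
  have hB0 : 0 ≤ B := by
    have : 0 ≤ q ^ 2 * B := le_trans (by positivity) hfin
    exact nonneg_of_mul_nonneg_right this (by positivity)
  calc W x1 = (W x1 ^ (1 / m)) ^ m := by
        rw [← Real.rpow_mul hx1n]; simp [hm0.ne']
    _ ≤ (q ^ 2 * B) ^ m := by gcongr
    _ = w * B ^ m := by
        rw [Real.mul_rpow (by positivity) hB0, ← e1, ← Real.rpow_mul hw.le]; simp [hm0.ne']
end

section
/- Let m, n ∈ ℕ, let S₁ ⊆ {1,…,m} and S₂ ⊆ {1,…,m}² with S₂ nonempty and |S₁| + |S₂| = n, and let κ_{i₁i₂} ∈ ℕ (positive integers) for (i₁,i₂) ∈ S₂. Let a ∈ ℝⁿ have components (a_{i₁})_{i₁∈S₁} and (a_{i₁i₂})_{(i₁,i₂)∈S₂}, and suppose ‖a‖ ≤ γ₁αd for some γ₁, α > 0 and d ≥ 0. For ε > 0 define φ_i(t) = Σ_{i₁∈S₁} a_{i₁}δ_{ii₁} + √(4π/ε) Σ_{(i₁,i₂)∈S₂} √(κ_{i₁i₂}|a_{i₁i₂}|)(δ_{ii₁} sign(a_{i₁i₂}) cos(2πκ_{i₁i₂}t/ε)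 + δ_{ii₂} sin(2πκ_{i₁i₂}t/ε)) for i = 1,…,m. Then for all t ∈ ℝ, ε Σ_{i=1}^m |φ_i(t)| ≤ ε Σ_{i₁∈S₁} |a_{i₁}| + 2√(2πε) Σ_{(i₁,i₂)∈S₂} √(κ_{i₁i₂}|a_{i₁i₂}|) ≤ c_u √(γ₁εd), where c_u = √α (√(γ₁αεd|S₁|) + 2√(2π)) (Σ_{(j₁,j₂)∈S₂} κ_{j₁j₂}^{2/3})^{3/4}. -/
open Real


lemma aux_abs_cs (x : ℝ) : |cos x| + |sin x| ≤ √2 := by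
  apply Real.le_sqrt_of_sq_le
  nlinarith [sq_nonneg (|cos x| - |sin x|), sq_abs (cos x), sq_abs (sin x), Real.sin_sq_add_cos_sq x]

lemma aux_sign (x : ℝ) : |Real.sign x| ≤ 1 := by
  rcases Real.sign_apply_eq x with h | h | h <;> rw [h] <;> norm_num

lemma aux_first {m : ℕ} {ι₁ ι₂ : Type*} (s : Finset ι₁) (u : Finset ι₂)
    (x : ι₁ → ℝ) (e : ι₁ → Fin m) (c : ℝ) (hc : 0 ≤ c) (w σ θ : ι₂ → ℝ)
    (hw : ∀ p, 0 ≤ w p) (hσ : ∀ p, |σ p| ≤ 1) (f g : ι₂ → Fin m) :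
    ∑ i : Fin m, |(∑ j ∈ s, x j * (if i = e j then (1:ℝ) else 0)) +
      c * ∑ p ∈ u, w p * ((if i = f p then (1:ℝ) else 0) * σ p * cos (θ p) +
        (if i = g p then (1:ℝ) else 0) * sin (θ p))| ≤
    ∑ j ∈ s, |x j| + c * (√2 * ∑ p ∈ u, w p) := by
  have h1 : ∀ i : Fin m, |(∑ j ∈ s, x j * (if i = e j then (1:ℝ) else 0)) +
      c * ∑ p ∈ u, w p * ((if i = f p then (1:ℝ) else 0) * σ p * cos (θ p) +
        (if i = g p then (1:ℝ) else 0) * sin (θ p))| ≤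
      (∑ j ∈ s, |x j| * (if i = e j then (1:ℝ) else 0)) +
      c * ∑ p ∈ u, w p * ((if i = f p then (1:ℝ) else 0) * |cos (θ p)| +
        (if i = g p then (1:ℝ) else 0) * |sin (θ p)|) := by
    intro i
    refine (abs_add_le _ _).trans (add_le_add ?_ ?_)
    · refine (Finset.abs_sum_le_sum_abs _ _).trans (Finset.sum_le_sum fun j _ => ?_)
      split_ifs <;> simp
    · rw [abs_mul, abs_of_nonneg hc]
      refine mul_le_mul_of_nonneg_left ?_ hc
      refine (Finset.abs_sum_le_sum_abs _ _).trans (Finset.sum_le_sum fun p _ => ?_)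
      rw [abs_mul, abs_of_nonneg (hw p)]
      refine mul_le_mul_of_nonneg_left ?_ (hw p)
      refine (abs_add_le _ _).trans (add_le_add ?_ ?_)
      · split_ifs
        · rw [one_mul, one_mul, abs_mul]
          exact mul_le_of_le_one_left (abs_nonneg _) (hσ p)
        · simp
      · split_ifs <;> simp
  refine (Finset.sum_le_sum fun i _ => h1 i).trans ?_
  rw [Finset.sum_add_distrib, ← Finset.mul_sum, Finset.sum_comm]
  refine add_le_add (le_of_eq ?_) (mul_le_mul_of_nonneg_left ?_ hc)
  · simp
  · rw [Finset.sum_comm, Finset.mul_sum]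
    refine Finset.sum_le_sum fun p _ => ?_
    rw [← Finset.mul_sum, Finset.sum_add_distrib, ← Finset.sum_mul, ← Finset.sum_mul]
    simp only [Finset.sum_ite_eq', Finset.mem_univ, if_true, one_mul]
    rw [mul_comm (√2)]
    exact mul_le_mul_of_nonneg_left (aux_abs_cs _) (hw p)

lemma aux_holder {ι : Type*} (s : Finset ι) (k y : ι → ℝ) (hk : ∀ p, 0 ≤ k p) (M : ℝ)
    (hM : 0 ≤ M) (hy : ∑ p ∈ s, y p ^ 2 ≤ M ^ 2) :
    ∑ p ∈ s, √(k p * |y p|) ≤ (∑ p ∈ s, k p ^ ((2:ℝ)/3)) ^ ((3:ℝ)/4) * √M := by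
  have hpq : (4/3 : ℝ).HolderConjugate 4 := by
    rw [Real.holderConjugate_iff]; norm_num
  have h := Real.inner_le_Lp_mul_Lq_of_nonneg s hpq (f := fun p => √(k p))
    (g := fun p => √(|y p|)) (fun _ _ => sqrt_nonneg _) (fun _ _ => sqrt_nonneg _)
  have e1 : ∀ p, √(k p) ^ (4/3 : ℝ) = k p ^ ((2:ℝ)/3) := by
    intro p
    rw [Real.sqrt_eq_rpow, ← Real.rpow_mul (hk p)]; norm_num
  have e2 : ∀ p, √(|y p|) ^ (4 : ℝ) = y p ^ 2 := by
    intro p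
    rw [Real.sqrt_eq_rpow, ← Real.rpow_mul (abs_nonneg _)]; norm_num
  simp only [e1, e2] at h
  simp only [Real.sqrt_mul (hk _)]
  refine h.trans ?_
  rw [show (1 / (4/3) : ℝ) = 3/4 by norm_num]
  refine mul_le_mul_of_nonneg_left ?_ (Real.rpow_nonneg
    (Finset.sum_nonneg fun p _ => Real.rpow_nonneg (hk p) _) _)
  calc _ ≤ (M ^ 2) ^ (1/4 : ℝ) :=
        Real.rpow_le_rpow (Finset.sum_nonneg fun p _ => sq_nonneg _) hy (by norm_num)
    _ = √M := by
        rw [Real.sqrt_eq_rpow, ← Real.rpow_natCast, ← Real.rpow_mul hM]; norm_num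

lemma aux_cs {ι : Type*} (s : Finset ι) (x : ι → ℝ) (M : ℝ)
    (hM : 0 ≤ M) (hx : ∑ p ∈ s, x p ^ 2 ≤ M ^ 2) :
    ∑ p ∈ s, |x p| ≤ √(s.card) * M := by
  have h := sq_sum_le_card_mul_sum_sq (s := s) (f := fun p => |x p|)
  simp only [sq_abs] at h
  apply abs_le_of_sq_le_sq' _ (by positivity) |>.2
  rw [mul_pow, Real.sq_sqrt (by positivity)]
  exact h.trans (mul_le_mul_of_nonneg_left hx (by positivity))

/-- **Bound on the sampled stabilizing controls.** With coefficient vector `a` indexed by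
`S₁ ⊕ S₂` (with `‖a‖ ≤ γ₁αd`) and the fast-oscillating controls
`φᵢ(t) = Σ_{i₁∈S₁}a_{i₁}δ_{ii₁} + √(4π/ε)Σ_{(i₁,i₂)∈S₂}√(κ_{i₁i₂}|a_{i₁i₂}|)(δ_{ii₁}sign(a_{i₁i₂})cos(2πκ_{i₁i₂}t/ε) + δ_{ii₂}sin(2πκ_{i₁i₂}t/ε))`,
one has `εΣᵢ|φᵢ(t)| ≤ εΣ_{S₁}|a_{i₁}| + 2√(2πε)Σ_{S₂}√(κ_{i₁i₂}|a_{i₁i₂}|) ≤ c_u√(γ₁εd)` with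
`c_u = √α(√(γ₁αεd|S₁|) + 2√(2π))(Σ_{S₂}κ^{2/3})^{3/4}`. -/
theorem control_magnitude_bound (m n : ℕ)
    (S₁ : Finset (Fin m)) (S₂ : Finset (Fin m × Fin m)) (hS₂ : S₂.Nonempty)
    (idx : (↥S₁ ⊕ ↥S₂) ≃ Fin n)
    (κ : Fin m × Fin m → ℕ) (hκ : ∀ p ∈ S₂, 0 < κ p)
    (a : EuclideanSpace ℝ (Fin n))
    (γ₁ α d : ℝ) (hγ₁ : 0 < γ₁) (hα : 0 < α) (hd : 0 ≤ d)
    (ha : ‖a‖ ≤ γ₁ * α * d)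
    (ε : ℝ) (hε : 0 < ε) (t : ℝ) :
    ε * (∑ i : Fin m,
        |(∑ i₁ ∈ S₁.attach, a (idx (Sum.inl i₁)) * (if i = ↑i₁ then (1:ℝ) else 0)) +
          Real.sqrt (4 * π / ε) * ∑ p ∈ S₂.attach,
            Real.sqrt (κ p.1 * |a (idx (Sum.inr p))|) *
              ((if i = p.1.1 then (1:ℝ) else 0) * Real.sign (a (idx (Sum.inr p))) *
                  Real.cos (2 * π * κ p.1 * t / ε) +
                (if i = p.1.2 then (1:ℝ) else 0) * Real.sin (2 * π * κ p.1 * t / ε))|) ≤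
      ε * (∑ i₁ ∈ S₁.attach, |a (idx (Sum.inl i₁))|) +
        2 * Real.sqrt (2 * π * ε) *
          ∑ p ∈ S₂.attach, Real.sqrt (κ p.1 * |a (idx (Sum.inr p))|) ∧
    ε * (∑ i₁ ∈ S₁.attach, |a (idx (Sum.inl i₁))|) +
        2 * Real.sqrt (2 * π * ε) *
          ∑ p ∈ S₂.attach, Real.sqrt (κ p.1 * |a (idx (Sum.inr p))|) ≤
      (Real.sqrt α * (Real.sqrt (γ₁ * α * ε * d * S₁.card) + 2 * Real.sqrt (2 * π)) *
          (∑ p ∈ S₂, ((κ p : ℝ) ^ ((2:ℝ)/3))) ^ ((3:ℝ)/4)) *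
        Real.sqrt (γ₁ * ε * d) := by
  have hM : 0 ≤ γ₁ * α * d := by positivity
  have hsum : ∑ p ∈ S₁.attach, a (idx (Sum.inl p)) ^ 2 +
      ∑ p ∈ S₂.attach, a (idx (Sum.inr p)) ^ 2 ≤ (γ₁ * α * d) ^ 2 := by
    have h1 : ‖a‖ ^ 2 ≤ (γ₁ * α * d) ^ 2 := pow_le_pow_left₀ (norm_nonneg _) ha 2
    rw [EuclideanSpace.real_norm_sq_eq, ← idx.sum_comp, Fintype.sum_sum_type] at h1
    exact h1
  have hx0 : 0 ≤ ∑ p ∈ S₁.attach, a (idx (Sum.inl p)) ^ 2 := Finset.sum_nonneg fun _ _ => sq_nonneg _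
  have hy0 : 0 ≤ ∑ p ∈ S₂.attach, a (idx (Sum.inr p)) ^ 2 := Finset.sum_nonneg fun _ _ => sq_nonneg _
  constructor
  · have h := aux_first S₁.attach S₂.attach (fun j => a (idx (Sum.inl j))) (fun j => (j : Fin m))
      (√(4 * π / ε)) (sqrt_nonneg _) (fun p => √(κ p.1 * |a (idx (Sum.inr p))|))
      (fun p => Real.sign (a (idx (Sum.inr p)))) (fun p => 2 * π * κ p.1 * t / ε)
      (fun _ => sqrt_nonneg _) (fun _ => aux_sign _) (fun p => p.1.1) (fun p => p.1.2)
    refine (mul_le_mul_of_nonneg_left h hε.le).trans (le_of_eq ?_)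
    have hc : ε * (√(4 * π / ε) * √2) = 2 * √(2 * π * ε) := by
      rw [← Real.sqrt_mul (by positivity)]
      nth_rewrite 1 [← Real.sqrt_sq hε.le]
      rw [← Real.sqrt_mul (by positivity)]
      rw [show (2:ℝ) * √(2 * π * ε) = √(2^2) * √(2 * π * ε) by rw [Real.sqrt_sq (by norm_num)]]
      rw [← Real.sqrt_mul (by positivity)]
      congr 1
      field_simp
      ring
    rw [← hc]
    ring
  · have h1 := aux_cs S₁.attach (fun j => a (idx (Sum.inl j))) _ hM (by linarith)
    have h2 := aux_holder S₂.attach (fun p => (κ p.1 : ℝ)) (fun j => a (idx (Sum.inr j)))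
      (fun _ => by positivity) _ hM (by linarith)
    rw [Finset.card_attach] at h1
    rw [Finset.sum_attach S₂ (fun p => (κ p : ℝ) ^ ((2:ℝ)/3))] at h2
    have hK : 1 ≤ (∑ p ∈ S₂, ((κ p : ℝ) ^ ((2:ℝ)/3))) ^ ((3:ℝ)/4) := by
      apply Real.one_le_rpow _ (by norm_num)
      obtain ⟨p, hp⟩ := hS₂
      have : (1:ℝ) ≤ (κ p : ℝ) ^ ((2:ℝ)/3) :=
        Real.one_le_rpow (by exact_mod_cast hκ p hp) (by norm_num)
      exact this.trans (Finset.single_le_sum (f := fun p => (κ p : ℝ) ^ ((2:ℝ)/3))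
        (fun _ _ => by positivity) hp)
    generalize (∑ p ∈ S₂, ((κ p : ℝ) ^ ((2:ℝ)/3))) ^ ((3:ℝ)/4) = K at *
    have e1 : √α * √(γ₁ * α * ε * d * S₁.card) * √(γ₁ * ε * d) =
        ε * (√(S₁.card) * (γ₁ * α * d)) := by
      rw [← Real.sqrt_mul (by positivity), ← Real.sqrt_mul (by positivity),
        show α * (γ₁ * α * ε * d * S₁.card) * (γ₁ * ε * d) =
          S₁.card * (ε * (γ₁ * α * d)) ^ 2 by ring,
        Real.sqrt_mul (by positivity), Real.sqrt_sq (by positivity)]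
      ring
    have e2 : √α * √(2 * π) * √(γ₁ * ε * d) = √(2 * π * ε) * √(γ₁ * α * d) := by
      rw [← Real.sqrt_mul (by positivity), ← Real.sqrt_mul (by positivity),
        ← Real.sqrt_mul (by positivity)]
      congr 1
      ring
    have f1 := mul_le_mul_of_nonneg_left h1 hε.le
    have f2 := mul_le_mul_of_nonneg_left h2 (show 0 ≤ 2 * √(2 * π * ε) by positivity)
    have f3 : ε * (√(S₁.card) * (γ₁ * α * d)) ≤ ε * (√(S₁.card) * (γ₁ * α * d)) * K :=
      le_mul_of_one_le_right (by positivity) hK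
    have e3 : (√α * (√(γ₁ * α * ε * d * S₁.card) + 2 * √(2 * π)) * K) * √(γ₁ * ε * d) =
        ε * (√(S₁.card) * (γ₁ * α * d)) * K + 2 * √(2 * π * ε) * (K * √(γ₁ * α * d)) := by
      linear_combination K * e1 + 2 * K * e2
    rw [e3]
    exact add_le_add (f1.trans f3) f2
end

section
/- The functions g₁(z) = √((1 − e^{−z})/(1 + e^{z}))·sin(e^{z} + 2ln(e^{z} − 1)) and g₂(z) = √((1 − e^{−z})/(1 + e^{z}))·cos(e^{z} + 2ln(e^{z} − 1)), defined for z > 0, satisfy r(z)²φ'(z) = 1 with r(z) = √((1 − e^{−z})/(1 + e^{z})) and φ(z) = e^{z} + 2ln(e^{z} − 1), and consequently the Lie-bracket relation [g₁, g₂](z) = g₁(z)g₂'(z) − g₂(z)g₁'(z) = −1 holds for all z > 0. -/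
open Real

/-- The generating functions `g₁(z) = √((1−e^{−z})/(1+e^z)) sin(e^z + 2 ln(e^z − 1))`,
`g₂(z) = √((1−e^{−z})/(1+e^z)) cos(e^z + 2 ln(e^z − 1))` on `(0,∞)` satisfy
`r(z)²φ'(z) = 1` with `r(z) = √((1−e^{−z})/(1+e^z))`, `φ(z) = e^z + 2 ln(e^z − 1)`, and hence
the Lie-bracket relation `g₁ g₂' − g₂ g₁' = −1`. -/
theorem bracket_exp_generating :
    ∀ z : ℝ, 0 < z →
      (Real.sqrt ((1 - Real.exp (-z)) / (1 + Real.exp z))) ^ 2 *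
          deriv (fun w => Real.exp w + 2 * Real.log (Real.exp w - 1)) z = 1 ∧
      (Real.sqrt ((1 - Real.exp (-z)) / (1 + Real.exp z)) *
            Real.sin (Real.exp z + 2 * Real.log (Real.exp z - 1))) *
          deriv (fun w => Real.sqrt ((1 - Real.exp (-w)) / (1 + Real.exp w)) *
            Real.cos (Real.exp w + 2 * Real.log (Real.exp w - 1))) z -
        (Real.sqrt ((1 - Real.exp (-z)) / (1 + Real.exp z)) *
            Real.cos (Real.exp z + 2 * Real.log (Real.exp z - 1))) *
          deriv (fun w => Real.sqrt ((1 - Real.exp (-w)) / (1 + Real.exp w)) *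
            Real.sin (Real.exp w + 2 * Real.log (Real.exp w - 1))) z = -1 := by
  intro z hz
  have hE : 1 < Real.exp z := Real.one_lt_exp_iff.mpr hz
  have hE1 : Real.exp z - 1 ≠ 0 := by linarith
  have hE2 : 1 + Real.exp z ≠ 0 := by linarith
  have hn : Real.exp (-z) < 1 := by
    rw [Real.exp_lt_one_iff]; linarith
  have hq : 0 < (1 - Real.exp (-z)) / (1 + Real.exp z) :=
    div_pos (by linarith) (by linarith)
  have hphi : HasDerivAt (fun w => Real.exp w + 2 * Real.log (Real.exp w - 1))
      (Real.exp z + 2 * (Real.exp z / (Real.exp z - 1))) z :=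
    (Real.hasDerivAt_exp z).add
      ((((Real.hasDerivAt_exp z).sub_const 1).log hE1).const_mul 2)
  have hr : DifferentiableAt ℝ
      (fun w => Real.sqrt ((1 - Real.exp (-w)) / (1 + Real.exp w))) z := by
    refine DifferentiableAt.sqrt (f := fun w => (1 - Real.exp (-w)) / (1 + Real.exp w)) ?_ hq.ne'
    refine DifferentiableAt.fun_div ?_ ?_ ?_
    · fun_prop
    · fun_prop
    · exact hE2
  have hr' := hr.hasDerivAt
  have key : (Real.sqrt ((1 - Real.exp (-z)) / (1 + Real.exp z))) ^ 2 *
      (Real.exp z + 2 * (Real.exp z / (Real.exp z - 1))) = 1 := by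
    rw [Real.sq_sqrt hq.le, Real.exp_neg]
    have := Real.exp_ne_zero z
    field_simp
    ring
  have hc := (hr'.fun_mul hphi.cos).deriv
  have hs := (hr'.fun_mul hphi.sin).deriv
  refine ⟨by rw [hphi.deriv]; exact key, ?_⟩
  rw [hc, hs]
  have hsc := Real.sin_sq_add_cos_sq (Real.exp z + 2 * Real.log (Real.exp z - 1))
  generalize Real.exp z + 2 * Real.log (Real.exp z - 1) = a at *
  generalize Real.exp z + 2 * (Real.exp z / (Real.exp z - 1)) = b at *
  generalize deriv (fun w => Real.sqrt ((1 - Real.exp (-w)) / (1 + Real.exp w))) z = d at *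
  generalize Real.sqrt ((1 - Real.exp (-z)) / (1 + Real.exp z)) = r at *
  linear_combination (-(r ^ 2 * b)) * hsc - key
end

section
/- The functions g₁(z) = √(tanh(z/2))·sin(2ln(e^{z} − 1) − z) and g₂(z) = √(tanh(z/2))·cos(2ln(e^{z} − 1) − z), defined for z > 0, satisfy r(z)²φ'(z) = 1 with r(z) = √(tanh(z/2)) and φ(z) = 2ln(e^{z} − 1) − z, and consequently the Lie-bracket relation [g₁, g₂](z) = g₁(z)g₂'(z) − g₂(z)g₁'(z) = −1 holds for all z > 0. -/
open Real

/-- The generating functions `g₁(z) = √(tanh(z/2)) sin(2 ln(e^z − 1) − z)`,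
`g₂(z) = √(tanh(z/2)) cos(2 ln(e^z − 1) − z)` on `(0,∞)` satisfy `r(z)²φ'(z) = 1` with
`r(z) = √(tanh(z/2))`, `φ(z) = 2 ln(e^z − 1) − z`, and hence the Lie-bracket relation
`g₁ g₂' − g₂ g₁' = −1`. -/
theorem bracket_tanh_generating :
    ∀ z : ℝ, 0 < z →
      (Real.sqrt (Real.tanh (z / 2))) ^ 2 *
          deriv (fun w => 2 * Real.log (Real.exp w - 1) - w) z = 1 ∧
      (Real.sqrt (Real.tanh (z / 2)) * Real.sin (2 * Real.log (Real.exp z - 1) - z)) *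
          deriv (fun w => Real.sqrt (Real.tanh (w / 2)) *
            Real.cos (2 * Real.log (Real.exp w - 1) - w)) z -
        (Real.sqrt (Real.tanh (z / 2)) * Real.cos (2 * Real.log (Real.exp z - 1) - z)) *
          deriv (fun w => Real.sqrt (Real.tanh (w / 2)) *
            Real.sin (2 * Real.log (Real.exp w - 1) - w)) z = -1 := by
  intro z hz
  have hE : 0 < Real.exp z - 1 := by
    have := Real.one_lt_exp_iff.mpr hz
    linarith
  have hT : Real.tanh (z / 2) = (Real.exp z - 1) / (Real.exp z + 1) := by
    have h1 : Real.exp z = Real.exp (z / 2) * Real.exp (z / 2) := by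
      rw [← Real.exp_add]; congr 1; ring
    have hp := Real.exp_pos (z / 2)
    rw [Real.tanh_eq_sinh_div_cosh, Real.sinh_eq, Real.cosh_eq, Real.exp_neg, h1]
    field_simp
  have hTpos : 0 < Real.tanh (z / 2) := by
    rw [hT]; positivity
  have hphi : HasDerivAt (fun w => 2 * Real.log (Real.exp w - 1) - w)
      (2 * (Real.exp z / (Real.exp z - 1)) - 1) z :=
    ((((Real.hasDerivAt_exp z).sub_const 1).log hE.ne').const_mul 2).sub (hasDerivAt_id z)
  have hr : DifferentiableAt ℝ (fun w => Real.sqrt (Real.tanh (w / 2))) z := by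
    refine DifferentiableAt.sqrt (f := fun w => Real.tanh (w / 2)) ?_ hTpos.ne'
    simp only [Real.tanh_eq_sinh_div_cosh]
    exact DifferentiableAt.div (by fun_prop) (by fun_prop) (Real.cosh_pos _).ne'
  have key : (Real.sqrt (Real.tanh (z / 2))) ^ 2 *
      (2 * (Real.exp z / (Real.exp z - 1)) - 1) = 1 := by
    rw [Real.sq_sqrt hTpos.le, hT]
    have := Real.exp_pos z
    field_simp
    ring
  refine ⟨by rw [hphi.deriv]; exact key, ?_⟩
  have h2 := (hr.hasDerivAt.mul hphi.cos).deriv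
  have h3 := (hr.hasDerivAt.mul hphi.sin).deriv
  simp only [Pi.mul_def] at h2 h3
  rw [h2, h3]
  have hsc := Real.sin_sq_add_cos_sq (2 * Real.log (Real.exp z - 1) - z)
  generalize 2 * Real.log (Real.exp z - 1) - z = p at *
  generalize 2 * (Real.exp z / (Real.exp z - 1)) - 1 = q at *
  generalize deriv (fun w => Real.sqrt (Real.tanh (w / 2))) z = d at *
  generalize Real.sqrt (Real.tanh (z / 2)) = r at *
  linear_combination (-(r ^ 2 * q)) * hsc - key
end
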